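/- arXiv:2601.14928 — 3 statements merged into one kernel-verified Lean document; each statement's English description precedes it below -/
import Mathlib

section
/- Let (Ω,d_Ω) be a complete, separable, locally compact metric space, σ a Borel probability measure on Ω, Y = ℝ^d with the Euclidean distance for some d ≥ 1, and fix y0 ∈ ℝ^d. Fix 1 < p < ∞, p ≤ q < ∞, an integer K ≥ 2, weights λ_1,…,λ_K ∈ (0,1) with Σ_k λ_k = 1, and m_1,…,m_K ∈ 𝒫^σ_{p,q}(Ω×ℝ^d). Suppose that for some index k0, for σ-a.e. ω the conditional measure (m_{k0})^ω is absolutely continuous with respect to Lebesgue measure on ℝ^d. Then the function n ↦ Σ_{k=1}^K λ_k scrMK_{p,q}(m_k, n)^p has at most one minimizer in 𝒫^σ_{p,q}(Ω×ℝ^d). -/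
open MeasureTheory ProbabilityTheory ENNReal

/-- The `p`-Monge–Kantorovich (Wasserstein) distance between two measures on a metric
space: the infimum over all couplings `γ` of `μ` and `ν` of the `L^p(γ)`-norm of the
distance function. -/
noncomputable def MK {X : Type*} [PseudoEMetricSpace X] [MeasurableSpace X] (p : ℝ)
    (μ ν : Measure X) : ℝ≥0∞ :=
  ⨅ (γ : Measure (X × X)) (_ : γ.map Prod.fst = μ ∧ γ.map Prod.snd = ν),
    (∫⁻ z, edist z.1 z.2 ^ p ∂γ) ^ (1 / p)

/-- The disintegrated `(p,q)`-Monge–Kantorovich distance on the trivial bundle `Ω × Y`,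
expressed in terms of the fiberwise disintegrations (Markov kernels) `κ`, `η` of the two
measures: the `L^q(σ)`-norm of `ω ↦ MK_p(κ ω, η ω)`. -/
noncomputable def scrMK {Ω Y : Type*} [MeasurableSpace Ω] [PseudoEMetricSpace Y]
    [MeasurableSpace Y] (p : ℝ) (q : ℝ≥0∞) (σ : Measure Ω) (κ η : Kernel Ω Y) : ℝ≥0∞ :=
  if q = ∞ then essSup (fun ω => MK p (κ ω) (η ω)) σ
  else (∫⁻ ω, MK p (κ ω) (η ω) ^ q.toReal ∂σ) ^ (1 / q.toReal)

/-- Membership in `𝒫^σ_{p,q}(Ω × Y)`, with a measure on `Ω × Y` with first marginal `σ`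
encoded by its disintegration: a Markov kernel `κ : Ω → 𝒫(Y)` such that the disintegrated
`(p,q)`-distance to the fiberwise Dirac measure `σ ⊗ δ_{y0}` is finite. -/
def MemP {Ω Y : Type*} [MeasurableSpace Ω] [PseudoEMetricSpace Y] [MeasurableSpace Y]
    (p : ℝ) (q : ℝ≥0∞) (σ : Measure Ω) (y0 : Y) (κ : Kernel Ω Y) : Prop :=
  IsMarkovKernel κ ∧ scrMK p q σ (Kernel.const Ω (Measure.dirac y0)) κ ≠ ∞

section geom
open Filter Topology Set

variable {E : Type*} [NormedAddCommGroup E] [InnerProductSpace ℝ E]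

/-- the gradient of `‖x‖^p` is injective -/
lemma grad_inj {p : ℝ} (hp : 1 < p) {z1 z2 : E} (h : z1 ≠ z2) :
    ((p * ‖z2‖ ^ (p - 2)) • innerSL ℝ z2 - (p * ‖z1‖ ^ (p - 2)) • innerSL ℝ z1 : E →L[ℝ] ℝ) ≠ 0 := by
  intro h0
  apply h
  have h1 : (p * ‖z2‖ ^ (p - 2)) • z2 = (p * ‖z1‖ ^ (p - 2)) • z1 := by
    apply ext_inner_right ℝ
    intro v
    have := congrArg (fun L : E →L[ℝ] ℝ => L v) h0
    simp at this
    rw [inner_smul_left, inner_smul_left]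
    simp
    linarith
  have hn : ∀ z : E, ‖(p * ‖z‖ ^ (p - 2)) • z‖ = p * ‖z‖ ^ (p - 1) := by
    intro z
    rw [norm_smul, Real.norm_of_nonneg (by positivity)]
    by_cases hz : ‖z‖ = 0
    · rw [hz, Real.zero_rpow (by linarith : p - 1 ≠ 0)]; simp
    · have : p - 1 = (p - 2) + 1 := by ring
      rw [this, Real.rpow_add_one hz]; ring
  have h2 : ‖z2‖ = ‖z1‖ := by
    have := congrArg norm h1
    rw [hn, hn] at this
    have h3 : ‖z2‖ ^ (p - 1) = ‖z1‖ ^ (p - 1) := mul_left_cancel₀ (by linarith) this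
    exact (Real.rpow_left_inj (norm_nonneg _) (norm_nonneg _) (by linarith)).1 h3
  by_cases hz : ‖z1‖ = 0
  · rw [hz] at h2
    rw [norm_eq_zero.1 h2, norm_eq_zero.1 hz]
  · rw [h2] at h1
    have : p * ‖z1‖ ^ (p - 2) ≠ 0 := by positivity
    exact (smul_right_injective E this h1).symm

variable [FiniteDimensional ℝ E] [MeasurableSpace E] [BorelSpace E]

/-- two-monotone sets are a.e. single valued -/
lemma ae_unique_of_monotone {p : ℝ} (hp : 1 < p) (μ : Measure E) [μ.IsAddHaarMeasure]
    (Γ : Set (E × E))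
    (hΓ : ∀ z ∈ Γ, ∀ z' ∈ Γ, ‖z.1 - z.2‖ ^ p + ‖z'.1 - z'.2‖ ^ p ≤
      ‖z.1 - z'.2‖ ^ p + ‖z'.1 - z.2‖ ^ p) :
    ∀ᵐ x ∂μ, ∀ y1 y2, (x, y1) ∈ Γ → (x, y2) ∈ Γ → y1 = y2 := by
  let A : Set E → Set E := fun B => {x | ∃ y ∈ B, (x, y) ∈ Γ}
  have hc := TopologicalSpace.countable_countableBasis E
  have hd : ∀ᵐ x ∂μ, ∀ B ∈ TopologicalSpace.countableBasis E, x ∈ A B →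
      Tendsto (fun r => μ (A B ∩ Metric.closedBall x r) / μ (Metric.closedBall x r))
        (𝓝[>] 0) (𝓝 1) := by
    rw [ae_ball_iff hc]
    intro B hB
    exact ae_imp_of_ae_restrict (Besicovitch.ae_tendsto_measure_inter_div μ (A B))
  filter_upwards [hd] with x hx y1 y2 h1 h2
  by_contra hne
  set h : E → ℝ := fun z => ‖z‖ ^ p with hh
  have hder : ∀ z, HasStrictFDerivAt h ((p * ‖z‖ ^ (p - 2)) • innerSL ℝ z : E →L[ℝ] ℝ) z := by
    intro z
    have e := (hasFDerivAt_norm_rpow z hp).fderiv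
    rw [← e]
    exact (contDiff_norm_rpow hp).contDiffAt.hasStrictFDerivAt one_ne_zero
  set L1 : E →L[ℝ] ℝ := (p * ‖x - y1‖ ^ (p - 2)) • innerSL ℝ (x - y1) with hL1
  set L2 : E →L[ℝ] ℝ := (p * ‖x - y2‖ ^ (p - 2)) • innerSL ℝ (x - y2) with hL2
  have hl : L2 - L1 ≠ 0 := grad_inj hp (by intro h; exact hne (sub_right_injective h))
  obtain ⟨v, hv⟩ : ∃ v, 0 < (L2 - L1) v := by
    by_contra hcon
    push Not at hcon
    apply hl
    ext v
    have a := hcon v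
    have b := hcon (-v)
    rw [map_neg] at b
    simp only [zero_apply]
    linarith
  have hv0 : 0 < ‖v‖ := by
    rw [norm_pos_iff]; rintro rfl; simp at hv
  obtain ⟨ε, hε, hεv⟩ : ∃ ε > 0, 2 * ε * ‖v‖ < (L2 - L1) v := by
    refine ⟨(L2 - L1) v / (4 * ‖v‖), by positivity, ?_⟩
    field_simp
    linarith
  let t : Set E := {w | 2 * ε * ‖w‖ < (L2 - L1) w} ∩ Metric.ball 0 (‖v‖ + 1)
  have hto : IsOpen t := by
    apply IsOpen.inter _ Metric.isOpen_ball
    exact isOpen_lt (by fun_prop) (by fun_prop)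
  have htn : t.Nonempty := ⟨v, hεv, by simp⟩
  have b1 := (hder (x - y1)).isLittleO.def hε
  have b2 := (hder (x - y2)).isLittleO.def hε
  rw [nhds_prod_eq] at b1 b2
  -- pull back
  have c1 : ∀ᶠ x' in 𝓝 x, ‖h (x' - y1) - h (x - y1) - L1 (x' - x)‖ ≤ ε * ‖x' - x‖ := by
    have : Tendsto (fun x' : E => (x' - y1, x - y1)) (𝓝 x) (𝓝 (x - y1) ×ˢ 𝓝 (x - y1)) := by
      rw [← nhds_prod_eq]
      exact Continuous.tendsto' (by fun_prop) _ _ rfl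
    filter_upwards [this.eventually b1] with x' hx'
    simp only [sub_sub_sub_cancel_right] at hx'
    exact hx'
  have c2 : ∀ᶠ w in 𝓝 (x, y2), ‖h (w.1 - w.2) - h (x - w.2) - L2 (w.1 - x)‖ ≤ ε * ‖w.1 - x‖ := by
    have : Tendsto (fun w : E × E => (w.1 - w.2, x - w.2)) (𝓝 (x, y2))
        (𝓝 (x - y2) ×ˢ 𝓝 (x - y2)) := by
      rw [← nhds_prod_eq]
      exact Continuous.tendsto' (by fun_prop) _ _ rfl
    filter_upwards [this.eventually b2] with x' hx'
    simp only [sub_sub_sub_cancel_right] at hx'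
    exact hx'
  rw [nhds_prod_eq, eventually_prod_iff] at c2
  obtain ⟨P, hP, Q, hQ, hPQ⟩ := c2
  obtain ⟨B, hB, hyB, hBQ⟩ :=
    (TopologicalSpace.isBasis_countableBasis E).mem_nhds_iff.1 hQ
  have hxA : x ∈ A B := ⟨y2, hyB, h2⟩
  have hex := Measure.eventually_nonempty_inter_smul_of_density_one μ (A B) x (hx B hB hxA) t
    hto.measurableSet (hto.measure_pos μ htn).ne'
  obtain ⟨δ, hδ, hball⟩ := Metric.eventually_nhds_iff_ball.1 (c1.and hP)
  have hsm : ∀ᶠ r in 𝓝[>] (0:ℝ), r * (‖v‖ + 1) < δ := by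
    have : Tendsto (fun r : ℝ => r * (‖v‖ + 1)) (𝓝[>] 0) (𝓝 0) :=
      (Continuous.tendsto' (by fun_prop) _ _ (by simp)).mono_left nhdsWithin_le_nhds
    exact this.eventually (gt_mem_nhds hδ)
  obtain ⟨r, ⟨⟨x', hx'A, hx't⟩, hrδ⟩, hr⟩ := ((hex.and hsm).and self_mem_nhdsWithin).exists
  replace hr : 0 < r := hr
  obtain ⟨a, ha, w', ⟨w, hw, rfl⟩, hxw⟩ := hx't
  rw [mem_singleton_iff] at ha
  subst ha
  simp only at hxw
  obtain ⟨y2', hy2B, hy2Γ⟩ := hx'A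
  have hx'x : x' - a = r • w := by rw [← hxw]; simp
  have hdist : x' ∈ Metric.ball a δ := by
    rw [mem_ball_iff_norm, hx'x, norm_smul, Real.norm_of_nonneg hr.le]
    have : ‖w‖ < ‖v‖ + 1 := by simpa using hw.2
    nlinarith
  obtain ⟨d1, d2⟩ := hball x' hdist
  have d3 := hPQ d2 (hBQ hy2B)
  simp only at d3
  have hm := hΓ _ h1 _ hy2Γ
  simp only at hm
  rw [hx'x] at d1 d3
  rw [norm_smul, Real.norm_of_nonneg hr.le, Real.norm_eq_abs, abs_le] at d1 d3
  have hw1 : 2 * ε * ‖w‖ < L2 w - L1 w := by simpa using hw.1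
  have hw2 : r * (2 * ε * ‖w‖) < r * (L2 w - L1 w) := by gcongr
  simp only [map_smul, smul_eq_mul, hh] at d1 d3
  nlinarith [d1.1, d1.2, d3.1, d3.2]
end geom

section swap
open Filter Topology Set

/-- optimal plans are almost surely two-monotone -/
lemma swap_null {X Y : Type*} [MeasurableSpace X] [MeasurableSpace Y] (γ : Measure (X × Y))
    [IsProbabilityMeasure γ] (c : X × Y → ℝ≥0∞) (hc : Measurable c)
    (hfin : ∫⁻ z, c z ∂γ ≠ ∞)
    (hopt : ∀ γ' : Measure (X × Y), γ'.map Prod.fst = γ.map Prod.fst →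
      γ'.map Prod.snd = γ.map Prod.snd → ∫⁻ z, c z ∂γ ≤ ∫⁻ z, c z ∂γ') :
    (γ.prod γ) {w | c (w.1.1, w.2.2) + c (w.2.1, w.1.2) < c w.1 + c w.2} = 0 := by
  classical
  set D : Set ((X × Y) × (X × Y)) := {w | c (w.1.1, w.2.2) + c (w.2.1, w.1.2) < c w.1 + c w.2}
    with hDdef
  have hD : MeasurableSet D := measurableSet_lt (by fun_prop) (by fun_prop)
  have hDs : Prod.swap ⁻¹' D = D := by
    ext w
    simp only [hDdef, mem_preimage, mem_ofPred_eq, Prod.swap]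
    rw [add_comm, add_comm (c w.2)]
  have hsw : ∀ G : (X × Y) × (X × Y) → ℝ≥0∞, Measurable G →
      ∫⁻ w in D, G w.swap ∂(γ.prod γ) = ∫⁻ w in D, G w ∂(γ.prod γ) := by
    intro G hG
    have := (Measure.measurePreserving_swap (μ := γ) (ν := γ)).setLIntegral_comp_preimage hD hG
    rwa [hDs] at this
  let T : (X × Y) × (X × Y) → X × Y := fun w => (w.1.1, if w ∈ D then w.2.2 else w.1.2)
  have hT : Measurable T := by
    refine Measurable.prodMk (by fun_prop) (Measurable.ite hD (by fun_prop) (by fun_prop))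
  have hlint : ∀ f : X × Y → ℝ≥0∞, Measurable f →
      ∫⁻ z, f z ∂((γ.prod γ).map T) = ∫⁻ w in D, f (w.1.1, w.2.2) ∂(γ.prod γ)
        + ∫⁻ w in Dᶜ, f w.1 ∂(γ.prod γ) := by
    intro f hf
    rw [lintegral_map hf hT, ← lintegral_add_compl _ hD]
    congr 1
    · refine setLIntegral_congr_fun hD fun w hw => ?_
      simp only [T, if_pos hw]
    · refine setLIntegral_congr_fun hD.compl fun w hw => ?_
      simp only [T, if_neg hw]
  have hlint0 : ∀ f : X × Y → ℝ≥0∞, Measurable f →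
      ∫⁻ z, f z ∂γ = ∫⁻ w in D, f w.1 ∂(γ.prod γ) + ∫⁻ w in Dᶜ, f w.1 ∂(γ.prod γ) := by
    intro f hf
    rw [lintegral_add_compl _ hD]
    have := (measurePreserving_fst (μ := γ) (ν := γ)).lintegral_comp hf
    exact this.symm
  have h1 : ((γ.prod γ).map T).map Prod.fst = γ.map Prod.fst := by
    refine Measure.ext_of_lintegral _ fun f hf => ?_
    rw [lintegral_map hf measurable_fst, lintegral_map hf measurable_fst,
      hlint _ (by fun_prop), hlint0 _ (by fun_prop)]
  have h2 : ((γ.prod γ).map T).map Prod.snd = γ.map Prod.snd := by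
    refine Measure.ext_of_lintegral _ fun f hf => ?_
    rw [lintegral_map hf measurable_snd, lintegral_map hf measurable_snd,
      hlint _ (by fun_prop), hlint0 _ (by fun_prop)]
    congr 1
    exact hsw (fun w => f w.1.2) (by fun_prop)
  have h3 := hopt _ h1 h2
  rw [hlint _ hc] at h3
  have h4 := hlint0 _ hc
  rw [h4] at h3
  rw [h4] at hfin
  have hA : ∫⁻ w in D, c w.1 ∂(γ.prod γ) ≠ ∞ := fun h => hfin (by simp [h])
  have hB : ∫⁻ w in Dᶜ, c w.1 ∂(γ.prod γ) ≠ ∞ := fun h => hfin (by simp [h])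
  have h5 : ∫⁻ w in D, c w.1 ∂(γ.prod γ) ≤ ∫⁻ w in D, c (w.1.1, w.2.2) ∂(γ.prod γ) :=
    (ENNReal.add_le_add_iff_right hB).1 h3
  have s1 : ∫⁻ w in D, c w.2 ∂(γ.prod γ) = ∫⁻ w in D, c w.1 ∂(γ.prod γ) :=
    hsw (fun w => c w.1) (by fun_prop)
  have s2 : ∫⁻ w in D, c (w.2.1, w.1.2) ∂(γ.prod γ) = ∫⁻ w in D, c (w.1.1, w.2.2) ∂(γ.prod γ) :=
    hsw (fun w => c (w.1.1, w.2.2)) (by fun_prop)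
  have h6 : ∫⁻ w in D, (c w.1 + c w.2) ∂(γ.prod γ) ≤
      ∫⁻ w in D, (c (w.1.1, w.2.2) + c (w.2.1, w.1.2)) ∂(γ.prod γ) := by
    rw [lintegral_add_left (by fun_prop), lintegral_add_left (by fun_prop), s1, s2]
    gcongr
  have hle : (fun w : (X × Y) × (X × Y) => c (w.1.1, w.2.2) + c (w.2.1, w.1.2))
      ≤ᵐ[(γ.prod γ).restrict D] fun w => c w.1 + c w.2 := by
    filter_upwards [ae_restrict_mem hD] with w hw
    exact le_of_lt hw
  have hfin2 : ∫⁻ w in D, (c (w.1.1, w.2.2) + c (w.2.1, w.1.2)) ∂(γ.prod γ) ≠ ∞ := by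
    refine ne_top_of_le_ne_top ?_ (lintegral_mono_ae hle)
    rw [lintegral_add_left (by fun_prop), s1]
    exact ENNReal.add_ne_top.2 ⟨hA, hA⟩
  have h7 := ae_eq_of_ae_le_of_lintegral_le hle hfin2 (by fun_prop) h6
  have h8 : ∀ᵐ w ∂((γ.prod γ).restrict D), False := by
    filter_upwards [h7, ae_restrict_mem hD] with w hw hw'
    exact (ne_of_lt hw') hw
  rw [← Measure.restrict_eq_zero]
  simpa using h8

variable {E : Type*} [NormedAddCommGroup E] [InnerProductSpace ℝ E]
  [FiniteDimensional ℝ E] [MeasurableSpace E] [BorelSpace E]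

lemma edist_rpow_eq {p : ℝ} (hp : 1 < p) (x y : E) :
    edist x y ^ p = ENNReal.ofReal (‖x - y‖ ^ p) := by
  rw [edist_dist, dist_eq_norm, ENNReal.ofReal_rpow_of_nonneg (norm_nonneg _) (by linarith)]

/-- If the average of two plans with common absolutely continuous first marginal is optimal,
then the second marginals agree. -/
lemma snd_eq_of_optimal {p : ℝ} (hp : 1 < p) (μ vol : Measure E) [vol.IsAddHaarMeasure]
    (hac : μ ≪ vol)
    (γ1 γ2 : Measure (E × E)) [IsProbabilityMeasure γ1] [IsProbabilityMeasure γ2]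
    (h1 : γ1.map Prod.fst = μ) (h2 : γ2.map Prod.fst = μ)
    (γ : Measure (E × E)) [IsProbabilityMeasure γ] (ha1 : γ1 ≪ γ) (ha2 : γ2 ≪ γ)
    (hfin : ∫⁻ z, edist z.1 z.2 ^ p ∂γ ≠ ∞)
    (hopt : ∀ γ' : Measure (E × E), γ'.map Prod.fst = γ.map Prod.fst →
      γ'.map Prod.snd = γ.map Prod.snd →
      ∫⁻ z, edist z.1 z.2 ^ p ∂γ ≤ ∫⁻ z, edist z.1 z.2 ^ p ∂γ') :
    γ1.map Prod.snd = γ2.map Prod.snd := by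
  have hcc : Continuous (fun z : E × E => edist z.1 z.2 ^ p) :=
    (ENNReal.continuous_rpow_const).comp continuous_edist
  have hnull := swap_null γ (fun z => edist z.1 z.2 ^ p) hcc.measurable hfin hopt
  set Γ := γ.support with hΓdef
  have hΓc : IsClosed Γ := Measure.isClosed_support
  have hmono : ∀ z ∈ Γ, ∀ z' ∈ Γ, ‖z.1 - z.2‖ ^ p + ‖z'.1 - z'.2‖ ^ p ≤
      ‖z.1 - z'.2‖ ^ p + ‖z'.1 - z.2‖ ^ p := by
    intro z hz z' hz'
    by_contra hcon
    push Not at hcon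
    set D : Set ((E × E) × (E × E)) := {w | edist w.1.1 w.2.2 ^ p + edist w.2.1 w.1.2 ^ p <
      edist w.1.1 w.1.2 ^ p + edist w.2.1 w.2.2 ^ p} with hD
    have hDo : IsOpen D := by
      refine isOpen_lt ?_ ?_
      · exact (hcc.comp (by fun_prop : Continuous fun w : (E × E) × (E × E) => (w.1.1, w.2.2))).add
          (hcc.comp (by fun_prop : Continuous fun w : (E × E) × (E × E) => (w.2.1, w.1.2)))
      · exact (hcc.comp (by fun_prop : Continuous fun w : (E × E) × (E × E) => w.1)).add
          (hcc.comp (by fun_prop : Continuous fun w : (E × E) × (E × E) => w.2))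
    have hzD : (z, z') ∈ D := by
      simp only [hD, mem_ofPred_eq, edist_rpow_eq hp]
      rw [← ENNReal.ofReal_add (by positivity) (by positivity),
        ← ENNReal.ofReal_add (by positivity) (by positivity)]
      exact (ENNReal.ofReal_lt_ofReal_iff_of_nonneg (by positivity)).2 hcon
    obtain ⟨U, hU, V, hV, hUV⟩ := mem_nhds_prod_iff.1 (hDo.mem_nhds hzD)
    have hpos : 0 < γ U * γ V := ENNReal.mul_pos
      ((Measure.mem_support_iff_forall _).1 hz U hU).ne'
      ((Measure.mem_support_iff_forall _).1 hz' V hV).ne'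
    rw [← Measure.prod_prod] at hpos
    exact absurd (measure_mono_null hUV hnull) hpos.ne'
  have huniq := hac.ae_le (ae_unique_of_monotone hp vol Γ hmono)
  have hsup : Γ ∈ ae γ := Measure.support_mem_ae
  have key : ∀ B : Set E, IsCompact B → ∀ γ' : Measure (E × E), γ' ≪ γ →
      γ'.map Prod.fst = μ → γ'.map Prod.snd B = μ (Prod.fst '' (Γ ∩ Prod.snd ⁻¹' B)) := by
    intro B hB γ' hg hg1
    have hcl : IsClosed (Prod.fst '' (Γ ∩ Prod.snd ⁻¹' B)) := by
      have : Prod.fst '' (Γ ∩ Prod.snd ⁻¹' B) =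
          Prod.fst '' ((fun z : E × B => (z.1, (z.2 : E))) ⁻¹' Γ) := by
        ext x
        constructor
        · rintro ⟨⟨a, b⟩, ⟨h, h'⟩, rfl⟩
          exact ⟨(a, ⟨b, h'⟩), h, rfl⟩
        · rintro ⟨⟨a, b⟩, h, rfl⟩
          exact ⟨(a, b), ⟨h, b.2⟩, rfl⟩
      rw [this]
      haveI : CompactSpace B := isCompact_iff_compactSpace.1 hB
      exact isClosedMap_fst_of_compactSpace _ (hΓc.preimage (by fun_prop))
    rw [Measure.map_apply measurable_snd hB.measurableSet, ← hg1,
      Measure.map_apply measurable_fst hcl.measurableSet]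
    rw [← hg1] at huniq
    have hu := ae_of_ae_map measurable_fst.aemeasurable huniq
    refine measure_congr ?_
    filter_upwards [hu, hg.ae_le hsup] with z hz hzΓ
    refine propext ⟨fun h => ⟨z, ⟨hzΓ, h⟩, rfl⟩, ?_⟩
    rintro ⟨⟨a, b⟩, ⟨h, h'⟩, hab⟩
    simp only at hab
    subst hab
    have := hz b z.2 h hzΓ
    change z.2 ∈ B
    rw [← this]; exact h'
  haveI : IsProbabilityMeasure (γ1.map Prod.snd) :=
    Measure.isProbabilityMeasure_map measurable_snd.aemeasurable
  haveI : IsProbabilityMeasure (γ2.map Prod.snd) :=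
    Measure.isProbabilityMeasure_map measurable_snd.aemeasurable
  have hK : ∀ B : Set E, IsCompact B → γ1.map Prod.snd B = γ2.map Prod.snd B := fun B hB => by
    rw [key B hB γ1 ha1 h1, key B hB γ2 ha2 h2]
  refine Measure.ext fun s hs => ?_
  rw [hs.measure_eq_iSup_isCompact, hs.measure_eq_iSup_isCompact]
  exact iSup_congr fun K => iSup_congr fun _ => iSup_congr fun h => hK K h
end swap

section compactness
open Filter Topology Set
open scoped NNReal

/-- The transport cost. -/
noncomputable def Wc {X : Type*} [PseudoEMetricSpace X] [MeasurableSpace X] (p : ℝ)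
    (μ ν : Measure X) : ℝ≥0∞ :=
  ⨅ (γ : Measure (X × X)) (_ : γ.map Prod.fst = μ ∧ γ.map Prod.snd = ν),
    ∫⁻ z, edist z.1 z.2 ^ p ∂γ

lemma Wc_le {X : Type*} [PseudoEMetricSpace X] [MeasurableSpace X] (p : ℝ)
    {μ ν : Measure X} {γ : Measure (X × X)} (h : γ.map Prod.fst = μ ∧ γ.map Prod.snd = ν) :
    Wc p μ ν ≤ ∫⁻ z, edist z.1 z.2 ^ p ∂γ :=
  iInf₂_le (f := fun (γ : Measure (X × X)) (_ : γ.map Prod.fst = μ ∧ γ.map Prod.snd = ν) =>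
    ∫⁻ z, edist z.1 z.2 ^ p ∂γ) γ h

lemma MK_eq {X : Type*} [PseudoEMetricSpace X] [MeasurableSpace X] {p : ℝ} (hp : 0 < p)
    (μ ν : Measure X) : MK p μ ν = Wc p μ ν ^ (1 / p) := by
  have h : ∀ x : ℝ≥0∞, x ^ (1 / p) = ENNReal.orderIsoRpow (1 / p) (by positivity) x := fun x => rfl
  unfold MK Wc
  simp only [h, OrderIso.map_iInf]

lemma MK_rpow {X : Type*} [PseudoEMetricSpace X] [MeasurableSpace X] {p : ℝ} (hp : 0 < p)
    (μ ν : Measure X) : MK p μ ν ^ p = Wc p μ ν := by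
  rw [MK_eq hp, ← ENNReal.rpow_mul, one_div_mul_cancel hp.ne', ENNReal.rpow_one]

lemma lsc_lintegral {X : Type*} [TopologicalSpace X] [MeasurableSpace X] [OpensMeasurableSpace X]
    (f : X → ℝ≥0∞) (hf : Continuous f) (hfin : ∀ x, f x ≠ ∞) :
    LowerSemicontinuous fun γ : ProbabilityMeasure X => ∫⁻ x, f x ∂(γ : Measure X) := by
  have hg : Continuous fun x => (f x).toNNReal := by
    rw [continuous_iff_continuousAt]
    intro x
    exact (ENNReal.tendsto_toNNReal (hfin x)).comp hf.continuousAt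
  let F : ℕ → BoundedContinuousFunction X ℝ≥0 := fun n =>
    BoundedContinuousFunction.mkOfBound ⟨fun x => min (f x).toNNReal n, hg.min continuous_const⟩ n
      (by
        intro x y
        have h1 : min (f x).toNNReal (n : ℝ≥0) ≤ n := min_le_right _ _
        have h2 : min (f y).toNNReal (n : ℝ≥0) ≤ n := min_le_right _ _
        simp only [ContinuousMap.coe_mk, NNReal.dist_eq]
        have h1' : ((min (f x).toNNReal (n : ℝ≥0) : ℝ≥0) : ℝ) ≤ n := by exact_mod_cast h1
        have h2' : ((min (f y).toNNReal (n : ℝ≥0) : ℝ≥0) : ℝ) ≤ n := by exact_mod_cast h2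
        have h3 := NNReal.coe_nonneg (min (f x).toNNReal (n : ℝ≥0))
        have h4 := NNReal.coe_nonneg (min (f y).toNNReal (n : ℝ≥0))
        rw [abs_le]; constructor <;> linarith)
  have hF : ∀ n x, F n x = min (f x).toNNReal (n : ℝ≥0) := fun n x => rfl
  have hsup : ∀ x, f x = ⨆ n, (F n x : ℝ≥0∞) := by
    intro x
    apply le_antisymm
    · obtain ⟨n, hn⟩ := exists_nat_ge (f x).toNNReal
      refine le_iSup_of_le n ?_
      rw [hF, min_eq_left hn, ENNReal.coe_toNNReal (hfin x)]
    · refine iSup_le fun n => ?_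
      rw [hF]
      calc ((min (f x).toNNReal (n : ℝ≥0) : ℝ≥0) : ℝ≥0∞) ≤ ((f x).toNNReal : ℝ≥0∞) := by
            exact_mod_cast min_le_left _ _
        _ = f x := ENNReal.coe_toNNReal (hfin x)
  have : (fun γ : ProbabilityMeasure X => ∫⁻ x, f x ∂(γ : Measure X)) =
      fun γ : ProbabilityMeasure X => ⨆ n, ∫⁻ x, F n x ∂(γ : Measure X) := by
    ext γ
    rw [← lintegral_iSup]
    · exact lintegral_congr hsup
    · intro n
      exact (ENNReal.continuous_coe.comp (F n).continuous).measurable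
    · intro m n hmn x
      simp only [hF]
      gcongr
  rw [this]
  exact lowerSemicontinuous_iSup fun n =>
    (ProbabilityMeasure.continuous_lintegral_boundedContinuousFunction (F n)).lowerSemicontinuous

variable {E : Type*} [NormedAddCommGroup E] [InnerProductSpace ℝ E]
  [FiniteDimensional ℝ E] [MeasurableSpace E] [BorelSpace E]

lemma cont_cost (p : ℝ) (y0 : E) : Continuous fun z : E × E => edist y0 z.1 ^ p + edist y0 z.2 ^ p := by
  have h : Continuous fun x : ℝ≥0∞ => x ^ p := ENNReal.continuous_rpow_const
  exact (h.comp (by fun_prop)).add (h.comp (by fun_prop))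

/-- plans with bounded moments are compact -/
lemma isCompact_moment {p : ℝ} (hp : 1 < p) (y0 : E) (R : ℝ≥0∞) (hR : R ≠ ∞) :
    IsCompact {γ : ProbabilityMeasure (E × E) |
      ∫⁻ z, (edist y0 z.1 ^ p + edist y0 z.2 ^ p) ∂(γ : Measure (E × E)) ≤ R} := by
  have hp0 : 0 < p := by linarith
  have hfin : ∀ z : E × E, edist y0 z.1 ^ p + edist y0 z.2 ^ p ≠ ∞ := fun z =>
    ENNReal.add_ne_top.2 ⟨ENNReal.rpow_ne_top_of_nonneg hp0.le (edist_ne_top _ _),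
      ENNReal.rpow_ne_top_of_nonneg hp0.le (edist_ne_top _ _)⟩
  have hcl : IsClosed {γ : ProbabilityMeasure (E × E) |
      ∫⁻ z, (edist y0 z.1 ^ p + edist y0 z.2 ^ p) ∂(γ : Measure (E × E)) ≤ R} :=
    (lsc_lintegral _ (cont_cost p y0) hfin).isClosed_preimage R
  rw [← hcl.closure_eq]
  apply isCompact_closure_of_isTightMeasureSet
  rw [isTightMeasureSet_iff_exists_isCompact_measure_compl_le]
  intro ε hε
  obtain ⟨n, hn⟩ := ENNReal.exists_nat_mul_gt hε.ne' hR
  refine ⟨{z | edist y0 z.1 ^ p + edist y0 z.2 ^ p ≤ n}, ?_, ?_⟩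
  · have hb : {z : E × E | edist y0 z.1 ^ p + edist y0 z.2 ^ p ≤ n} ⊆
        Metric.closedBall (y0, y0) ((n : ℝ) ^ (1 / p)) := by
      have key : ∀ y : E, edist y0 y ^ p ≤ n → dist y y0 ≤ (n : ℝ) ^ (1 / p) := by
        intro y hy
        rw [edist_rpow_eq hp] at hy
        have : ‖y0 - y‖ ^ p ≤ n := by
          rw [← ENNReal.ofReal_natCast] at hy
          exact (ENNReal.ofReal_le_ofReal_iff (by positivity)).1 hy
        rw [dist_comm, dist_eq_norm]
        rw [one_div]
        exact (Real.le_rpow_inv_iff_of_pos (norm_nonneg _) (by positivity) hp0).2 this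
      intro z hz
      rw [Metric.mem_closedBall, Prod.dist_eq]
      exact max_le (key _ (le_trans le_self_add hz)) (key _ (le_trans le_add_self hz))
    exact (isCompact_closedBall _ _).of_isClosed_subset
      (isClosed_le (cont_cost p y0) continuous_const) hb
  · rintro _ ⟨γ, hγ, rfl⟩
    have hM := mul_meas_ge_le_lintegral (μ := (γ : Measure (E × E))) (cont_cost p y0).measurable n
    have : (γ : Measure (E × E)) {z | edist y0 z.1 ^ p + edist y0 z.2 ^ p ≤ n}ᶜ ≤
        (γ : Measure (E × E)) {z | (n : ℝ≥0∞) ≤ edist y0 z.1 ^ p + edist y0 z.2 ^ p} := by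
      apply measure_mono
      intro z hz
      rw [mem_compl_iff, mem_ofPred_eq, not_le] at hz
      exact hz.le
    refine this.trans ?_
    by_contra hcon
    push Not at hcon
    have : (n : ℝ≥0∞) * ε ≤ R := le_trans (by gcongr) (hM.trans hγ)
    exact absurd hn (not_lt.2 this)

lemma coupling_prob {X : Type*} [MeasurableSpace X] {γ : Measure (X × X)} {μ : Measure X}
    [IsProbabilityMeasure μ] (h : γ.map Prod.fst = μ) : IsProbabilityMeasure γ := by
  constructor
  have := congrArg (fun m => m univ) h
  simpa [Measure.map_apply measurable_fst MeasurableSet.univ] using this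

lemma coupling_moment {p : ℝ} (y0 : E) {γ : Measure (E × E)} {μ ν : Measure E}
    (h : γ.map Prod.fst = μ ∧ γ.map Prod.snd = ν) :
    ∫⁻ z, (edist y0 z.1 ^ p + edist y0 z.2 ^ p) ∂γ =
      ∫⁻ y, edist y0 y ^ p ∂μ + ∫⁻ y, edist y0 y ^ p ∂ν := by
  rw [← h.1, ← h.2, lintegral_map (by fun_prop) (by fun_prop),
    lintegral_map (by fun_prop) (by fun_prop), lintegral_add_left (by fun_prop)]

lemma lsc_cost {p : ℝ} (hp : 1 < p) : LowerSemicontinuous fun γ : ProbabilityMeasure (E × E) =>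
    ∫⁻ z, edist z.1 z.2 ^ p ∂(γ : Measure (E × E)) :=
  lsc_lintegral (fun z : E × E => edist z.1 z.2 ^ p)
    ((ENNReal.continuous_rpow_const).comp continuous_edist)
    (fun z => ENNReal.rpow_ne_top_of_nonneg (by linarith) (edist_ne_top _ _))

lemma exists_optimal {p : ℝ} (hp : 1 < p) (y0 : E) (μ ν : Measure E) [IsProbabilityMeasure μ]
    [IsProbabilityMeasure ν] (hμ : ∫⁻ y, edist y0 y ^ p ∂μ ≠ ∞) (hν : ∫⁻ y, edist y0 y ^ p ∂ν ≠ ∞) :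
    ∃ γ : Measure (E × E), IsProbabilityMeasure γ ∧ γ.map Prod.fst = μ ∧ γ.map Prod.snd = ν ∧
      ∫⁻ z, edist z.1 z.2 ^ p ∂γ = Wc p μ ν := by
  let μ' : ProbabilityMeasure E := ⟨μ, inferInstance⟩
  let ν' : ProbabilityMeasure E := ⟨ν, inferInstance⟩
  have hK := isCompact_moment (E := E) hp y0 _ (ENNReal.add_ne_top.2 ⟨hμ, hν⟩)
  let S : Set (ProbabilityMeasure (E × E)) :=
    {γ | γ.map measurable_fst.aemeasurable = μ' ∧ γ.map measurable_snd.aemeasurable = ν'}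
  have hS : IsClosed S := by
    refine IsClosed.inter ?_ ?_
    · exact isClosed_eq (ProbabilityMeasure.continuous_map continuous_fst) continuous_const
    · exact isClosed_eq (ProbabilityMeasure.continuous_map continuous_snd) continuous_const
  have hSm : ∀ γ : ProbabilityMeasure (E × E), γ ∈ S ↔
      (γ : Measure (E × E)).map Prod.fst = μ ∧ (γ : Measure (E × E)).map Prod.snd = ν := by
    intro γ
    exact and_congr Subtype.ext_iff Subtype.ext_iff
  have hSc : IsCompact S := hK.of_isClosed_subset hS fun γ hγ =>
    (coupling_moment y0 ((hSm γ).1 hγ)).le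
  have hne : S.Nonempty := ⟨⟨μ.prod ν, inferInstance⟩, (hSm _).2 (by
    constructor
    · exact Measure.fst_prod
    · exact Measure.snd_prod)⟩
  obtain ⟨γ, hγ, hmin⟩ := ((lsc_cost hp).lowerSemicontinuousOn S).exists_isMinOn hne hSc
  have hγ' := (hSm γ).1 hγ
  refine ⟨γ, inferInstance, hγ'.1, hγ'.2, le_antisymm ?_ ?_⟩
  · refine le_iInf₂ fun γ2 h2 => ?_
    have := coupling_prob h2.1
    exact hmin (a := ⟨γ2, this⟩) ((hSm _).2 h2)
  · exact Wc_le p hγ'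

lemma cont_charFun (t : E) {f : E × E → E} (hf : Continuous f) :
    Continuous fun γ : ProbabilityMeasure (E × E) =>
      charFun ((γ : Measure (E × E)).map f) t := by
  rw [continuous_iff_continuousAt]
  intro γ
  have h := ProbabilityMeasure.tendsto_map_of_tendsto_of_continuous (fun i => i) γ tendsto_id hf
  rw [ProbabilityMeasure.tendsto_iff_forall_integral_rclike_tendsto ℂ] at h
  simp only [charFun_eq_integral_innerProbChar]
  exact h (BoundedContinuousFunction.innerProbChar t)

/-- measurability of the fiberwise cost -/
lemma aemeasurable_Wc {Ω : Type*} [MeasurableSpace Ω] {p : ℝ} (hp : 1 < p) (y0 : E)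
    (σ : Measure Ω) (κ η : Kernel Ω E) [IsMarkovKernel κ] [IsMarkovKernel η]
    (hκ : ∀ᵐ ω ∂σ, ∫⁻ y, edist y0 y ^ p ∂(κ ω) ≠ ∞)
    (hη : ∀ᵐ ω ∂σ, ∫⁻ y, edist y0 y ^ p ∂(η ω) ≠ ∞) :
    AEMeasurable (fun ω => Wc p (κ ω) (η ω)) σ := by
  classical
  let M : Ω → ℝ≥0∞ := fun ω => ∫⁻ y, edist y0 y ^ p ∂(κ ω) + ∫⁻ y, edist y0 y ^ p ∂(η ω)
  have hM : Measurable M := (Measurable.lintegral_kernel (by fun_prop)).add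
    (Measurable.lintegral_kernel (by fun_prop))
  refine ⟨fun ω => if M ω = ∞ then 0 else Wc p (κ ω) (η ω), ?_, ?_⟩
  swap
  · filter_upwards [hκ, hη] with ω h1 h2
    rw [if_neg (ENNReal.add_ne_top.2 ⟨h1, h2⟩)]
  refine measurable_of_Iic fun a => ?_
  let e : Ω → (ℕ → ℂ) × (ℕ → ℂ) := fun ω =>
    (fun n => charFun (κ ω) (TopologicalSpace.denseSeq E n),
     fun n => charFun (η ω) (TopologicalSpace.denseSeq E n))
  have hmch : ∀ (κ : Kernel Ω E) [IsMarkovKernel κ] (t : E), Measurable fun ω => charFun (κ ω) t := by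
    intro κ _ t
    have hs : StronglyMeasurable fun x : E => Complex.exp ((inner ℝ x t : ℝ) * Complex.I) :=
      Continuous.stronglyMeasurable (by fun_prop)
    have := hs.integral_kernel (κ := κ)
    simpa only [charFun_apply] using this.measurable
  have he : Measurable e :=
    Measurable.prodMk (measurable_pi_lambda _ fun n => hmch κ _)
      (measurable_pi_lambda _ fun n => hmch η _)
  let G : ProbabilityMeasure (E × E) → (ℕ → ℂ) × (ℕ → ℂ) := fun γ =>
    (fun n => charFun ((γ : Measure (E × E)).map Prod.fst) (TopologicalSpace.denseSeq E n),
     fun n => charFun ((γ : Measure (E × E)).map Prod.snd) (TopologicalSpace.denseSeq E n))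
  have hG : Continuous G := Continuous.prodMk
    (continuous_pi fun n => cont_charFun _ continuous_fst)
    (continuous_pi fun n => cont_charFun _ continuous_snd)
  have hinj : ∀ μ ν : Measure E, IsProbabilityMeasure μ → IsProbabilityMeasure ν →
      (∀ n, charFun μ (TopologicalSpace.denseSeq E n) = charFun ν (TopologicalSpace.denseSeq E n)) →
      μ = ν := by
    intro μ ν _ _ h
    apply Measure.ext_of_charFun
    refine Continuous.ext_on (TopologicalSpace.denseRange_denseSeq E)
      continuous_charFun continuous_charFun ?_
    rintro _ ⟨n, rfl⟩
    exact h n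
  let C : ℕ → Set (ProbabilityMeasure (E × E)) := fun R =>
    {γ | ∫⁻ z, (edist y0 z.1 ^ p + edist y0 z.2 ^ p) ∂(γ : Measure (E × E)) ≤ R} ∩
    {γ | ∫⁻ z, edist z.1 z.2 ^ p ∂(γ : Measure (E × E)) ≤ a}
  have hC : ∀ R, IsCompact (C R) := fun R =>
    (isCompact_moment hp y0 R (by simp)).inter_right ((lsc_cost hp).isClosed_preimage a)
  have heq : (fun ω => if M ω = ∞ then 0 else Wc p (κ ω) (η ω)) ⁻¹' (Iic a) =
      {ω | M ω = ∞} ∪ ⋃ R : ℕ, (e ⁻¹' (G '' (C R))) := by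
    ext ω
    simp only [mem_preimage, mem_Iic, mem_union, mem_ofPred_eq, mem_iUnion]
    by_cases hω : M ω = ∞
    · simp [hω]
    · simp only [hω, if_false, false_or]
      have hω' := ENNReal.add_ne_top.1 hω
      constructor
      · intro hle
        obtain ⟨γ, hγ, h1, h2, h3⟩ := exists_optimal hp y0 (κ ω) (η ω) hω'.1 hω'.2
        obtain ⟨R, hR⟩ := ENNReal.exists_nat_gt hω
        refine ⟨R, ⟨γ, hγ⟩, ⟨?_, ?_⟩, ?_⟩
        · exact (coupling_moment y0 ⟨h1, h2⟩).le.trans hR.le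
        · exact h3.le.trans hle
        · simp only [G, e, ProbabilityMeasure.coe_mk, h1, h2]
      · rintro ⟨R, γ, ⟨hγ1, hγ2⟩, hGe⟩
        have h1 : (γ : Measure (E × E)).map Prod.fst = κ ω :=
          hinj _ _ (Measure.isProbabilityMeasure_map measurable_fst.aemeasurable) inferInstance
            fun n => congrFun (congrArg Prod.fst hGe) n
        have h2 : (γ : Measure (E × E)).map Prod.snd = η ω :=
          hinj _ _ (Measure.isProbabilityMeasure_map measurable_snd.aemeasurable) inferInstance
            fun n => congrFun (congrArg Prod.snd hGe) n
        exact (Wc_le p ⟨h1, h2⟩).trans hγ2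
  rw [heq]
  refine (hM (measurableSet_singleton ∞)).union (MeasurableSet.iUnion fun R => ?_)
  exact he ((hC R).image hG).isClosed.measurableSet
end compactness

section fiber
open Filter Topology Set
open scoped NNReal

variable {E : Type*} [NormedAddCommGroup E] [InnerProductSpace ℝ E]
  [FiniteDimensional ℝ E] [MeasurableSpace E] [BorelSpace E]

lemma Wc_dirac {p : ℝ} (y0 : E) (ν : Measure E) [IsProbabilityMeasure ν] :
    Wc p (Measure.dirac y0) ν = ∫⁻ y, edist y0 y ^ p ∂ν := by
  have key : ∀ γ : Measure (E × E), γ.map Prod.fst = Measure.dirac y0 ∧ γ.map Prod.snd = ν →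
      ∫⁻ z, edist z.1 z.2 ^ p ∂γ = ∫⁻ y, edist y0 y ^ p ∂ν := by
    intro γ h
    rw [← h.2, lintegral_map (by fun_prop) (by fun_prop)]
    have h1 : ∀ᵐ x ∂(γ.map Prod.fst), x = y0 := by
      rw [h.1, ae_dirac_eq]; rfl
    refine lintegral_congr_ae ?_
    filter_upwards [ae_of_ae_map measurable_fst.aemeasurable h1] with z hz
    rw [hz]
  apply le_antisymm
  · have hc : ((Measure.dirac y0).prod ν).map Prod.fst = Measure.dirac y0 ∧
        ((Measure.dirac y0).prod ν).map Prod.snd = ν :=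
      ⟨Measure.fst_prod, Measure.snd_prod⟩
    rw [← key _ hc]
    exact Wc_le p hc
  · exact le_iInf₂ fun γ h => (key γ h).ge

lemma Wc_le_moment {p : ℝ} (hp : 1 < p) (y0 : E) (μ ν : Measure E) [IsProbabilityMeasure μ]
    [IsProbabilityMeasure ν] :
    Wc p μ ν ≤ 2 ^ (p - 1) * (∫⁻ y, edist y0 y ^ p ∂μ + ∫⁻ y, edist y0 y ^ p ∂ν) := by
  have hc : (μ.prod ν).map Prod.fst = μ ∧ (μ.prod ν).map Prod.snd = ν :=
    ⟨Measure.fst_prod, Measure.snd_prod⟩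
  refine (Wc_le p hc).trans ?_
  rw [← coupling_moment y0 hc, ← lintegral_const_mul _ (cont_cost p y0).measurable]
  refine lintegral_mono fun z => ?_
  calc edist z.1 z.2 ^ p ≤ (edist y0 z.1 + edist y0 z.2) ^ p := by
        gcongr
        exact edist_triangle_left _ _ _
    _ ≤ _ := ENNReal.rpow_add_le_mul_rpow_add_rpow _ _ hp.le

lemma half_prob {X : Type*} [MeasurableSpace X] (μ ν : Measure X) [IsProbabilityMeasure μ]
    [IsProbabilityMeasure ν] : IsProbabilityMeasure ((2⁻¹ : ℝ≥0∞) • (μ + ν)) := by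
  constructor
  simp only [Measure.smul_apply, Measure.add_apply, measure_univ, smul_eq_mul]
  rw [one_add_one_eq_two]
  exact ENNReal.inv_mul_cancel (by simp) (by simp)

lemma half_coupling {γ1 γ2 : Measure (E × E)} {μ ν1 ν2 : Measure E}
    (h1 : γ1.map Prod.fst = μ ∧ γ1.map Prod.snd = ν1)
    (h2 : γ2.map Prod.fst = μ ∧ γ2.map Prod.snd = ν2) :
    ((2⁻¹ : ℝ≥0∞) • (γ1 + γ2)).map Prod.fst = μ ∧
    ((2⁻¹ : ℝ≥0∞) • (γ1 + γ2)).map Prod.snd = (2⁻¹ : ℝ≥0∞) • (ν1 + ν2) := by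
  constructor
  · rw [Measure.map_smul, Measure.map_add _ _ measurable_fst, h1.1, h2.1, ← two_smul ℝ≥0∞ μ,
      smul_smul, ENNReal.inv_mul_cancel (by simp) (by simp), one_smul]
  · rw [Measure.map_smul, Measure.map_add _ _ measurable_snd, h1.2, h2.2]

lemma Wc_half_le {p : ℝ} (hp : 1 < p) (y0 : E) (μ ν1 ν2 : Measure E) [IsProbabilityMeasure μ]
    [IsProbabilityMeasure ν1] [IsProbabilityMeasure ν2]
    (hμ : ∫⁻ y, edist y0 y ^ p ∂μ ≠ ∞)
    (hν1 : ∫⁻ y, edist y0 y ^ p ∂ν1 ≠ ∞) (hν2 : ∫⁻ y, edist y0 y ^ p ∂ν2 ≠ ∞) :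
    Wc p μ ((2⁻¹ : ℝ≥0∞) • (ν1 + ν2)) ≤ 2⁻¹ * (Wc p μ ν1 + Wc p μ ν2) := by
  obtain ⟨γ1, _, a1, b1, c1⟩ := exists_optimal hp y0 μ ν1 hμ hν1
  obtain ⟨γ2, _, a2, b2, c2⟩ := exists_optimal hp y0 μ ν2 hμ hν2
  refine (Wc_le p (half_coupling ⟨a1, b1⟩ ⟨a2, b2⟩)).trans ?_
  rw [lintegral_smul_measure, lintegral_add_measure, c1, c2, smul_eq_mul]

lemma fiber_unique {p : ℝ} (hp : 1 < p) (y0 : E) (vol : Measure E) [vol.IsAddHaarMeasure]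
    (μ ν1 ν2 : Measure E) [IsProbabilityMeasure μ]
    [IsProbabilityMeasure ν1] [IsProbabilityMeasure ν2] (hac : μ ≪ vol)
    (hμ : ∫⁻ y, edist y0 y ^ p ∂μ ≠ ∞)
    (hν1 : ∫⁻ y, edist y0 y ^ p ∂ν1 ≠ ∞) (hν2 : ∫⁻ y, edist y0 y ^ p ∂ν2 ≠ ∞)
    (heq : Wc p μ ((2⁻¹ : ℝ≥0∞) • (ν1 + ν2)) = 2⁻¹ * (Wc p μ ν1 + Wc p μ ν2)) : ν1 = ν2 := by
  have h2top : (2 : ℝ≥0∞) ^ (p - 1) ≠ ∞ := ENNReal.rpow_ne_top_of_nonneg (by linarith) (by simp)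
  obtain ⟨γ1, _, a1, b1, c1⟩ := exists_optimal hp y0 μ ν1 hμ hν1
  obtain ⟨γ2, _, a2, b2, c2⟩ := exists_optimal hp y0 μ ν2 hμ hν2
  have hc := half_coupling ⟨a1, b1⟩ ⟨a2, b2⟩
  have hcost : ∫⁻ z, edist z.1 z.2 ^ p ∂((2⁻¹ : ℝ≥0∞) • (γ1 + γ2)) =
      Wc p μ ((2⁻¹ : ℝ≥0∞) • (ν1 + ν2)) := by
    rw [lintegral_smul_measure, lintegral_add_measure, c1, c2, smul_eq_mul, heq]
  have := half_prob γ1 γ2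
  have f1 : Wc p μ ν1 ≠ ∞ := ne_top_of_le_ne_top
    (ENNReal.mul_ne_top h2top (ENNReal.add_ne_top.2 ⟨hμ, hν1⟩)) (Wc_le_moment hp y0 μ ν1)
  have f2 : Wc p μ ν2 ≠ ∞ := ne_top_of_le_ne_top
    (ENNReal.mul_ne_top h2top (ENNReal.add_ne_top.2 ⟨hμ, hν2⟩)) (Wc_le_moment hp y0 μ ν2)
  have hac1 : γ1 ≪ (2⁻¹ : ℝ≥0∞) • (γ1 + γ2) := by
    refine Measure.AbsolutelyContinuous.mk fun s _ hs => ?_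
    simp at hs
    exact hs.1
  have hac2 : γ2 ≪ (2⁻¹ : ℝ≥0∞) • (γ1 + γ2) := by
    refine Measure.AbsolutelyContinuous.mk fun s _ hs => ?_
    simp at hs
    exact hs.2
  rw [← b1, ← b2]
  refine snd_eq_of_optimal hp μ vol hac γ1 γ2 a1 a2 ((2⁻¹ : ℝ≥0∞) • (γ1 + γ2)) hac1 hac2 ?_ ?_
  · rw [hcost, heq]
    exact ENNReal.mul_ne_top (by simp) (ENNReal.add_ne_top.2 ⟨f1, f2⟩)
  · intro γ' h1 h2
    rw [hcost]
    exact Wc_le p ⟨h1.trans hc.1, h2.trans hc.2⟩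
end fiber

section final
open Filter Topology Set

/-- abbreviation for the `L^r` norm -/
noncomputable def Nr {Ω : Type*} [MeasurableSpace Ω] (σ : Measure Ω) (r : ℝ) (f : Ω → ℝ≥0∞) : ℝ≥0∞ :=
  (∫⁻ ω, f ω ^ r ∂σ) ^ (1 / r)

lemma scrMK_rpow {Ω Y : Type*} [MeasurableSpace Ω] [PseudoEMetricSpace Y]
    [MeasurableSpace Y] {p : ℝ} (hp : 0 < p) {q : ℝ≥0∞} (hq : q ≠ ∞) (hq0 : q ≠ 0) (σ : Measure Ω)
    (κ η : Kernel Ω Y) :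
    scrMK p q σ κ η ^ p = Nr σ (q.toReal / p) (fun ω => Wc p (κ ω) (η ω)) := by
  have hq' : 0 < q.toReal := ENNReal.toReal_pos hq0 hq
  unfold scrMK Nr
  rw [if_neg hq, ← ENNReal.rpow_mul]
  congr 1
  · refine lintegral_congr fun ω => ?_
    rw [MK_eq hp, ← ENNReal.rpow_mul]
    congr 1
    field_simp
  · field_simp

lemma lintegral_add_rpow_ne_top {Ω : Type*} [MeasurableSpace Ω] {σ : Measure Ω} {r : ℝ}
    (hr : 1 ≤ r) {f g : Ω → ℝ≥0∞} (hf : AEMeasurable f σ)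
    (hf' : ∫⁻ ω, f ω ^ r ∂σ ≠ ∞) (hg' : ∫⁻ ω, g ω ^ r ∂σ ≠ ∞) :
    ∫⁻ ω, (f ω + g ω) ^ r ∂σ ≠ ∞ := by
  have h2top : (2 : ℝ≥0∞) ^ (r - 1) ≠ ∞ := ENNReal.rpow_ne_top_of_nonneg (by linarith) (by simp)
  refine ne_top_of_le_ne_top (b := 2 ^ (r - 1) * (∫⁻ ω, f ω ^ r ∂σ + ∫⁻ ω, g ω ^ r ∂σ)) ?_ ?_
  · exact ENNReal.mul_ne_top h2top (ENNReal.add_ne_top.2 ⟨hf', hg'⟩)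
  · rw [← lintegral_add_left' (hf.pow_const r), ← lintegral_const_mul' _ _ h2top]
    exact lintegral_mono fun ω => ENNReal.rpow_add_le_mul_rpow_add_rpow _ _ hr

lemma lintegral_mul_rpow_ne_top {Ω : Type*} [MeasurableSpace Ω] {σ : Measure Ω} {r : ℝ}
    (hr : 1 ≤ r) {f : Ω → ℝ≥0∞} {c : ℝ≥0∞} (hc : c ≠ ∞)
    (hf' : ∫⁻ ω, f ω ^ r ∂σ ≠ ∞) :
    ∫⁻ ω, (c * f ω) ^ r ∂σ ≠ ∞ := by
  have h0 : 0 ≤ r := by linarith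
  simp_rw [ENNReal.mul_rpow_of_nonneg _ _ h0]
  rw [lintegral_const_mul' _ _ (ENNReal.rpow_ne_top_of_nonneg h0 hc)]
  exact ENNReal.mul_ne_top (ENNReal.rpow_ne_top_of_nonneg h0 hc) hf'

lemma Nr_half {Ω : Type*} [MeasurableSpace Ω] {σ : Measure Ω} {r : ℝ}
    (hr : 1 ≤ r) {f g : Ω → ℝ≥0∞} (hf : AEMeasurable f σ) (hg : AEMeasurable g σ) :
    Nr σ r (fun ω => 2⁻¹ * (f ω + g ω)) ≤ 2⁻¹ * (Nr σ r f + Nr σ r g) := by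
  have h0 : 0 < r := by linarith
  unfold Nr
  simp_rw [ENNReal.mul_rpow_of_nonneg _ _ h0.le]
  rw [lintegral_const_mul' _ _ (ENNReal.rpow_ne_top_of_nonneg h0.le (by simp)),
    ENNReal.mul_rpow_of_nonneg _ _ (by positivity), ← ENNReal.rpow_mul,
    mul_one_div_cancel h0.ne', ENNReal.rpow_one]
  gcongr
  exact ENNReal.lintegral_Lp_add_le hf hg hr

/-- the equality case -/
lemma Nr_eq_case {Ω : Type*} [MeasurableSpace Ω] {σ : Measure Ω} {r : ℝ}
    (hr : 1 ≤ r) {f g : Ω → ℝ≥0∞} (hg : AEMeasurable g σ) (hfg : f ≤ᵐ[σ] g)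
    (hfin : ∫⁻ ω, g ω ^ r ∂σ ≠ ∞) (h : Nr σ r g ≤ Nr σ r f) : f =ᵐ[σ] g := by
  have h0 : 0 < r := by linarith
  have h1 : ∫⁻ ω, g ω ^ r ∂σ ≤ ∫⁻ ω, f ω ^ r ∂σ :=
    (ENNReal.rpow_le_rpow_iff (by positivity : 0 < 1 / r)).1 h
  have h2 : (fun ω => f ω ^ r) ≤ᵐ[σ] fun ω => g ω ^ r := by
    filter_upwards [hfg] with ω hω
    exact ENNReal.rpow_le_rpow hω h0.le
  have h3 := ae_eq_of_ae_le_of_lintegral_le h2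
    (ne_top_of_le_ne_top hfin (lintegral_mono_ae h2)) (hg.pow_const r) h1
  filter_upwards [h3] with ω hω
  exact ENNReal.rpow_left_injective h0.ne' hω

lemma sum_eq_case {K : ℕ} (a A B C : Fin K → ℝ≥0∞) (k0 : Fin K) (ha0 : a k0 ≠ 0)
    (ha : ∀ k, a k ≠ ∞)
    (hA : ∀ k, A k ≠ ∞) (hC : ∀ k, C k ≤ 2⁻¹ * (A k + B k))
    (h1 : ∑ k, a k * A k ≤ ∑ k, a k * C k)
    (h12 : ∑ k, a k * B k ≤ ∑ k, a k * A k) : 2⁻¹ * (A k0 + B k0) ≤ C k0 := by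
  by_contra hcon
  push Not at hcon
  have hfin : ∑ k, a k * A k ≠ ∞ := ENNReal.sum_ne_top.2 fun k _ => ENNReal.mul_ne_top (ha k) (hA k)
  have h2 : ∑ k, a k * (2⁻¹ * (A k + B k)) ≤ ∑ k, a k * A k := by
    have : ∀ k, a k * (2⁻¹ * (A k + B k)) = 2⁻¹ * (a k * A k) + 2⁻¹ * (a k * B k) := fun k => by ring
    simp_rw [this]
    rw [Finset.sum_add_distrib, ← Finset.mul_sum, ← Finset.mul_sum]
    calc _ ≤ 2⁻¹ * ∑ k, a k * A k + 2⁻¹ * ∑ k, a k * A k := by gcongr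
      _ = ∑ k, a k * A k := by rw [← add_mul, ENNReal.inv_two_add_inv_two, one_mul]
  have h3 : ∑ k, a k * C k < ∑ k, a k * (2⁻¹ * (A k + B k)) := by
    rw [← Finset.add_sum_erase _ _ (Finset.mem_univ k0),
      ← Finset.add_sum_erase _ (fun k => a k * (2⁻¹ * (A k + B k))) (Finset.mem_univ k0)]
    have hle : ∑ x ∈ Finset.univ.erase k0, a x * C x ≤
        ∑ x ∈ Finset.univ.erase k0, a x * (2⁻¹ * (A x + B x)) :=
      Finset.sum_le_sum fun k _ => mul_le_mul_right (hC k) _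
    refine ENNReal.add_lt_add_of_lt_of_le ?_ ?_ hle
    · refine ne_top_of_le_ne_top (hfin) (le_trans ?_ h2)
      exact hle.trans (Finset.sum_le_sum_of_subset (Finset.erase_subset _ _))
    · exact (ENNReal.mul_lt_mul_iff_right ha0 (ha k0)).2 hcon
  exact absurd (h1.trans_lt (h3.trans_le h2)) (lt_irrefl _)

end final

/-- **Uniqueness of disintegrated barycenters with Euclidean fiber.**
For `1 < p < ∞`, `p ≤ q < ∞`, weights `λ_k ∈ (0,1)` summing to `1` and
`m_1, …, m_K ∈ 𝒫^σ_{p,q}(Ω × ℝ^d)` such that for some `k0` the fibers `(m_{k0})^ω` are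
`σ`-a.e. absolutely continuous with respect to Lebesgue measure, the function
`n ↦ ∑ k λ_k scrMK_{p,q}(m_k, n)^p` has at most one minimizer in `𝒫^σ_{p,q}(Ω × ℝ^d)`:
any two minimizers (encoded by their disintegration kernels) agree as measures, i.e. their
fibers coincide `σ`-a.e. -/
theorem disintegrated_barycenter_uniqueness
    {Ω : Type*} [MetricSpace Ω] [CompleteSpace Ω] [SecondCountableTopology Ω]
    [LocallyCompactSpace Ω] [MeasurableSpace Ω] [BorelSpace Ω]
    (d : ℕ) (hd : 1 ≤ d)
    (σ : Measure Ω) [IsProbabilityMeasure σ] (y0 : EuclideanSpace ℝ (Fin d))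
    (p : ℝ) (hp : 1 < p) (q : ℝ≥0∞) (hpq : ENNReal.ofReal p ≤ q) (hq : q ≠ ∞)
    (K : ℕ) (hK : 2 ≤ K)
    (lam : Fin K → ℝ) (hlam : ∀ k, lam k ∈ Set.Ioo (0 : ℝ) 1) (hsum : ∑ k, lam k = 1)
    (m : Fin K → Kernel Ω (EuclideanSpace ℝ (Fin d))) (hm : ∀ k, MemP p q σ y0 (m k))
    (k0 : Fin K)
    (hac : ∀ᵐ ω ∂σ, m k0 ω ≪ (volume : Measure (EuclideanSpace ℝ (Fin d)))) :
    ∀ η1 η2 : Kernel Ω (EuclideanSpace ℝ (Fin d)),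
      MemP p q σ y0 η1 → MemP p q σ y0 η2 →
      (∀ η, MemP p q σ y0 η →
        ∑ k, ENNReal.ofReal (lam k) * scrMK p q σ (m k) η1 ^ p ≤
          ∑ k, ENNReal.ofReal (lam k) * scrMK p q σ (m k) η ^ p) →
      (∀ η, MemP p q σ y0 η →
        ∑ k, ENNReal.ofReal (lam k) * scrMK p q σ (m k) η2 ^ p ≤
          ∑ k, ENNReal.ofReal (lam k) * scrMK p q σ (m k) η ^ p) →
      ∀ᵐ ω ∂σ, η1 ω = η2 ω := by
  intro η1 η2 hη1 hη2 hmin1 hmin2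
  have hp0 : 0 < p := by linarith
  have hq0 : q ≠ 0 := by
    rintro rfl
    simp at hpq
    linarith
  have hpq' : p ≤ q.toReal := (ENNReal.ofReal_le_iff_le_toReal hq).1 hpq
  set r : ℝ := q.toReal / p with hrdef
  have hr : 1 ≤ r := (one_le_div hp0).2 hpq'
  have hr0 : 0 < r := by linarith
  have h2top : (2 : ℝ≥0∞) ^ (p - 1) ≠ ∞ := ENNReal.rpow_ne_top_of_nonneg (by linarith) (by simp)
  let M : Kernel Ω (EuclideanSpace ℝ (Fin d)) → Ω → ℝ≥0∞ := fun κ ω => ∫⁻ y, edist y0 y ^ p ∂(κ ω)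
  have hMm : ∀ κ, Measurable (M κ) := fun κ => Measurable.lintegral_kernel (by fun_prop)
  have hMemP : ∀ κ, MemP p q σ y0 κ ↔ IsMarkovKernel κ ∧ ∫⁻ ω, M κ ω ^ r ∂σ ≠ ∞ := by
    intro κ
    refine and_congr_right fun hκ => ?_
    have e := scrMK_rpow hp0 hq hq0 σ (Kernel.const Ω (Measure.dirac y0)) κ
    simp only [Kernel.const_apply, Wc_dirac] at e
    rw [← not_iff_not, not_not, not_not, ← ENNReal.rpow_eq_top_iff_of_pos hp0, e, Nr,
      ENNReal.rpow_eq_top_iff_of_pos (by positivity)]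
  have hMfin : ∀ κ, MemP p q σ y0 κ → ∀ᵐ ω ∂σ, M κ ω ≠ ∞ := by
    intro κ hκ
    have := ae_lt_top' ((hMm κ).pow_const r).aemeasurable ((hMemP κ).1 hκ).2
    filter_upwards [this] with ω hω h
    rw [h, ENNReal.top_rpow_of_pos hr0] at hω
    exact lt_irrefl _ hω
  have hWm : ∀ κ η, MemP p q σ y0 κ → MemP p q σ y0 η →
      AEMeasurable (fun ω => Wc p (κ ω) (η ω)) σ := by
    intro κ η hκ hη
    have := hκ.1
    have := hη.1
    exact aemeasurable_Wc hp y0 σ κ η (hMfin κ hκ) (hMfin η hη)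
  have hWfin : ∀ κ η, MemP p q σ y0 κ → MemP p q σ y0 η →
      ∫⁻ ω, Wc p (κ ω) (η ω) ^ r ∂σ ≠ ∞ := by
    intro κ η hκ hη
    have := hκ.1
    have := hη.1
    refine ne_top_of_le_ne_top (lintegral_mul_rpow_ne_top hr h2top
      (lintegral_add_rpow_ne_top hr (hMm κ).aemeasurable
        ((hMemP κ).1 hκ).2 ((hMemP η).1 hη).2)) ?_
    refine lintegral_mono fun ω => ?_
    gcongr
    exact Wc_le_moment hp y0 (κ ω) (η ω)
  have i1 := hη1.1
  have i2 := hη2.1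
  let η : Kernel Ω (EuclideanSpace ℝ (Fin d)) :=
    ⟨fun ω => (2⁻¹ : ℝ≥0∞) • (η1 ω + η2 ω), by
      refine Measure.measurable_of_measurable_coe _ fun s hs => ?_
      simp only [Measure.smul_apply, Measure.add_apply, smul_eq_mul]
      exact ((η1.measurable_coe hs).add (η2.measurable_coe hs)).const_mul _⟩
  have hηω : ∀ ω, η ω = (2⁻¹ : ℝ≥0∞) • (η1 ω + η2 ω) := fun ω => rfl
  have hηP : MemP p q σ y0 η := by
    rw [hMemP]
    refine ⟨⟨fun ω => by rw [hηω]; exact half_prob _ _⟩, ?_⟩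
    have : ∀ ω, M η ω = 2⁻¹ * (M η1 ω + M η2 ω) := by
      intro ω
      simp only [M, hηω, lintegral_smul_measure, lintegral_add_measure, smul_eq_mul]
    simp_rw [this]
    exact lintegral_mul_rpow_ne_top hr (by simp) (lintegral_add_rpow_ne_top hr
      (hMm η1).aemeasurable ((hMemP η1).1 hη1).2 ((hMemP η2).1 hη2).2)
  have hle : ∀ k, (fun ω => Wc p (m k ω) (η ω)) ≤ᵐ[σ]
      fun ω => 2⁻¹ * (Wc p (m k ω) (η1 ω) + Wc p (m k ω) (η2 ω)) := by
    intro k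
    have := (hm k).1
    filter_upwards [hMfin _ (hm k), hMfin _ hη1, hMfin _ hη2] with ω a b c
    rw [hηω]
    exact Wc_half_le hp y0 _ _ _ a b c
  have hNle : ∀ k, Nr σ r (fun ω => Wc p (m k ω) (η ω)) ≤
      Nr σ r (fun ω => 2⁻¹ * (Wc p (m k ω) (η1 ω) + Wc p (m k ω) (η2 ω))) := by
    intro k
    refine ENNReal.rpow_le_rpow (lintegral_mono_ae ?_) (by positivity)
    filter_upwards [hle k] with ω hω
    exact ENNReal.rpow_le_rpow hω hr0.le
  have hNhalf := fun k => Nr_half hr (hWm _ _ (hm k) hη1) (hWm _ _ (hm k) hη2)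
  have hm1 := hmin1 η hηP
  have hm2 := hmin2 η1 hη1
  simp only [scrMK_rpow hp0 hq hq0, ← hrdef] at hm1 hm2
  have hcase := sum_eq_case (fun k => ENNReal.ofReal (lam k))
    (fun k => Nr σ r (fun ω => Wc p (m k ω) (η1 ω))) (fun k => Nr σ r (fun ω => Wc p (m k ω) (η2 ω)))
    (fun k => Nr σ r (fun ω => Wc p (m k ω) (η ω))) k0
    (by simpa using (hlam k0).1) (fun k => ENNReal.ofReal_ne_top)
    (fun k => ENNReal.rpow_ne_top_of_nonneg (by positivity) (hWfin _ _ (hm k) hη1))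
    (fun k => (hNle k).trans (hNhalf k)) hm1 hm2
  have hae := Nr_eq_case hr (((hWm _ _ (hm k0) hη1).add (hWm _ _ (hm k0) hη2)).const_mul 2⁻¹)
    (hle k0) (lintegral_mul_rpow_ne_top hr (by simp) (lintegral_add_rpow_ne_top hr
      (hWm _ _ (hm k0) hη1) (hWfin _ _ (hm k0) hη1) (hWfin _ _ (hm k0) hη2)))
    ((hNhalf k0).trans hcase)
  have ik := (hm k0).1
  filter_upwards [hae, hac, hMfin _ (hm k0), hMfin _ hη1, hMfin _ hη2] with ω h1 h2 h3 h4 h5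
  exact fiber_unique hp y0 volume (m k0 ω) (η1 ω) (η2 ω) h2 h3 h4 h5 h1
end

section
/- Let (Ω,d_Ω) and (Y,d_Y) be complete, separable, locally compact metric spaces, σ a Borel probability measure on Ω, and fix y0 ∈ Y. Fix 1 ≤ p < ∞, p ≤ q ≤ ∞, λ ∈ (0,1], and m ∈ 𝒫^σ_{p,q}(Ω×Y); let r := q/p and r' its Hölder conjugate, and let H_{λ,m} be as defined below. Then for every n ∈ 𝒫^σ(Ω×Y) with ∫_{Ω×Y} d_Y(y0,y)^p dn(ω,y) < ∞, one has sup_{η ∈ X_p} ( −∫_{Ω×Y} η dn − H_{λ,m}(η) ) = λ · scrMK_{p,q}(m,n)^p, where the right-hand side is +∞ when n ∉ 𝒫^σ_{p,q}(Ω×Y). -/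
open MeasureTheory ProbabilityTheory ENNReal Filter

/-- The nonnegative part of an extended real, as an extended nonnegative real. -/
noncomputable def eToENNReal (x : EReal) : ℝ≥0∞ :=
  if x = ⊤ then ⊤ else ENNReal.ofReal x.toReal

/-- The integral of an `EReal`-valued function, taken in the extended-real sense:
the lower integral of the positive part minus the lower integral of the negative part. -/
noncomputable def eIntegral {α : Type*} [MeasurableSpace α] (f : α → EReal)
    (μ : Measure α) : EReal :=
  ((∫⁻ x, eToENNReal (f x) ∂μ : ℝ≥0∞) : EReal) - ((∫⁻ x, eToENNReal (-f x) ∂μ : ℝ≥0∞) : EReal)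

/-- The fiberwise transform `S_λ ξ (ω,y) = sup_{y'} ( -λ d_Y(y,y')^p - ξ(ω,y') )`, with
values in the extended reals. -/
noncomputable def Slam {Ω Y : Type*} [PseudoMetricSpace Y] (lam p : ℝ) (ξ : Ω × Y → ℝ)
    (u : Ω × Y) : EReal :=
  ⨆ y' : Y, (((-(lam * dist u.2 y' ^ p) - ξ (u.1, y')) : ℝ) : EReal)

/-- `ξ` belongs to the class `𝒳_p` on `Ω × Y`: it is continuous and
`ξ/(1 + d_Y(y0,·)^p)` vanishes at infinity. -/
def MemXp {Ω Y : Type*} [TopologicalSpace Ω] [PseudoMetricSpace Y] (p : ℝ) (y0 : Y)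
    (ξ : Ω × Y → ℝ) : Prop :=
  Continuous ξ ∧
    Tendsto (fun u : Ω × Y => ξ u / (1 + dist y0 u.2 ^ p)) (cocompact (Ω × Y)) (nhds 0)

/-- `ζ` belongs to the class `𝒵_{r',σ}`: it is a bounded continuous strictly positive
function on `Ω` with `L^{r'}(σ)`-norm at most `1`. -/
def MemZ {Ω : Type*} [TopologicalSpace Ω] [MeasurableSpace Ω] (r' : ℝ≥0∞) (σ : Measure Ω)
    (ζ : Ω → ℝ) : Prop :=
  Continuous ζ ∧ (∃ C, ∀ ω, |ζ ω| ≤ C) ∧ (∀ ω, 0 < ζ ω) ∧ eLpNorm ζ r' σ ≤ 1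


/-- The dual functional `H_{λ,m}` of the disintegrated barycenter problem, on the trivial
bundle `Ω × Y` with `m` encoded by its disintegration kernel `κ`:
`H_{λ,m}(η) = inf { ∫_Ω ζ (∫_Y S_λ ξ dm^ω) dσ | (ζ,ξ) ∈ 𝒵_{r',σ} × 𝒳_p, η = ζ·ξ }`,
with values in the extended reals (`sInf ∅ = ⊤`). -/
noncomputable def Hfun {Ω Y : Type*} [TopologicalSpace Ω] [MeasurableSpace Ω]
    [PseudoMetricSpace Y] [MeasurableSpace Y] (p : ℝ) (r' : ℝ≥0∞) (σ : Measure Ω) (y0 : Y)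
    (lam : ℝ) (κ : Kernel Ω Y) (η : Ω × Y → ℝ) : EReal :=
  sInf {v : EReal | ∃ (ζ : Ω → ℝ) (ξ : Ω × Y → ℝ), MemZ r' σ ζ ∧ MemXp p y0 ξ ∧
    (∀ u : Ω × Y, η u = ζ u.1 * ξ u) ∧
    v = eIntegral (fun ω => ((ζ ω : ℝ) : EReal) *
          eIntegral (fun y => Slam lam p ξ (ω, y)) (κ ω)) σ}

set_option linter.unusedSectionVars false
set_option linter.style.haveILetI false
set_option linter.unusedVariables false
open scoped BoundedContinuousFunction CompactlySupported Topology

/-- Real-valued fiber transform. -/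
noncomputable def TT {Y : Type*} [PseudoMetricSpace Y] (lam p : ℝ) (φ : Y → ℝ) (y : Y) : ℝ :=
  ⨆ y' : Y, (-(lam * dist y y' ^ p) - φ y')

section Kant

variable {Y : Type*} [MetricSpace Y] [CompleteSpace Y] [SecondCountableTopology Y]
    [LocallyCompactSpace Y] [MeasurableSpace Y] [BorelSpace Y]

lemma continuous_cost {Y : Type*} [PseudoMetricSpace Y] (lam p : ℝ) (hp : 1 ≤ p) :
    Continuous (fun z : Y × Y => lam * dist z.1 z.2 ^ p) :=
  continuous_const.mul (continuous_dist.rpow_const (fun _ => Or.inr (by linarith)))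

lemma exists_cutoff {Y : Type*} [MetricSpace Y] [SecondCountableTopology Y]
    [LocallyCompactSpace Y] : ∃ χ : ℕ → C_c(Y, ℝ), (∀ n y, 0 ≤ χ n y) ∧ (∀ n y, χ n y ≤ 1) ∧
      ∀ y, ∀ᶠ n in atTop, χ n y = 1 := by
  let K : CompactExhaustion Y := default
  have : ∀ n, ∃ f : C(Y, ℝ), Set.EqOn f 1 (K n) ∧ IsCompact (tsupport f) ∧
      tsupport f ⊆ Set.univ ∧ ∀ x, f x ∈ Set.Icc 0 1 := fun n =>
    exists_continuousMap_one_of_isCompact_subset_isOpen (K.isCompact n) isOpen_univ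
      (Set.subset_univ _)
  choose f h1 h2 _ h3 using this
  refine ⟨fun n => ⟨f n, h2 n⟩, fun n y => (h3 n y).1, fun n y => (h3 n y).2, fun y => ?_⟩
  obtain ⟨N, hN⟩ := K.exists_mem y
  filter_upwards [eventually_ge_atTop N] with n hn
  exact h1 n (K.subset hn hN)

/-- key nonnegativity -/
lemma kant_key (lam p : ℝ) (hp : 1 ≤ p) (hlam : 0 < lam) (μ ν : Measure Y)
    [IsProbabilityMeasure μ] [IsProbabilityMeasure ν] (T : ℝ)
    (hT : ∀ φ : C_c(Y, ℝ), -∫ y, φ y ∂ν - ∫ y, TT lam p φ y ∂μ ≤ T)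
    (f : Y →ᵇ ℝ) (φ : C_c(Y, ℝ)) (t : ℝ) (ht : 0 ≤ t)
    (h : ∀ y y', 0 ≤ f y + φ y' + t * (lam * dist y y' ^ p)) :
    0 ≤ ∫ y, f y ∂μ + ∫ y, φ y ∂ν + t * T := by
  have hfi : Integrable f μ := f.integrable μ
  have hφi : Integrable φ ν := φ.continuous.integrable_of_hasCompactSupport φ.hasCompactSupport
  rcases ht.eq_or_lt with rfl | ht
  · have h1 : ∀ y, 0 ≤ f y + ∫ y', φ y' ∂ν := by
      intro y
      have : 0 ≤ ∫ y', (f y + φ y') ∂ν := integral_nonneg (fun y' => by simpa using h y y')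
      rwa [integral_add (integrable_const _) hφi, integral_const, probReal_univ, one_smul] at this
    have : 0 ≤ ∫ y, (f y + ∫ y', φ y' ∂ν) ∂μ := integral_nonneg h1
    rw [integral_add hfi (integrable_const _), integral_const, probReal_univ, one_smul] at this
    simpa using this
  · have h2 := hT (t⁻¹ • φ)
    have h3 : ∫ y, (t⁻¹ • φ) y ∂ν = t⁻¹ * ∫ y, φ y ∂ν := by
      simp [integral_const_mul]
    rw [h3] at h2
    have hub : ∀ y y', -(lam * dist y y' ^ p) - (t⁻¹ • φ) y' ≤ t⁻¹ * f y := by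
      intro y y'
      have := mul_nonneg (inv_nonneg.2 ht.le) (h y y')
      have e : t⁻¹ * (f y + φ y' + t * (lam * dist y y' ^ p))
        = t⁻¹ * f y + t⁻¹ * φ y' + lam * dist y y' ^ p := by field_simp
      rw [e] at this
      simp only [CompactlySupportedContinuousMap.coe_smul, Pi.smul_apply, smul_eq_mul]
      linarith
    have hle : ∫ y, TT lam p (t⁻¹ • φ) y ∂μ ≤ t⁻¹ * ∫ y, f y ∂μ := by
      rw [← integral_const_mul]
      by_cases hi : Integrable (TT lam p (t⁻¹ • φ)) μ
      · refine integral_mono hi (hfi.const_mul _) fun y => ?_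
        haveI : Nonempty Y := ⟨y⟩
        exact ciSup_le (hub y)
      · exfalso
        apply hi
        obtain ⟨C, hC⟩ : ∃ C, ∀ y, ‖(t⁻¹ • φ) y‖ ≤ C :=
          (t⁻¹ • φ).hasCompactSupport.exists_bound_of_continuous (t⁻¹ • φ).continuous
        have hbd : ∀ y, BddAbove (Set.range fun y' => -(lam * dist y y' ^ p) - (t⁻¹ • φ) y') :=
          fun y => ⟨t⁻¹ * f y, by rintro _ ⟨y', rfl⟩; exact hub y y'⟩
        have hm : Measurable (TT lam p (t⁻¹ • φ)) := by
          refine LowerSemicontinuous.measurable (lowerSemicontinuous_ciSup hbd fun y' => ?_)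
          refine Continuous.lowerSemicontinuous ?_
          refine (Continuous.neg ?_).sub continuous_const
          exact (continuous_cost lam p hp).comp (continuous_id.prodMk continuous_const)
        refine Integrable.of_bound hm.aestronglyMeasurable C (ae_of_all _ fun y => ?_)
        haveI : Nonempty Y := ⟨y⟩
        rw [Real.norm_eq_abs, abs_le]
        constructor
        · refine le_trans ?_ (le_ciSup (hbd y) y)
          have := (abs_le.1 (hC y)).2
          rw [dist_self, Real.zero_rpow (by linarith)]
          linarith
        · refine ciSup_le fun y' => ?_
          have := (abs_le.1 (hC y')).1
          have : 0 ≤ lam * dist y y' ^ p := by positivity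
          linarith
    have h4 : -(t⁻¹ * ∫ y, φ y ∂ν) - t⁻¹ * ∫ y, f y ∂μ ≤ T := by
      change -(t⁻¹ * ∫ y, φ y ∂ν) - ∫ y, TT lam p (t⁻¹ • φ) y ∂μ ≤ T at h2
      linarith
    have h5 := mul_le_mul_of_nonneg_left h4 ht.le
    have e : t * (-(t⁻¹ * ∫ y, φ y ∂ν) - t⁻¹ * ∫ y, f y ∂μ)
      = - ∫ y, φ y ∂ν - ∫ y, f y ∂μ := by field_simp
    linarith

/-- Existence of a dominated functional. -/
lemma kant_functional (lam p : ℝ) (hp : 1 ≤ p) (hlam : 0 < lam) (μ ν : Measure Y)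
    [IsProbabilityMeasure μ] [IsProbabilityMeasure ν] (T : ℝ)
    (hT : ∀ φ : C_c(Y, ℝ), -∫ y, φ y ∂ν - ∫ y, TT lam p φ y ∂μ ≤ T) :
    ∃ L : C_c(Y × Y, ℝ) →ₗ[ℝ] ℝ, ∀ (h : C_c(Y × Y, ℝ)) (f : Y →ᵇ ℝ) (φ : C_c(Y, ℝ)) (t : ℝ),
      0 ≤ t → (∀ y y', h (y, y') ≤ f y + φ y' + t * (lam * dist y y' ^ p)) →
      L h ≤ ∫ y, f y ∂μ + ∫ y, φ y ∂ν + t * T := by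
  let E := C_c(Y × Y, ℝ) × (Y →ᵇ ℝ) × C_c(Y, ℝ) × ℝ
  let s : PointedCone ℝ E :=
    { carrier := {x | 0 ≤ x.2.2.2 ∧ ∀ y y', x.1 (y, y') ≤
        x.2.1 y + x.2.2.1 y' + x.2.2.2 * (lam * dist y y' ^ p)}
      add_mem' := by
        rintro a b ⟨ha, ha'⟩ ⟨hb, hb'⟩
        refine ⟨add_nonneg ha hb, fun y y' => ?_⟩
        have h1 := ha' y y'
        have h2 := hb' y y'
        change a.1 (y, y') + b.1 (y, y') ≤ (a.2.1 y + b.2.1 y) + (a.2.2.1 y' + b.2.2.1 y') +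
          (a.2.2.2 + b.2.2.2) * (lam * dist y y' ^ p)
        linarith
      zero_mem' := by
        refine ⟨le_refl _, fun y y' => ?_⟩
        simp
      smul_mem' := by
        rintro ⟨c, hc⟩ a ⟨ha, ha'⟩
        refine ⟨mul_nonneg hc ha, fun y y' => ?_⟩
        have h1 := mul_le_mul_of_nonneg_left (ha' y y') hc
        change c * a.1 (y, y') ≤ c * a.2.1 y + c * a.2.2.1 y' + c * a.2.2.2 * (lam * dist y y' ^ p)
        linarith }
  have hφi : ∀ φ : C_c(Y, ℝ), Integrable φ ν := fun φ =>
    φ.continuous.integrable_of_hasCompactSupport φ.hasCompactSupport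
  let Λ : E →ₗ[ℝ] ℝ :=
    { toFun := fun x => ∫ y, x.2.1 y ∂μ + ∫ y, x.2.2.1 y ∂ν + x.2.2.2 * T
      map_add' := by
        intro a b
        have e1 : ∫ y, (a + b).2.1 y ∂μ = ∫ y, a.2.1 y ∂μ + ∫ y, b.2.1 y ∂μ :=
          integral_add (a.2.1.integrable μ) (b.2.1.integrable μ)
        have e2 : ∫ y, (a + b).2.2.1 y ∂ν = ∫ y, a.2.2.1 y ∂ν + ∫ y, b.2.2.1 y ∂ν :=
          integral_add (hφi _) (hφi _)
        rw [e1, e2]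
        change _ + _ + (a.2.2.2 + b.2.2.2) * T = _
        ring
      map_smul' := by
        intro c a
        have e1 : ∫ y, (c • a).2.1 y ∂μ = c * ∫ y, a.2.1 y ∂μ :=
          integral_const_mul c _
        have e2 : ∫ y, (c • a).2.2.1 y ∂ν = c * ∫ y, a.2.2.1 y ∂ν :=
          integral_const_mul c _
        rw [e1, e2]
        change _ + _ + (c * a.2.2.2) * T = c * _
        ring }
  let D : Submodule ℝ E := LinearMap.ker (LinearMap.fst ℝ _ _)
  let F : E →ₗ.[ℝ] ℝ := ⟨D, Λ.comp D.subtype⟩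
  obtain ⟨g, hg1, hg2⟩ := riesz_extension s F (by
    rintro ⟨x, hx⟩ ⟨hxs, hxs'⟩
    have hx0 : x.1 = 0 := hx
    refine kant_key lam p hp hlam μ ν T hT x.2.1 x.2.2.1 x.2.2.2 hxs fun y y' => ?_
    have := hxs' y y'
    simp only [hx0] at this
    simpa using this) (by
    intro x
    obtain ⟨C, hC⟩ : ∃ C, ∀ y, ‖x.1 y‖ ≤ C :=
      x.1.hasCompactSupport.exists_bound_of_continuous x.1.continuous
    refine ⟨⟨(0, BoundedContinuousFunction.const Y C - x.2.1, - x.2.2.1, - x.2.2.2), ?_⟩, ?_, ?_⟩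
    · change (0 : C_c(Y × Y, ℝ)) = 0
      rfl
    · change 0 ≤ -x.2.2.2 + x.2.2.2
      simp
    · intro y y'
      have := (abs_le.1 (hC (y, y'))).2
      change 0 + x.1 (y, y') ≤ (C - x.2.1 y + x.2.1 y) + (-x.2.2.1 y' + x.2.2.1 y') +
        (-x.2.2.2 + x.2.2.2) * (lam * dist y y' ^ p)
      linarith)
  refine ⟨-(g.comp (LinearMap.inl ℝ _ _)), fun h f φ t ht hle => ?_⟩
  have h1 : 0 ≤ g (h, f, φ, t) := hg2 _ ⟨ht, hle⟩
  have h2 : g (0, f, φ, t) = ∫ y, f y ∂μ + ∫ y, φ y ∂ν + t * T :=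
    hg1 ⟨(0, f, φ, t), rfl⟩
  have h3 : ((h, f, φ, t) : E) = (h, 0) + (0, f, φ, t) := by ext <;> simp
  rw [h3, map_add, h2] at h1
  change - g (h, 0) ≤ _
  linarith

end Kant
section Kant2

variable {Y : Type*} [MetricSpace Y] [CompleteSpace Y] [SecondCountableTopology Y]
    [LocallyCompactSpace Y] [MeasurableSpace Y] [BorelSpace Y]

lemma measure_eq_of_cc_le (μ₁ μ : Measure Y) [IsProbabilityMeasure μ₁] [IsProbabilityMeasure μ]
    (h : ∀ f : C_c(Y, ℝ), (∀ y, 0 ≤ f y) → ∫ y, f y ∂μ₁ ≤ ∫ y, f y ∂μ) : μ₁ = μ := by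
  obtain ⟨χ, hχ0, hχ1, hχ⟩ := exists_cutoff (Y := Y)
  have key : ∀ f : Y →ᵇ ℝ, (∀ y, 0 ≤ f y) → ∫ y, f y ∂μ₁ ≤ ∫ y, f y ∂μ := by
    intro f hf
    have hlim : ∀ (m : Measure Y) [IsProbabilityMeasure m],
        Tendsto (fun n => ∫ y, f y * χ n y ∂m) atTop (𝓝 (∫ y, f y ∂m)) := by
      intro m _
      refine tendsto_integral_of_dominated_convergence (fun y => f y) ?_ (f.integrable m) ?_ ?_
      · intro n
        exact (f.continuous.mul (χ n).continuous).aestronglyMeasurable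
      · intro n
        refine ae_of_all _ fun y => ?_
        rw [Real.norm_eq_abs, abs_of_nonneg (mul_nonneg (hf y) (hχ0 n y))]
        exact mul_le_of_le_one_right (hf y) (hχ1 n y)
      · refine ae_of_all _ fun y => ?_
        refine tendsto_const_nhds.congr' ?_
        filter_upwards [hχ y] with n hn
        rw [hn, mul_one]
    refine le_of_tendsto_of_tendsto' (hlim μ₁) (hlim μ) fun n => ?_
    exact h ⟨⟨fun y => f y * χ n y, f.continuous.mul (χ n).continuous⟩,
      (χ n).hasCompactSupport.mul_left⟩ (fun y => mul_nonneg (hf y) (hχ0 n y))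
  refine ext_of_forall_integral_eq_of_IsFiniteMeasure fun f => ?_
  have hb : ∀ y, |f y| ≤ ‖f‖ := fun y => f.norm_coe_le_norm y
  have h1 := key (BoundedContinuousFunction.const Y ‖f‖ - f) (fun y => by
    have := (abs_le.1 (hb y)).2
    simpa using this)
  have h2 := key (BoundedContinuousFunction.const Y ‖f‖ + f) (fun y => by
    have := (abs_le.1 (hb y)).1
    simp; linarith)
  have e1 : ∀ (m : Measure Y) [IsProbabilityMeasure m],
      ∫ y, (BoundedContinuousFunction.const Y ‖f‖ - f) y ∂m = ‖f‖ - ∫ y, f y ∂m := by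
    intro m _
    have := integral_sub (integrable_const (μ := m) ‖f‖) (f.integrable m)
    simpa using this
  have e2 : ∀ (m : Measure Y) [IsProbabilityMeasure m],
      ∫ y, (BoundedContinuousFunction.const Y ‖f‖ + f) y ∂m = ‖f‖ + ∫ y, f y ∂m := by
    intro m _
    have := integral_add (integrable_const (μ := m) ‖f‖) (f.integrable m)
    simpa using this
  rw [e1, e1] at h1
  rw [e2, e2] at h2
  linarith

/-- A bound on a lintegral through cutoffs. -/
lemma lintegral_le_of_cutoff (γ : Measure (Y × Y)) (χ : ℕ → C_c(Y, ℝ)) (hχ0 : ∀ n y, 0 ≤ χ n y)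
    (hχ : ∀ y, ∀ᶠ n in atTop, χ n y = 1) (c : Y × Y → ℝ) (hc : Continuous c) (hc0 : ∀ z, 0 ≤ c z)
    (hIntg : ∀ n, Integrable (fun z : Y × Y => c z * (χ n z.1 * χ n z.2)) γ)
    (T : ℝ) (hT : ∀ n, ∫ z, c z * (χ n z.1 * χ n z.2) ∂γ ≤ T) :
    ∫⁻ z, ENNReal.ofReal (c z) ∂γ ≤ ENNReal.ofReal T := by
  have hm : ∀ n, Measurable fun z : Y × Y => ENNReal.ofReal (c z * (χ n z.1 * χ n z.2)) :=
    fun n => (hc.mul (((χ n).continuous.comp continuous_fst).mul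
      ((χ n).continuous.comp continuous_snd))).measurable.ennreal_ofReal
  calc ∫⁻ z, ENNReal.ofReal (c z) ∂γ
      = ∫⁻ z, liminf (fun n => ENNReal.ofReal (c z * (χ n z.1 * χ n z.2))) atTop ∂γ := by
        refine lintegral_congr fun z => ?_
        refine (Tendsto.liminf_eq ?_).symm
        refine tendsto_const_nhds.congr' ?_
        filter_upwards [hχ z.1, hχ z.2] with n h1 h2
        rw [h1, h2]; simp
    _ ≤ liminf (fun n => ∫⁻ z, ENNReal.ofReal (c z * (χ n z.1 * χ n z.2)) ∂γ) atTop :=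
        lintegral_liminf_le hm
    _ ≤ ENNReal.ofReal T := by
        refine liminf_le_of_frequently_le' (Frequently.of_forall fun n => ?_)
        rw [← ofReal_integral_eq_lintegral_ofReal (hIntg n)
          (ae_of_all _ fun z => mul_nonneg (hc0 z) (mul_nonneg (hχ0 n _) (hχ0 n _)))]
        exact ENNReal.ofReal_le_ofReal (hT n)

lemma kantorovich (lam p : ℝ) (hp : 1 ≤ p) (hlam : 0 < lam) (μ ν : Measure Y)
    [IsProbabilityMeasure μ] [IsProbabilityMeasure ν] (T : ℝ)
    (hT : ∀ φ : C_c(Y, ℝ), -∫ y, φ y ∂ν - ∫ y, TT lam p φ y ∂μ ≤ T) :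
    ∃ γ : Measure (Y × Y), (γ.map Prod.fst = μ ∧ γ.map Prod.snd = ν) ∧
      ∫⁻ z, ENNReal.ofReal (lam * dist z.1 z.2 ^ p) ∂γ ≤ ENNReal.ofReal T := by
  obtain ⟨L, hL⟩ := kant_functional lam p hp hlam μ ν T hT
  obtain ⟨χ, hχ0, hχ1, hχ⟩ := exists_cutoff (Y := Y)
  have hc0 : ∀ y y' : Y, 0 ≤ lam * dist y y' ^ p := fun y y' => by positivity
  let Λ : C_c(Y × Y, ℝ) →ₚ[ℝ] ℝ := PositiveLinearMap.mk₀ L (by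
    intro h hh
    have := hL (-h) 0 0 0 le_rfl (fun y y' => by
      have : 0 ≤ h (y, y') := hh (y, y')
      simpa using this)
    simpa using this)
  let γ := RealRMK.rieszMeasure Λ
  have hγ : ∀ h : C_c(Y × Y, ℝ), ∫ z, h z ∂γ = L h := fun h => RealRMK.integral_rieszMeasure Λ h
  have hcc : ∀ (c : Y × Y → ℝ) (hc : Continuous c) (n : ℕ),
      HasCompactSupport (fun z : Y × Y => c z * (χ n z.1 * χ n z.2)) := by
    intro c hc n
    refine HasCompactSupport.mul_left ?_
    refine HasCompactSupport.intro ((χ n).hasCompactSupport.isCompact.prod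
      (χ n).hasCompactSupport.isCompact) ?_
    rintro ⟨y, y'⟩ hz
    rw [Set.mem_prod, not_and_or] at hz
    rcases hz with hz | hz
    · simp [image_eq_zero_of_notMem_tsupport hz]
    · simp [image_eq_zero_of_notMem_tsupport hz]
  have hcont : ∀ (c : Y × Y → ℝ) (hc : Continuous c) (n : ℕ),
      Continuous (fun z : Y × Y => c z * (χ n z.1 * χ n z.2)) := fun c hc n =>
    hc.mul (((χ n).continuous.comp continuous_fst).mul
      ((χ n).continuous.comp continuous_snd))
  let H : ∀ (c : Y × Y → ℝ) (hc : Continuous c) (n : ℕ), C_c(Y × Y, ℝ) := fun c hc n =>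
    ⟨⟨fun z => c z * (χ n z.1 * χ n z.2), hcont c hc n⟩, hcc c hc n⟩
  have hIntg : ∀ (c : Y × Y → ℝ) (hc : Continuous c) (n : ℕ),
      Integrable (fun z : Y × Y => c z * (χ n z.1 * χ n z.2)) γ := fun c hc n =>
    (hcont c hc n).integrable_of_hasCompactSupport (hcc c hc n)
  have hχχ0 : ∀ n y y', 0 ≤ χ n y * χ n y' := fun n y y' => mul_nonneg (hχ0 n y) (hχ0 n y')
  have hχχ1 : ∀ n y y', χ n y * χ n y' ≤ 1 := fun n y y' =>
    mul_le_one₀ (hχ1 n y) (hχ0 n y') (hχ1 n y')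
  -- mass
  have hmass1 : γ Set.univ ≤ 1 := by
    have := lintegral_le_of_cutoff γ χ hχ0 hχ (fun _ => 1) continuous_const (fun _ => zero_le_one)
      (hIntg _ continuous_const) 1 (fun n => by
        have h1 := hL (H (fun _ => 1) continuous_const n) (BoundedContinuousFunction.const Y 1) 0 0
          le_rfl (fun y y' => by
            change 1 * (χ n y * χ n y') ≤ 1 + 0 + 0 * _
            have := hχχ1 n y y'
            linarith)
        rw [← hγ] at h1
        refine h1.trans ?_
        simp)
    simpa using this
  haveI : IsFiniteMeasure γ := ⟨hmass1.trans_lt ENNReal.one_lt_top⟩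
  have hmass2 : 1 ≤ γ.real Set.univ := by
    have hl : ∀ (m : Measure Y) [IsProbabilityMeasure m],
        Tendsto (fun n => ∫ y, (1 - χ n y) ∂m) atTop (𝓝 0) := by
      intro m _
      have : Tendsto (fun n => ∫ y, (1 - χ n y) ∂m) atTop (𝓝 (∫ y, (0 : ℝ) ∂m)) := by
        refine tendsto_integral_of_dominated_convergence (fun y => 1) ?_ (integrable_const _) ?_ ?_
        · intro n
          exact (continuous_const.sub (χ n).continuous).aestronglyMeasurable
        · intro n
          refine ae_of_all _ fun y => ?_
          rw [Real.norm_eq_abs, abs_of_nonneg (by linarith [hχ1 n y])]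
          linarith [hχ0 n y]
        · refine ae_of_all _ fun y => ?_
          refine tendsto_const_nhds.congr' ?_
          filter_upwards [hχ y] with n hn
          rw [hn, sub_self]
      simpa using this
    have hlim : Tendsto (fun n => 1 - (∫ y, (1 - χ n y) ∂μ + ∫ y, (1 - χ n y) ∂ν)) atTop
        (𝓝 (1 - (0 + 0))) := tendsto_const_nhds.sub ((hl μ).add (hl ν))
    rw [add_zero, sub_zero] at hlim
    refine le_of_tendsto' hlim fun n => ?_
    have hχb : Y →ᵇ ℝ := 0
    have h1 := hL (-(H (fun _ => 1) continuous_const n))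
      (BoundedContinuousFunction.ofNormedAddCommGroup (fun y => 1 - χ n y)
        (continuous_const.sub (χ n).continuous) 1 (fun y => by
          rw [Real.norm_eq_abs, abs_of_nonneg (by linarith [hχ1 n y])]
          linarith [hχ0 n y])) (-(χ n)) 0
          le_rfl (fun y y' => by
            change -(1 * (χ n y * χ n y')) ≤ (1 - χ n y) + (-(χ n y')) + 0 * _
            nlinarith [hχ0 n y, hχ1 n y, hχ0 n y', hχ1 n y'])
    rw [map_neg, ← hγ] at h1
    have hχν : Integrable (χ n) ν :=
      (χ n).continuous.integrable_of_hasCompactSupport (χ n).hasCompactSupport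
    have e1 : ∫ y, (-(χ n)) y ∂ν = ∫ y, (1 - χ n y) ∂ν - 1 := by
      rw [integral_sub (integrable_const _) hχν]
      simp [integral_neg]
    rw [e1] at h1
    have h2 : ∫ z, H (fun _ => 1) continuous_const n z ∂γ ≤ ∫ z, (1 : ℝ) ∂γ := by
      refine integral_mono (hIntg _ continuous_const n) (integrable_const _) fun z => ?_
      change 1 * (χ n z.1 * χ n z.2) ≤ 1
      linarith [hχχ1 n z.1 z.2]
    have h3 : ∫ z, (1 : ℝ) ∂γ = γ.real Set.univ := by simp
    have h4 : -∫ z, H (fun _ => 1) continuous_const n z ∂γ ≤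
      ∫ y, (1 - χ n y) ∂μ + (∫ y, (1 - χ n y) ∂ν - 1) + 0 * T := h1
    linarith
  haveI : IsProbabilityMeasure γ := by
    refine ⟨le_antisymm hmass1 ?_⟩
    rw [← ENNReal.ofReal_one]
    exact (ENNReal.ofReal_le_iff_le_toReal (measure_ne_top _ _)).2 hmass2
  have hlimγ : ∀ (c : Y × Y → ℝ) (hc : Continuous c), (∀ z, 0 ≤ c z) → (∃ C, ∀ z, c z ≤ C) →
      ∀ T', (∀ n, ∫ z, c z * (χ n z.1 * χ n z.2) ∂γ ≤ T') → ∫ z, c z ∂γ ≤ T' := by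
    rintro c hc hc0 ⟨C, hC⟩ T' hT'
    have h0 : 0 ≤ T' := le_trans (integral_nonneg fun z => mul_nonneg (hc0 z) (hχχ0 0 _ _)) (hT' 0)
    have := lintegral_le_of_cutoff γ χ hχ0 hχ c hc hc0 (hIntg c hc) T' hT'
    rw [integral_eq_lintegral_of_nonneg_ae (ae_of_all _ hc0) hc.aestronglyMeasurable]
    exact ENNReal.toReal_le_of_le_ofReal h0 this
  refine ⟨γ, ⟨?_, ?_⟩, ?_⟩
  · haveI : IsProbabilityMeasure (γ.map Prod.fst) :=
      Measure.isProbabilityMeasure_map measurable_fst.aemeasurable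
    refine measure_eq_of_cc_le _ _ fun f hf => ?_
    obtain ⟨C, hC⟩ := f.hasCompactSupport.exists_bound_of_continuous f.continuous
    rw [integral_map (f := (f : Y → ℝ)) measurable_fst.aemeasurable f.continuous.aestronglyMeasurable]
    refine hlimγ (fun z => f z.1) (f.continuous.comp continuous_fst) (fun z => hf _)
      ⟨C, fun z => (abs_le.1 (hC z.1)).2⟩ _ fun n => ?_
    have h1 := hL (H (fun z => f z.1) (f.continuous.comp continuous_fst) n)
      (BoundedContinuousFunction.ofNormedAddCommGroup f f.continuous C hC) 0 0 le_rfl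
      (fun y y' => by
        change f y * (χ n y * χ n y') ≤ f y + 0 + 0 * _
        have := mul_le_of_le_one_right (hf y) (hχχ1 n y y')
        linarith)
    rw [← hγ] at h1
    refine h1.trans (le_of_eq ?_)
    simp
  · haveI : IsProbabilityMeasure (γ.map Prod.snd) :=
      Measure.isProbabilityMeasure_map measurable_snd.aemeasurable
    refine measure_eq_of_cc_le _ _ fun f hf => ?_
    obtain ⟨C, hC⟩ := f.hasCompactSupport.exists_bound_of_continuous f.continuous
    rw [integral_map (f := (f : Y → ℝ)) measurable_snd.aemeasurable f.continuous.aestronglyMeasurable]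
    refine hlimγ (fun z => f z.2) (f.continuous.comp continuous_snd) (fun z => hf _)
      ⟨C, fun z => (abs_le.1 (hC z.2)).2⟩ _ fun n => ?_
    have h1 := hL (H (fun z => f z.2) (f.continuous.comp continuous_snd) n)
      0 f 0 le_rfl
      (fun y y' => by
        change f y' * (χ n y * χ n y') ≤ 0 + f y' + 0 * _
        have := mul_le_of_le_one_right (hf y') (hχχ1 n y y')
        linarith)
    rw [← hγ] at h1
    refine h1.trans (le_of_eq ?_)
    simp
  · refine lintegral_le_of_cutoff γ χ hχ0 hχ (fun z => lam * dist z.1 z.2 ^ p)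
      (continuous_cost lam p hp) (fun z => hc0 _ _) (hIntg _ (continuous_cost lam p hp)) T
      fun n => ?_
    have h1 := hL (H (fun z => lam * dist z.1 z.2 ^ p) (continuous_cost lam p hp) n)
      0 0 1 zero_le_one
      (fun y y' => by
        change (lam * dist y y' ^ p) * (χ n y * χ n y') ≤ 0 + 0 + 1 * _
        have := mul_le_of_le_one_right (hc0 y y') (hχχ1 n y y')
        linarith)
    rw [← hγ] at h1
    refine h1.trans (le_of_eq ?_)
    simp

/-- Countable uniformly dense family of compactly supported functions. -/
lemma exists_dense_cc {Y : Type*} [MetricSpace Y] [SecondCountableTopology Y]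
    [LocallyCompactSpace Y] : ∃ φ : ℕ → C_c(Y, ℝ), ∀ (ψ : C_c(Y, ℝ)) (ε : ℝ), 0 < ε →
      ∃ k, ∀ y, |φ k y - ψ y| ≤ ε := by
  let K : CompactExhaustion Y := default
  let s : ℕ → Set C(Y, ℝ) := fun n => {f | tsupport f ⊆ K n}
  have hsep : ∀ n, ∃ t ⊆ s n, t.Countable ∧ s n ⊆ closure t := fun n =>
    (TopologicalSpace.IsSeparable.of_separableSpace (s n)).exists_countable_dense_subset
  choose t hts htc htd using hsep
  have hcount : (⋃ n, t n).Countable := Set.countable_iUnion htc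
  have h0 : (0 : C(Y, ℝ)) ∈ s 0 := by
    change tsupport (fun _ => (0 : ℝ)) ⊆ _
    simp [tsupport]
  have hne : (⋃ n, t n).Nonempty := by
    have h0 := htd 0 h0
    have : (t 0).Nonempty := by
      by_contra h
      rw [Set.not_nonempty_iff_eq_empty] at h
      simp [h] at h0
    obtain ⟨x, hx⟩ := this
    exact ⟨x, Set.mem_iUnion.2 ⟨0, hx⟩⟩
  obtain ⟨u, hu⟩ := hcount.exists_eq_range hne
  have hmem : ∀ k, ∃ n, u k ∈ t n := fun k => by
    have : u k ∈ ⋃ n, t n := hu ▸ Set.mem_range_self k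
    exact Set.mem_iUnion.1 this
  refine ⟨fun k => ⟨u k, ?_⟩, ?_⟩
  · obtain ⟨n, hn⟩ := hmem k
    exact (K.isCompact n).of_isClosed_subset (isClosed_tsupport _) (hts n hn)
  · intro ψ ε hε
    obtain ⟨n, hn⟩ : ∃ n, tsupport ψ ⊆ K n :=
      K.exists_superset_of_isCompact ψ.hasCompactSupport
    have hψ : (ψ : C(Y, ℝ)) ∈ closure (t n) := htd n hn
    have hnb : {g : C(Y, ℝ) | ∀ y ∈ K n, dist (ψ y) (g y) < ε} ∈ 𝓝 (ψ : C(Y, ℝ)) := by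
      have := (ContinuousMap.tendsto_iff_forall_isCompact_tendstoUniformlyOn
        (F := fun g : C(Y, ℝ) => g) (f := (ψ : C(Y, ℝ))) (p := 𝓝 (ψ : C(Y, ℝ)))).1 tendsto_id
          (K n) (K.isCompact n)
      exact Metric.tendstoUniformlyOn_iff.1 this ε hε
    obtain ⟨g, hg1, hg2⟩ := mem_closure_iff_nhds.1 hψ _ hnb
    obtain ⟨k, rfl⟩ : g ∈ Set.range u := hu ▸ Set.mem_iUnion.2 ⟨n, hg2⟩
    refine ⟨k, fun y => ?_⟩
    change |u k y - ψ y| ≤ ε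
    by_cases hy : y ∈ K n
    · have := hg1 y hy
      rw [dist_comm, Real.dist_eq] at this
      exact this.le
    · have h1 : ψ y = 0 := image_eq_zero_of_notMem_tsupport fun h => hy (hn h)
      have h2 : u k y = 0 := image_eq_zero_of_notMem_tsupport fun h => hy (hts n hg2 h)
      rw [h1, h2]; simpa using hε.le

end Kant2
section Trans

lemma lintegral_ofReal_cost {Y : Type*} [PseudoMetricSpace Y] [MeasurableSpace Y]
    (lam p : ℝ) (hp : 1 ≤ p) (hlam : 0 < lam) (γ : Measure (Y × Y)) :
    ∫⁻ z, ENNReal.ofReal (lam * dist z.1 z.2 ^ p) ∂γ =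
      ENNReal.ofReal lam * ∫⁻ z, edist z.1 z.2 ^ p ∂γ := by
  rw [← lintegral_const_mul' _ _ ENNReal.ofReal_ne_top]
  refine lintegral_congr fun z => ?_
  rw [ENNReal.ofReal_mul hlam.le, edist_dist,
    ENNReal.ofReal_rpow_of_nonneg dist_nonneg (by linarith)]

lemma MK_rpow_le {Y : Type*} [PseudoMetricSpace Y] [MeasurableSpace Y]
    (p : ℝ) (hp : 1 ≤ p) (μ ν : Measure Y) (γ : Measure (Y × Y))
    (hγ : γ.map Prod.fst = μ ∧ γ.map Prod.snd = ν) :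
    MK p μ ν ^ p ≤ ∫⁻ z, edist z.1 z.2 ^ p ∂γ := by
  have h : MK p μ ν ≤ (∫⁻ z, edist z.1 z.2 ^ p ∂γ) ^ (1 / p) := iInf₂_le γ hγ
  calc MK p μ ν ^ p ≤ ((∫⁻ z, edist z.1 z.2 ^ p ∂γ) ^ (1 / p)) ^ p :=
        ENNReal.rpow_le_rpow h (by linarith)
    _ = _ := by
        rw [← ENNReal.rpow_mul, one_div_mul_cancel (by linarith), ENNReal.rpow_one]

lemma le_MK_rpow {Y : Type*} [PseudoMetricSpace Y] [MeasurableSpace Y]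
    (p : ℝ) (hp : 1 ≤ p) (μ ν : Measure Y) (a : ℝ≥0∞)
    (h : ∀ γ : Measure (Y × Y), γ.map Prod.fst = μ → γ.map Prod.snd = ν →
      a ≤ ∫⁻ z, edist z.1 z.2 ^ p ∂γ) : a ≤ MK p μ ν ^ p := by
  have h1 : a ^ (1 / p) ≤ MK p μ ν := by
    refine le_iInf₂ fun γ hγ => ?_
    exact ENNReal.rpow_le_rpow (h γ hγ.1 hγ.2) (by positivity)
  calc a = (a ^ (1 / p)) ^ p := by
        rw [← ENNReal.rpow_mul, one_div_mul_cancel (by linarith), ENNReal.rpow_one]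
    _ ≤ _ := ENNReal.rpow_le_rpow h1 (by linarith)

variable {Y : Type*} [MetricSpace Y] [CompleteSpace Y] [SecondCountableTopology Y]
    [LocallyCompactSpace Y] [MeasurableSpace Y] [BorelSpace Y]
variable {Ω : Type*} [MetricSpace Ω] [SecondCountableTopology Ω]
    [MeasurableSpace Ω] [BorelSpace Ω]

/-- Growth class. -/
structure Gr (lam p : ℝ) (y0 : Y) (ξ : Ω × Y → ℝ) (C : ℝ) : Prop where
  cont : Continuous ξ
  bd : ∀ u : Ω × Y, |ξ u| ≤ C * (1 + dist y0 u.2 ^ p)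
  ub : ∀ (ω : Ω) (y y' : Y), -(lam * dist y y' ^ p) - ξ (ω, y') ≤ C * (1 + dist y0 y ^ p)

/-- Fiber transform on the product. -/
noncomputable def T2 (lam p : ℝ) (ξ : Ω × Y → ℝ) (u : Ω × Y) : ℝ :=
  TT lam p (fun y' => ξ (u.1, y')) u.2

lemma Gr.bdd {lam p : ℝ} {y0 : Y} {ξ : Ω × Y → ℝ} {C : ℝ} (h : Gr lam p y0 ξ C) (u : Ω × Y) :
    BddAbove (Set.range fun y' => -(lam * dist u.2 y' ^ p) - ξ (u.1, y')) :=
  ⟨_, by rintro _ ⟨y', rfl⟩; exact h.ub u.1 u.2 y'⟩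

lemma Gr.le_T2 {lam p : ℝ} {y0 : Y} {ξ : Ω × Y → ℝ} {C : ℝ} (h : Gr lam p y0 ξ C) (ω : Ω)
    (y y' : Y) : -(lam * dist y y' ^ p) - ξ (ω, y') ≤ T2 lam p ξ (ω, y) :=
  le_ciSup (h.bdd (ω, y)) y'

lemma Gr.abs_T2 {lam p : ℝ} (hp : 1 ≤ p) {y0 : Y} {ξ : Ω × Y → ℝ} {C : ℝ}
    (h : Gr lam p y0 ξ C) (u : Ω × Y) : |T2 lam p ξ u| ≤ C * (1 + dist y0 u.2 ^ p) := by
  haveI : Nonempty Y := ⟨y0⟩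
  rw [abs_le]
  constructor
  · refine le_trans ?_ (h.le_T2 u.1 u.2 u.2)
    rw [dist_self, Real.zero_rpow (by linarith)]
    have := (abs_le.1 (h.bd u)).2
    simp only [Prod.mk.eta]
    linarith
  · exact ciSup_le fun y' => h.ub _ _ _

lemma Gr.meas_T2 {lam p : ℝ} (hp : 1 ≤ p) {y0 : Y} {ξ : Ω × Y → ℝ} {C : ℝ}
    (h : Gr lam p y0 ξ C) : Measurable (T2 lam p ξ) := by
  refine LowerSemicontinuous.measurable (lowerSemicontinuous_ciSup h.bdd fun y' => ?_)
  refine Continuous.lowerSemicontinuous ?_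
  refine (Continuous.neg ?_).sub (h.cont.comp (continuous_fst.prodMk continuous_const))
  exact (continuous_cost lam p hp).comp (continuous_snd.prodMk continuous_const)

lemma Gr.slam {lam p : ℝ} {y0 : Y} {ξ : Ω × Y → ℝ} {C : ℝ} (h : Gr lam p y0 ξ C) (u : Ω × Y) :
    Slam lam p ξ u = ((T2 lam p ξ u : ℝ) : EReal) := by
  haveI : Nonempty Y := ⟨y0⟩
  refine le_antisymm (iSup_le fun y' => EReal.coe_le_coe_iff.2 (h.le_T2 u.1 u.2 y')) ?_
  have hS : ∀ y', ((-(lam * dist u.2 y' ^ p) - ξ (u.1, y') : ℝ) : EReal) ≤ Slam lam p ξ u :=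
    fun y' => le_iSup (fun y' => ((-(lam * dist u.2 y' ^ p) - ξ (u.1, y') : ℝ) : EReal)) y'
  generalize Slam lam p ξ u = s at hS
  induction s with
  | bot => exact absurd (le_bot_iff.1 (hS y0)) (EReal.coe_ne_bot _)
  | top => exact le_top
  | coe s => exact EReal.coe_le_coe_iff.2 (ciSup_le fun y' => EReal.coe_le_coe_iff.1 (hS y'))

lemma gr_of_bounded {lam p : ℝ} (hlam : 0 < lam) (y0 : Y) {ξ : Ω × Y → ℝ} (hc : Continuous ξ)
    {C : ℝ} (hC : ∀ u, |ξ u| ≤ C) : Gr lam p y0 ξ C := by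
  have aux : ∀ (ω : Ω) y, C ≤ C * (1 + dist y0 y ^ p) := fun ω y => by
    have : 0 ≤ C := (abs_nonneg _).trans (hC (ω, y0))
    have : 0 ≤ C * dist y0 y ^ p := by positivity
    linarith
  refine ⟨hc, fun u => (hC u).trans (aux u.1 u.2), fun ω y y' => ?_⟩
  have h1 := (abs_le.1 (hC (ω, y'))).1
  have : 0 ≤ lam * dist y y' ^ p := by positivity
  linarith [aux ω y]

lemma gr_of_memXp {lam p : ℝ} (hp : 1 ≤ p) (hlam : 0 < lam) (y0 : Y) {ξ : Ω × Y → ℝ}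
    (h : MemXp p y0 ξ) : ∃ C, Gr lam p y0 ξ C := by
  obtain ⟨hc, ht⟩ := h
  set ε : ℝ := lam / 2 ^ (p - 1) with hε
  have h2 : (0 : ℝ) < 2 ^ (p - 1) := by positivity
  have hεpos : 0 < ε := by positivity
  have hev : ∀ᶠ u in cocompact (Ω × Y), |ξ u / (1 + dist y0 u.2 ^ p)| < ε := by
    have := (Metric.tendsto_nhds.1 ht) ε hεpos
    simpa only [Real.dist_eq, sub_zero] using this
  obtain ⟨K, hK, hKs⟩ := mem_cocompact.1 hev
  obtain ⟨M, hM⟩ : ∃ M, ∀ u ∈ K, ‖ξ u‖ ≤ M := hK.exists_bound_of_continuousOn hc.continuousOn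
  have hw : ∀ y : Y, 0 ≤ dist y0 y ^ p := fun y => by positivity
  have hb : ∀ u, |ξ u| ≤ |M| + ε * (1 + dist y0 u.2 ^ p) := by
    intro u
    by_cases hu : u ∈ K
    · have h1 := hM u hu
      rw [Real.norm_eq_abs] at h1
      have : 0 ≤ ε * (1 + dist y0 u.2 ^ p) := mul_nonneg hεpos.le (by linarith [hw u.2])
      linarith [le_abs_self M]
    · have h1 : |ξ u / (1 + dist y0 u.2 ^ p)| < ε := hKs hu
      have hpos : 0 < 1 + dist y0 u.2 ^ p := by linarith [hw u.2]
      rw [abs_div, abs_of_pos hpos, div_lt_iff₀ hpos] at h1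
      linarith [abs_nonneg M]
  refine ⟨|M| + ε + lam, hc, fun u => (hb u).trans ?_, fun ω y y' => ?_⟩
  · have h1 := hw u.2
    nlinarith [abs_nonneg M, mul_nonneg (abs_nonneg M) h1, mul_nonneg hlam.le h1]
  · have h1 := (abs_le.1 (hb (ω, y'))).1
    simp only at h1
    have h3 : dist y0 y' ^ p ≤ 2 ^ (p - 1) * (dist y0 y ^ p + dist y y' ^ p) := by
      calc dist y0 y' ^ p ≤ (dist y0 y + dist y y') ^ p :=
            Real.rpow_le_rpow dist_nonneg (dist_triangle _ _ _) (by linarith)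
        _ ≤ _ := by
            exact_mod_cast NNReal.rpow_add_le_mul_rpow_add_rpow (nndist y0 y) (nndist y y') hp
    have h4 : ε * dist y0 y' ^ p ≤ lam * (dist y0 y ^ p + dist y y' ^ p) := by
      calc ε * dist y0 y' ^ p ≤ ε * (2 ^ (p - 1) * (dist y0 y ^ p + dist y y' ^ p)) :=
            mul_le_mul_of_nonneg_left h3 hεpos.le
        _ = _ := by rw [hε]; field_simp
    have h5 := hw y
    nlinarith [abs_nonneg M, mul_nonneg (abs_nonneg M) h5, mul_nonneg hεpos.le h5]

end Trans
section Val

lemma eIntegral_coe {α : Type*} [MeasurableSpace α] (μ : Measure α) (g : α → ℝ)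
    (hg : Integrable g μ) : eIntegral (fun x => ((g x : ℝ) : EReal)) μ = ((∫ x, g x ∂μ : ℝ) : EReal) := by
  have e : ∀ x : ℝ, eToENNReal (x : EReal) = ENNReal.ofReal x := fun x => by
    simp [eToENNReal]
  have e' : ∀ x : ℝ, eToENNReal (-(x : EReal)) = ENNReal.ofReal (-x) := fun x => by
    rw [← EReal.coe_neg, e]
  simp only [eIntegral, e, e']
  rw [integral_eq_lintegral_pos_part_sub_lintegral_neg_part hg, EReal.coe_sub]
  rw [EReal.coe_ennreal_toReal, EReal.coe_ennreal_toReal]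
  · exact hg.neg.lintegral_lt_top.ne
  · exact hg.lintegral_lt_top.ne

lemma eIntegral_congr_ae {α : Type*} [MeasurableSpace α] (μ : Measure α) (f g : α → EReal)
    (h : ∀ᵐ x ∂μ, f x = g x) : eIntegral f μ = eIntegral g μ := by
  unfold eIntegral
  have h1 : ∫⁻ x, eToENNReal (f x) ∂μ = ∫⁻ x, eToENNReal (g x) ∂μ :=
    lintegral_congr_ae (h.mono fun x hx => by simp only [hx])
  have h2 : ∫⁻ x, eToENNReal (-f x) ∂μ = ∫⁻ x, eToENNReal (-g x) ∂μ :=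
    lintegral_congr_ae (h.mono fun x hx => by simp only [hx])
  rw [h1, h2]

variable {Y : Type*} [MetricSpace Y] [CompleteSpace Y] [SecondCountableTopology Y]
    [LocallyCompactSpace Y] [MeasurableSpace Y] [BorelSpace Y]
variable {Ω : Type*} [MetricSpace Ω] [SecondCountableTopology Ω]
    [MeasurableSpace Ω] [BorelSpace Ω]

lemma integrable_of_growth (σ : Measure Ω) [IsProbabilityMeasure σ] (y0 : Y) (p : ℝ) (hp : 1 ≤ p)
    (κ : Kernel Ω Y) [IsMarkovKernel κ]
    (hmom : ∫⁻ ω, ∫⁻ y, edist y0 y ^ p ∂(κ ω) ∂σ ≠ ∞) (F : Ω × Y → ℝ) (hF : Measurable F)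
    (C : ℝ) (hC : ∀ u, |F u| ≤ C * (1 + dist y0 u.2 ^ p)) : Integrable F (σ.compProd κ) := by
  have hd : Integrable (fun u : Ω × Y => dist y0 u.2 ^ p) (σ.compProd κ) := by
    have hc : Continuous (fun u : Ω × Y => dist y0 u.2 ^ p) :=
      (continuous_const.dist continuous_snd).rpow_const (fun _ => Or.inr (by linarith))
    refine ⟨hc.aestronglyMeasurable, ?_⟩
    rw [hasFiniteIntegral_iff_ofReal (ae_of_all _ fun u => by positivity),
      Measure.lintegral_compProd hc.measurable.ennreal_ofReal]
    refine lt_of_le_of_lt (le_of_eq ?_) hmom.lt_top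
    refine lintegral_congr fun ω => lintegral_congr fun y => ?_
    rw [edist_dist, ENNReal.ofReal_rpow_of_nonneg dist_nonneg (by linarith)]
  refine Integrable.mono' ((((integrable_const (1 : ℝ))).add hd).const_mul C)
    hF.aestronglyMeasurable (ae_of_all _ fun u => ?_)
  exact hC u

/-- The fiberwise dual value. -/
noncomputable def Bf (lam p : ℝ) (κ η : Kernel Ω Y) (ξ : Ω × Y → ℝ) (ω : Ω) : ℝ :=
  -∫ y, ξ (ω, y) ∂(η ω) - ∫ y, T2 lam p ξ (ω, y) ∂(κ ω)

variable (σ : Measure Ω) [IsProbabilityMeasure σ] (y0 : Y) (p : ℝ)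
    (κ η : Kernel Ω Y) [IsMarkovKernel κ] [IsMarkovKernel η] (lam : ℝ)

lemma integrable_fiber (hp : 1 ≤ p) (κ : Kernel Ω Y) [IsMarkovKernel κ]
    (hκ : ∫⁻ ω, ∫⁻ y, edist y0 y ^ p ∂(κ ω) ∂σ ≠ ∞) (F : Ω × Y → ℝ) (hF : Measurable F)
    (C : ℝ) (hC : ∀ u, |F u| ≤ C * (1 + dist y0 u.2 ^ p)) :
    (∀ᵐ ω ∂σ, Integrable (fun y => F (ω, y)) (κ ω)) ∧
      Integrable (fun ω => ∫ y, F (ω, y) ∂(κ ω)) σ := by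
  have h := integrable_of_growth σ y0 p hp κ hκ F hF C hC
  refine ⟨((Measure.integrable_compProd_iff h.aestronglyMeasurable).1 h).1, ?_⟩
  refine Integrable.mono' ((Measure.integrable_compProd_iff h.aestronglyMeasurable).1 h).2 ?_ ?_
  · exact (hF.stronglyMeasurable.integral_kernel_prod_right' (κ := κ)).aestronglyMeasurable
  · exact ae_of_all _ fun ω => norm_integral_le_integral_norm _

lemma integrable_Bf (hp : 1 ≤ p)
    (hκ : ∫⁻ ω, ∫⁻ y, edist y0 y ^ p ∂(κ ω) ∂σ ≠ ∞)
    (hη : ∫⁻ ω, ∫⁻ y, edist y0 y ^ p ∂(η ω) ∂σ ≠ ∞)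
    {ξ : Ω × Y → ℝ} {C : ℝ} (h : Gr lam p y0 ξ C) :
    Integrable (Bf lam p κ η ξ) σ :=
  (integrable_fiber σ y0 p hp η hη ξ h.cont.measurable C h.bd).2.neg.sub
    (integrable_fiber σ y0 p hp κ hκ _ (h.meas_T2 hp) C (h.abs_T2 hp)).2

lemma measurable_Bf (hp : 1 ≤ p) {ξ : Ω × Y → ℝ} {C : ℝ} (h : Gr lam p y0 ξ C) :
    Measurable (Bf lam p κ η ξ) := by
  refine Measurable.sub (Measurable.neg ?_) ?_
  · exact (h.cont.measurable.stronglyMeasurable.integral_kernel_prod_right' (κ := η)).measurable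
  · exact ((h.meas_T2 hp).stronglyMeasurable.integral_kernel_prod_right' (κ := κ)).measurable

lemma value_eq (hp : 1 ≤ p)
    (hκ : ∫⁻ ω, ∫⁻ y, edist y0 y ^ p ∂(κ ω) ∂σ ≠ ∞)
    (hη : ∫⁻ ω, ∫⁻ y, edist y0 y ^ p ∂(η ω) ∂σ ≠ ∞)
    {ξ : Ω × Y → ℝ} {C : ℝ} (h : Gr lam p y0 ξ C) (ζ : Ω → ℝ) (hζ : Continuous ζ)
    (hζb : ∃ C, ∀ ω, |ζ ω| ≤ C) (f : Ω × Y → ℝ) (hf : ∀ u, f u = ζ u.1 * ξ u) :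
    ∃ v : ℝ, eIntegral (fun ω => ((ζ ω : ℝ) : EReal) *
          eIntegral (fun y => Slam lam p ξ (ω, y)) (κ ω)) σ = (v : EReal) ∧
      -∫ u, f u ∂(σ.compProd η) - v = ∫ ω, ζ ω * Bf lam p κ η ξ ω ∂σ := by
  obtain ⟨D, hD⟩ := hζb
  obtain ⟨hT1, hT2⟩ := integrable_fiber σ y0 p hp κ hκ _ (h.meas_T2 hp) C (h.abs_T2 hp)
  obtain ⟨hξ1, hξ2⟩ := integrable_fiber σ y0 p hp η hη ξ h.cont.measurable C h.bd
  have hζT : Integrable (fun ω => ζ ω * ∫ y, T2 lam p ξ (ω, y) ∂(κ ω)) σ :=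
    hT2.bdd_mul hζ.aestronglyMeasurable (ae_of_all _ hD)
  have hζξ : Integrable (fun ω => ζ ω * ∫ y, ξ (ω, y) ∂(η ω)) σ :=
    hξ2.bdd_mul hζ.aestronglyMeasurable (ae_of_all _ hD)
  refine ⟨∫ ω, ζ ω * ∫ y, T2 lam p ξ (ω, y) ∂(κ ω) ∂σ, ?_, ?_⟩
  · rw [← eIntegral_coe _ _ hζT]
    refine eIntegral_congr_ae _ _ _ ?_
    filter_upwards [hT1] with ω hω
    simp only [h.slam]
    rw [eIntegral_coe _ _ hω, EReal.coe_mul]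
  · have hfi : Integrable f (σ.compProd η) := by
      have := (integrable_of_growth σ y0 p hp η hη ξ h.cont.measurable C h.bd).bdd_mul
        (hζ.comp continuous_fst).aestronglyMeasurable (ae_of_all _ fun u => hD u.1)
      refine this.congr (ae_of_all _ fun u => ?_)
      rw [hf u]; rfl
    rw [Measure.integral_compProd hfi]
    have e : ∀ ω, ∫ y, f (ω, y) ∂(η ω) = ζ ω * ∫ y, ξ (ω, y) ∂(η ω) := fun ω => by
      rw [← integral_const_mul]
      exact integral_congr_ae (ae_of_all _ fun y => hf (ω, y))
    simp only [e]
    have hn : Integrable (fun ω => -(ζ ω * ∫ y, ξ (ω, y) ∂(η ω))) σ := hζξ.neg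
    rw [← integral_neg, ← integral_sub hn hζT]
    refine integral_congr_ae (ae_of_all _ fun ω => ?_)
    simp only [Bf]
    ring

lemma Bf_le_MK (hp : 1 ≤ p)
    (hκ : ∫⁻ ω, ∫⁻ y, edist y0 y ^ p ∂(κ ω) ∂σ ≠ ∞)
    (hη : ∫⁻ ω, ∫⁻ y, edist y0 y ^ p ∂(η ω) ∂σ ≠ ∞)
    (hlam : 0 < lam) {ξ : Ω × Y → ℝ} {C : ℝ} (h : Gr lam p y0 ξ C) :
    ∀ᵐ ω ∂σ, ENNReal.ofReal (Bf lam p κ η ξ ω) ≤ ENNReal.ofReal lam * MK p (κ ω) (η ω) ^ p := by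
  obtain ⟨hT1, hT2⟩ := integrable_fiber σ y0 p hp κ hκ _ (h.meas_T2 hp) C (h.abs_T2 hp)
  obtain ⟨hξ1, hξ2⟩ := integrable_fiber σ y0 p hp η hη ξ h.cont.measurable C h.bd
  filter_upwards [hT1, hξ1] with ω hTi hξi
  have hl0 : ENNReal.ofReal lam ≠ 0 := by simpa using hlam
  rw [← ENNReal.div_le_iff' hl0 ENNReal.ofReal_ne_top]
  refine le_MK_rpow p hp _ _ _ fun γ hγ1 hγ2 => ?_
  rw [ENNReal.div_le_iff' hl0 ENNReal.ofReal_ne_top, ← lintegral_ofReal_cost lam p hp hlam]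
  have hTi' : Integrable (fun z : Y × Y => T2 lam p ξ (ω, z.1)) γ := by
    rw [← hγ1] at hTi
    exact hTi.comp_measurable measurable_fst
  have hξi' : Integrable (fun z : Y × Y => ξ (ω, z.2)) γ := by
    rw [← hγ2] at hξi
    exact hξi.comp_measurable measurable_snd
  have e1 : ∫ y, ξ (ω, y) ∂(η ω) = ∫ z : Y × Y, ξ (ω, z.2) ∂γ := by
    rw [← hγ2, integral_map measurable_snd.aemeasurable]
    exact (h.cont.comp (continuous_const.prodMk continuous_id)).aestronglyMeasurable
  have e2 : ∫ y, T2 lam p ξ (ω, y) ∂(κ ω) = ∫ z : Y × Y, T2 lam p ξ (ω, z.1) ∂γ := by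
    rw [← hγ1, integral_map measurable_fst.aemeasurable]
    exact ((h.meas_T2 hp).comp measurable_prodMk_left).aestronglyMeasurable
  have e3 : Bf lam p κ η ξ ω = ∫ z : Y × Y, (-ξ (ω, z.2) - T2 lam p ξ (ω, z.1)) ∂γ := by
    have hn : Integrable (fun z : Y × Y => -ξ (ω, z.2)) γ := hξi'.neg
    rw [integral_sub hn hTi', integral_neg, Bf, e1, e2]
  rw [e3]
  refine (ENNReal.ofReal_le_ofReal (le_refl _)).trans ?_
  have hii : Integrable (fun z : Y × Y => (-ξ (ω, z.2) - T2 lam p ξ (ω, z.1))) γ := hξi'.neg.sub hTi'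
  refine (ENNReal.ofReal_le_ofReal (integral_mono hii hii.pos_part
    (fun z => le_max_left _ _))).trans ?_
  rw [ofReal_integral_eq_lintegral_ofReal hii.pos_part (ae_of_all _ fun z => le_max_right _ _)]
  refine lintegral_mono fun z => ENNReal.ofReal_le_ofReal ?_
  refine max_le ?_ (by positivity)
  have := h.le_T2 ω z.1 z.2
  linarith

end Val
section Mom

variable {Y : Type*} [MetricSpace Y] [CompleteSpace Y] [SecondCountableTopology Y]
    [LocallyCompactSpace Y] [MeasurableSpace Y] [BorelSpace Y]
variable {Ω : Type*} [MeasurableSpace Ω]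

lemma moment_le_MK (p : ℝ) (hp : 1 ≤ p) (y0 : Y) (μ : Measure Y) :
    ∫⁻ y, edist y0 y ^ p ∂μ ≤ MK p (Measure.dirac y0) μ ^ p := by
  refine le_MK_rpow p hp _ _ _ fun γ h1 h2 => ?_
  rw [← h2, lintegral_map (by fun_prop) measurable_snd]
  have hae : ∀ᵐ z ∂γ, z.1 = y0 := by
    have : ∀ᵐ y ∂(γ.map Prod.fst), y = y0 := by
      rw [h1]; simp [ae_dirac_eq]
    exact ae_of_ae_map measurable_fst.aemeasurable this
  refine le_of_eq (lintegral_congr_ae ?_)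
  filter_upwards [hae] with z hz
  rw [hz]

lemma moment_of_MemP (σ : Measure Ω) [IsProbabilityMeasure σ] (p : ℝ) (hp : 1 ≤ p) (q : ℝ≥0∞)
    (hpq : ENNReal.ofReal p ≤ q) (y0 : Y) (κ : Kernel Ω Y) (h : MemP p q σ y0 κ) :
    ∫⁻ ω, ∫⁻ y, edist y0 y ^ p ∂(κ ω) ∂σ ≠ ∞ := by
  obtain ⟨_, h⟩ := h
  have hle : ∀ ω, ∫⁻ y, edist y0 y ^ p ∂(κ ω) ≤ MK p (Measure.dirac y0) (κ ω) ^ p :=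
    fun ω => moment_le_MK p hp y0 _
  unfold scrMK at h
  simp only [Kernel.const_apply] at h
  split_ifs at h with hq
  · have h1 : ∀ᵐ ω ∂σ, ∫⁻ y, edist y0 y ^ p ∂(κ ω) ≤
        (essSup (fun ω => MK p (Measure.dirac y0) (κ ω)) σ) ^ p := by
      filter_upwards [ENNReal.ae_le_essSup (fun ω => MK p (Measure.dirac y0) (κ ω))] with ω hω
      exact (hle ω).trans (ENNReal.rpow_le_rpow hω (by linarith))
    refine ((lintegral_mono_ae h1).trans_lt ?_).ne
    rw [lintegral_const, measure_univ, mul_one]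
    exact ENNReal.rpow_lt_top_of_nonneg (by linarith) h
  · have hpq' : p ≤ q.toReal := by
      rwa [ENNReal.ofReal_le_iff_le_toReal hq] at hpq
    have hq0 : 0 < q.toReal := by linarith
    have h1 : ∫⁻ ω, MK p (Measure.dirac y0) (κ ω) ^ q.toReal ∂σ ≠ ∞ := by
      intro h'
      rw [h', ENNReal.top_rpow_of_pos (by positivity)] at h
      exact h rfl
    have h2 : ∀ ω, ∫⁻ y, edist y0 y ^ p ∂(κ ω) ≤
        1 + MK p (Measure.dirac y0) (κ ω) ^ q.toReal := fun ω => by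
      refine (hle ω).trans ?_
      rcases le_total (MK p (Measure.dirac y0) (κ ω)) 1 with h3 | h3
      · exact le_add_right (ENNReal.rpow_le_one h3 (by linarith))
      · exact le_add_left (ENNReal.rpow_le_rpow_of_exponent_le h3 hpq')
    refine ((lintegral_mono h2).trans_lt ?_).ne
    rw [lintegral_add_left measurable_const, lintegral_const, measure_univ, mul_one]
    exact ENNReal.add_lt_top.2 ⟨ENNReal.one_lt_top, h1.lt_top⟩

/-- The target as an `L^r` norm. -/
lemma scrMK_eq_eLpNorm (σ : Measure Ω) (p : ℝ) (hp : 1 ≤ p) (q : ℝ≥0∞)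
    (hpq : ENNReal.ofReal p ≤ q) (κ η : Kernel Ω Y) (lam : ℝ) :
    ENNReal.ofReal lam * scrMK p q σ κ η ^ p =
      eLpNorm (fun ω => ENNReal.ofReal lam * MK p (κ ω) (η ω) ^ p) (q / ENNReal.ofReal p) σ := by
  have hp0 : 0 < p := by linarith
  have hop : ENNReal.ofReal p ≠ 0 := by simpa using hp0
  unfold scrMK
  split_ifs with hq
  · subst hq
    rw [ENNReal.top_div_of_ne_top ENNReal.ofReal_ne_top, eLpNorm_exponent_top,
      eLpNormEssSup_eq_essSup_enorm]
    simp only [enorm_eq_self]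
    rw [ENNReal.essSup_const_mul]
    congr 1
    exact OrderIso.essSup_apply (fun ω => MK p (κ ω) (η ω)) σ (ENNReal.orderIsoRpow p hp0)
  · have hpq' : p ≤ q.toReal := by
      rwa [ENNReal.ofReal_le_iff_le_toReal hq] at hpq
    have hq0 : 0 < q.toReal := by linarith
    have hr : (q / ENNReal.ofReal p).toReal = q.toReal / p := by
      rw [ENNReal.toReal_div, ENNReal.toReal_ofReal hp0.le]
    have hr0 : q / ENNReal.ofReal p ≠ 0 := by
      intro h; rw [h] at hr
      have : 0 < q.toReal / p := by positivity
      simp at hr; simp [← hr] at this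
    have hrt : q / ENNReal.ofReal p ≠ ∞ := ENNReal.div_ne_top hq hop
    rw [eLpNorm_eq_lintegral_rpow_enorm_toReal hr0 hrt, hr]
    simp only [enorm_eq_self]
    have e : ∀ ω, (ENNReal.ofReal lam * MK p (κ ω) (η ω) ^ p) ^ (q.toReal / p) =
        ENNReal.ofReal lam ^ (q.toReal / p) * MK p (κ ω) (η ω) ^ q.toReal := fun ω => by
      rw [ENNReal.mul_rpow_of_nonneg _ _ (by positivity), ← ENNReal.rpow_mul]
      congr 2; field_simp
    simp only [e]
    rw [lintegral_const_mul' _ _ (ENNReal.rpow_ne_top_of_nonneg (by positivity) ENNReal.ofReal_ne_top),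
      ENNReal.mul_rpow_of_nonneg _ _ (by positivity), ← ENNReal.rpow_mul, ← ENNReal.rpow_mul]
    congr 1
    · rw [mul_one_div_cancel (by positivity), ENNReal.rpow_one]
    · congr 1; field_simp

end Mom
section Upper

lemma holder_real {Ω : Type*} [MeasurableSpace Ω] (σ : Measure Ω) (r r' : ℝ≥0∞)
    (hrr : r⁻¹ + r'⁻¹ = 1) (ζ B : Ω → ℝ) (hζ : AEStronglyMeasurable ζ σ)
    (hB : AEStronglyMeasurable B σ) (hζ1 : eLpNorm ζ r' σ ≤ 1) :
    ENNReal.ofReal (∫ ω, ζ ω * B ω ∂σ) ≤ eLpNorm B r σ := by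
  haveI : ENNReal.HolderTriple r' r 1 := ⟨by rw [add_comm, hrr, inv_one]⟩
  have h1 := eLpNorm_smul_le_mul_eLpNorm (μ := σ) (p := r') (q := r) (r := 1) hB hζ
  calc ENNReal.ofReal (∫ ω, ζ ω * B ω ∂σ) ≤ ‖∫ ω, ζ ω * B ω ∂σ‖ₑ := by
        rw [← ofReal_norm]; exact ENNReal.ofReal_le_ofReal (le_abs_self _)
    _ ≤ ∫⁻ ω, ‖ζ ω * B ω‖ₑ ∂σ := enorm_integral_le_lintegral_enorm _
    _ = eLpNorm (ζ • B) 1 σ := by rw [eLpNorm_one_eq_lintegral_enorm]; rfl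
    _ ≤ _ := h1
    _ ≤ 1 * eLpNorm B r σ := by gcongr
    _ = _ := one_mul _

variable {Y : Type*} [MetricSpace Y] [CompleteSpace Y] [SecondCountableTopology Y]
    [LocallyCompactSpace Y] [MeasurableSpace Y] [BorelSpace Y]
variable {Ω : Type*} [MetricSpace Ω] [SecondCountableTopology Ω]
    [MeasurableSpace Ω] [BorelSpace Ω]

lemma upper_bound (σ : Measure Ω) [IsProbabilityMeasure σ] (y0 : Y) (p : ℝ)
    (κ η : Kernel Ω Y) [IsMarkovKernel κ] [IsMarkovKernel η] (lam : ℝ) (hp : 1 ≤ p)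
    (hκ : ∫⁻ ω, ∫⁻ y, edist y0 y ^ p ∂(κ ω) ∂σ ≠ ∞)
    (hη : ∫⁻ ω, ∫⁻ y, edist y0 y ^ p ∂(η ω) ∂σ ≠ ∞)
    (hlam : 0 < lam) (r r' : ℝ≥0∞) (hrr : r⁻¹ + r'⁻¹ = 1) (f : Ω × Y → ℝ) :
    -(((∫ u, f u ∂(σ.compProd η) : ℝ)) : EReal) - Hfun p r' σ y0 lam κ f ≤
      ((eLpNorm (fun ω => ENNReal.ofReal lam * MK p (κ ω) (η ω) ^ p) r σ : ℝ≥0∞) : EReal) := by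
  set R := eLpNorm (fun ω => ENNReal.ofReal lam * MK p (κ ω) (η ω) ^ p) r σ with hR
  by_cases hRt : R = ∞
  · rw [hRt]; exact le_top
  lift R to NNReal using hRt with R'
  have key : ((-(∫ u, f u ∂(σ.compProd η)) - R' : ℝ) : EReal) ≤ Hfun p r' σ y0 lam κ f := by
    refine le_sInf ?_
    rintro v ⟨ζ, ξ, ⟨hζc, hζb, hζ0, hζ1⟩, hξ, hf, rfl⟩
    obtain ⟨C, hC⟩ := gr_of_memXp (lam := lam) hp hlam y0 hξ
    obtain ⟨v, hv, hv'⟩ := value_eq σ y0 p κ η lam hp hκ hη hC ζ hζc hζb f hf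
    rw [hv]
    rw [EReal.coe_le_coe_iff]
    have hBi := integrable_Bf σ y0 p κ η lam hp hκ hη hC
    obtain ⟨D, hD⟩ := hζb
    have h1 : ∫ ω, ζ ω * Bf lam p κ η ξ ω ∂σ ≤ ∫ ω, ζ ω * max (Bf lam p κ η ξ ω) 0 ∂σ := by
      refine integral_mono (hBi.bdd_mul hζc.aestronglyMeasurable (ae_of_all _ hD))
        (hBi.pos_part.bdd_mul hζc.aestronglyMeasurable (ae_of_all _ hD)) fun ω => ?_
      exact mul_le_mul_of_nonneg_left (le_max_left _ _) (hζ0 ω).le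
    have h2 := holder_real σ r r' hrr ζ (fun ω => max (Bf lam p κ η ξ ω) 0)
      hζc.aestronglyMeasurable hBi.pos_part.aestronglyMeasurable hζ1
    have h3 : eLpNorm (fun ω => max (Bf lam p κ η ξ ω) 0) r σ ≤ R' := by
      rw [hR]
      refine eLpNorm_mono_enorm_ae ?_
      filter_upwards [Bf_le_MK σ y0 p κ η lam hp hκ hη hlam hC] with ω hω
      rw [enorm_eq_self, Real.enorm_of_nonneg (le_max_right _ _), ENNReal.ofReal_max]
      simpa using hω
    have h4 := h2.trans h3
    rw [← ENNReal.ofReal_coe_nnreal] at h4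
    have h5 := (ENNReal.ofReal_le_ofReal_iff (NNReal.coe_nonneg R')).1 h4
    linarith
  generalize Hfun p r' σ y0 lam κ f = H at key
  induction H with
  | bot => exact absurd key (EReal.bot_lt_coe _).not_ge
  | top => simp
  | coe x =>
    rw [EReal.coe_le_coe_iff] at key
    have e : ((R' : ℝ≥0∞) : EReal) = ((R' : ℝ) : EReal) := rfl
    rw [e, ← EReal.coe_neg, ← EReal.coe_sub, EReal.coe_le_coe_iff]
    linarith

end Upper
section Lower

variable {Y : Type*} [MetricSpace Y] [CompleteSpace Y] [SecondCountableTopology Y]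
    [LocallyCompactSpace Y] [MeasurableSpace Y] [BorelSpace Y]

lemma abs_TT_le (lam p : ℝ) (hp : 1 ≤ p) (hlam : 0 < lam) (φ : Y → ℝ) (C : ℝ)
    (hC : ∀ y, |φ y| ≤ C) (y : Y) : |TT lam p φ y| ≤ C := by
  haveI : Nonempty Y := ⟨y⟩
  have hb : ∀ y', -(lam * dist y y' ^ p) - φ y' ≤ C := fun y' => by
    have := (abs_le.1 (hC y')).1
    have : 0 ≤ lam * dist y y' ^ p := by positivity
    linarith
  rw [abs_le]
  constructor
  · refine le_trans ?_ (le_ciSup (f := fun y' => -(lam * dist y y' ^ p) - φ y')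
      ⟨C, by rintro _ ⟨y', rfl⟩; exact hb y'⟩ y)
    simp only [dist_self]
    rw [Real.zero_rpow (by linarith)]
    have := (abs_le.1 (hC y)).2
    linarith
  · exact ciSup_le hb

lemma TT_mono (lam p : ℝ) (hlam : 0 < lam) (φ ψ : Y → ℝ) (C ε : ℝ)
    (hC : ∀ y, |ψ y| ≤ C) (h : ∀ y, ψ y ≤ φ y + ε) (y : Y) :
    TT lam p φ y ≤ TT lam p ψ y + ε := by
  haveI : Nonempty Y := ⟨y⟩
  refine ciSup_le fun y' => ?_
  have hb : ∀ y', -(lam * dist y y' ^ p) - ψ y' ≤ C := fun y' => by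
    have := (abs_le.1 (hC y')).1
    have : 0 ≤ lam * dist y y' ^ p := by positivity
    linarith
  have := le_ciSup (f := fun y' => -(lam * dist y y' ^ p) - ψ y')
      ⟨C, by rintro _ ⟨y', rfl⟩; exact hb y'⟩ y'
  have h' := h y'
  simp only [TT] at this ⊢
  linarith

lemma measurable_TT (lam p : ℝ) (hp : 1 ≤ p) (hlam : 0 < lam) (φ : Y → ℝ) (hφ : Continuous φ)
    (C : ℝ) (hC : ∀ y, |φ y| ≤ C) : Measurable (TT lam p φ) := by
  refine LowerSemicontinuous.measurable (lowerSemicontinuous_ciSup ?_ fun y' => ?_)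
  · intro y
    refine ⟨C, ?_⟩
    rintro _ ⟨y', rfl⟩
    have := (abs_le.1 (hC y')).1
    have : 0 ≤ lam * dist y y' ^ p := by positivity
    simp only
    linarith
  · refine Continuous.lowerSemicontinuous ?_
    refine (Continuous.neg ?_).sub continuous_const
    exact (continuous_cost lam p hp).comp (continuous_id.prodMk continuous_const)

lemma cc_bound (φ : C_c(Y, ℝ)) : ∃ C, ∀ y, |φ y| ≤ C := by
  obtain ⟨C, hC⟩ := φ.hasCompactSupport.exists_bound_of_continuous φ.continuous
  exact ⟨C, hC⟩

lemma integrable_of_abs_le {α : Type*} [MeasurableSpace α] (μ : Measure α) [IsFiniteMeasure μ]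
    (f : α → ℝ) (hf : Measurable f) (C : ℝ) (hC : ∀ y, |f y| ≤ C) : Integrable f μ :=
  Integrable.mono' (integrable_const C) hf.aestronglyMeasurable (ae_of_all _ hC)

lemma MK_le_iSup (lam p : ℝ) (hp : 1 ≤ p) (hlam : 0 < lam) (μ ν : Measure Y)
    [IsProbabilityMeasure μ] [IsProbabilityMeasure ν] (φ : ℕ → C_c(Y, ℝ))
    (hφ : ∀ (ψ : C_c(Y, ℝ)) (ε : ℝ), 0 < ε → ∃ k, ∀ y, |φ k y - ψ y| ≤ ε) :
    ENNReal.ofReal lam * MK p μ ν ^ p ≤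
      ⨆ k, ENNReal.ofReal (-∫ y, φ k y ∂ν - ∫ y, TT lam p (φ k) y ∂μ) := by
  set S := ⨆ k, ENNReal.ofReal (-∫ y, φ k y ∂ν - ∫ y, TT lam p (φ k) y ∂μ) with hS
  by_cases hSt : S = ∞
  · rw [hSt]; exact le_top
  have hle : ∀ k, -∫ y, φ k y ∂ν - ∫ y, TT lam p (φ k) y ∂μ ≤ S.toReal := fun k => by
    have h := le_iSup (fun k => ENNReal.ofReal (-∫ y, φ k y ∂ν - ∫ y, TT lam p (φ k) y ∂μ)) k
    rw [← hS] at h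
    exact (ENNReal.ofReal_le_iff_le_toReal hSt).1 h
  obtain ⟨γ, hγ, hγ'⟩ := kantorovich lam p hp hlam μ ν S.toReal (fun ψ => by
    refine le_of_forall_pos_le_add fun ε hε => ?_
    obtain ⟨k, hk⟩ := hφ ψ (ε / 2) (by linarith)
    obtain ⟨C, hC⟩ := cc_bound ψ
    obtain ⟨D, hD⟩ := cc_bound (φ k)
    have i1 := integrable_of_abs_le ν ψ ψ.continuous.measurable C hC
    have i2 := integrable_of_abs_le ν (φ k) (φ k).continuous.measurable D hD
    have i3 := integrable_of_abs_le μ _ (measurable_TT lam p hp hlam ψ ψ.continuous C hC) C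
      (abs_TT_le lam p hp hlam ψ C hC)
    have i4 := integrable_of_abs_le μ _ (measurable_TT lam p hp hlam (φ k) (φ k).continuous D hD) D
      (abs_TT_le lam p hp hlam (φ k) D hD)
    have h1 : ∫ y, φ k y ∂ν ≤ ∫ y, (ψ y + ε / 2) ∂ν :=
      integral_mono i2 (i1.add (integrable_const _)) fun y => by
        have := (abs_le.1 (hk y)).2
        simp only
        linarith
    have h2 : ∫ y, TT lam p (φ k) y ∂μ ≤ ∫ y, (TT lam p ψ y + ε / 2) ∂μ :=
      integral_mono i4 (i3.add (integrable_const _)) fun y =>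
        TT_mono lam p hlam (φ k) ψ C (ε / 2) hC (fun y => by
          have := (abs_le.1 (hk y)).1
          linarith) y
    rw [integral_add i1 (integrable_const _)] at h1
    rw [integral_add i3 (integrable_const _)] at h2
    simp only [integral_const, probReal_univ, one_smul] at h1 h2
    have := hle k
    linarith)
  rw [lintegral_ofReal_cost lam p hp hlam, ENNReal.ofReal_toReal hSt] at hγ'
  refine le_trans ?_ hγ'
  gcongr
  exact MK_rpow_le p hp μ ν γ hγ

end Lower
section Glue

variable {Y : Type*} [MetricSpace Y] [CompleteSpace Y] [SecondCountableTopology Y]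
    [LocallyCompactSpace Y] [MeasurableSpace Y] [BorelSpace Y]
variable {Ω : Type*} [MetricSpace Ω] [SecondCountableTopology Ω]
    [MeasurableSpace Ω] [BorelSpace Ω]

lemma memXp_of_compact (p : ℝ) (y0 : Y) {ξ : Ω × Y → ℝ} (hc : Continuous ξ)
    (hs : HasCompactSupport ξ) : MemXp p y0 ξ := by
  refine ⟨hc, ?_⟩
  have : HasCompactSupport (fun u : Ω × Y => ξ u / (1 + dist y0 u.2 ^ p)) := by
    refine hs.mono ?_
    intro u hu h
    apply hu
    simp only [h, zero_div]
  exact this.is_zero_at_infty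

lemma bound_of_compact {ξ : Ω × Y → ℝ} (hc : Continuous ξ)
    (hs : HasCompactSupport ξ) : ∃ C, ∀ u, |ξ u| ≤ C := by
  obtain ⟨C, hC⟩ := hs.exists_bound_of_continuous hc
  exact ⟨C, hC⟩

variable (σ : Measure Ω) [IsProbabilityMeasure σ] (y0 : Y) (p : ℝ)
    (κ η : Kernel Ω Y) [IsMarkovKernel κ] [IsMarkovKernel η] (lam : ℝ)

lemma abs_Bf_le (hp : 1 ≤ p) (hlam : 0 < lam) {ξ : Ω × Y → ℝ} {C : ℝ} (hC : ∀ u, |ξ u| ≤ C)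
    (ω : Ω) : |Bf lam p κ η ξ ω| ≤ 2 * C := by
  have h1 : ‖∫ y, ξ (ω, y) ∂(η ω)‖ ≤ C := by
    have := norm_integral_le_of_norm_le_const (μ := η ω) (C := C)
      (f := fun y => ξ (ω, y)) (ae_of_all _ fun y => hC (ω, y))
    simpa using this
  have h2 : ‖∫ y, T2 lam p ξ (ω, y) ∂(κ ω)‖ ≤ C := by
    have := norm_integral_le_of_norm_le_const (μ := κ ω) (C := C)
      (f := fun y => T2 lam p ξ (ω, y))
      (ae_of_all _ fun y => abs_TT_le lam p hp hlam (fun y' => ξ (ω, y')) C (fun y => hC (ω, y)) y)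
    simpa using this
  rw [Real.norm_eq_abs, abs_le] at h1 h2
  rw [Bf, abs_le]
  constructor <;> linarith

lemma Bf_concave (hp : 1 ≤ p) (hlam : 0 < lam) {ξ ξ' : Ω × Y → ℝ} {C : ℝ}
    (hc : Continuous ξ) (hc' : Continuous ξ')
    (hC : ∀ u, |ξ u| ≤ C) (hC' : ∀ u, |ξ' u| ≤ C) (θ : Ω → ℝ) (hθ : Continuous θ)
    (h0 : ∀ ω, 0 ≤ θ ω) (h1 : ∀ ω, θ ω ≤ 1) (ω : Ω) :
    (1 - θ ω) * Bf lam p κ η ξ ω + θ ω * Bf lam p κ η ξ' ω ≤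
      Bf lam p κ η (fun u => (1 - θ u.1) * ξ u + θ u.1 * ξ' u) ω := by
  have hcω : Continuous (fun y => ξ (ω, y)) := hc.comp (continuous_const.prodMk continuous_id)
  have hcω' : Continuous (fun y => ξ' (ω, y)) := hc'.comp (continuous_const.prodMk continuous_id)
  set t := θ ω with ht
  have ht0 : 0 ≤ t := h0 ω
  have ht1 : t ≤ 1 := h1 ω
  have hcm : Continuous (fun y => (1 - t) * ξ (ω, y) + t * ξ' (ω, y)) := by fun_prop
  have hCm : ∀ y, |(1 - t) * ξ (ω, y) + t * ξ' (ω, y)| ≤ C := fun y => by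
    have a := abs_le.1 (hC (ω, y))
    have b := abs_le.1 (hC' (ω, y))
    rw [abs_le]
    constructor <;> nlinarith
  have i1 := integrable_of_abs_le (η ω) _ hcω.measurable C (fun y => hC (ω, y))
  have i2 := integrable_of_abs_le (η ω) _ hcω'.measurable C (fun y => hC' (ω, y))
  have j1 := integrable_of_abs_le (κ ω) _ (measurable_TT lam p hp hlam _ hcω C fun y => hC (ω, y)) C
    (abs_TT_le lam p hp hlam _ C fun y => hC (ω, y))
  have j2 := integrable_of_abs_le (κ ω) _
    (measurable_TT lam p hp hlam _ hcω' C fun y => hC' (ω, y)) C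
    (abs_TT_le lam p hp hlam _ C fun y => hC' (ω, y))
  have j3 := integrable_of_abs_le (κ ω) _
    (measurable_TT lam p hp hlam _ hcm C hCm) C (abs_TT_le lam p hp hlam _ C hCm)
  have hb : ∀ (φ : Y → ℝ), (∀ y, |φ y| ≤ C) → ∀ y y', -(lam * dist y y' ^ p) - φ y' ≤
      TT lam p φ y := fun φ hφ y y' => by
    refine le_ciSup (f := fun y' => -(lam * dist y y' ^ p) - φ y') ⟨C, ?_⟩ y'
    rintro _ ⟨y', rfl⟩
    have := (abs_le.1 (hφ y')).1
    have : 0 ≤ lam * dist y y' ^ p := by positivity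
    simp only
    linarith
  have hT : ∫ y, TT lam p (fun y => (1 - t) * ξ (ω, y) + t * ξ' (ω, y)) y ∂(κ ω) ≤
      ∫ y, ((1 - t) * TT lam p (fun y' => ξ (ω, y')) y +
        t * TT lam p (fun y' => ξ' (ω, y')) y) ∂(κ ω) := by
    refine integral_mono j3 ((j1.const_mul _).add (j2.const_mul _)) fun y => ?_
    haveI : Nonempty Y := ⟨y⟩
    refine ciSup_le fun y' => ?_
    have a := hb _ (fun y => hC (ω, y)) y y'
    have b := hb _ (fun y => hC' (ω, y)) y y'
    have a' := mul_le_mul_of_nonneg_left a (sub_nonneg.2 ht1)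
    have b' := mul_le_mul_of_nonneg_left b ht0
    simp only at a' b' ⊢
    linarith
  rw [integral_add (j1.const_mul _) (j2.const_mul _), integral_const_mul, integral_const_mul] at hT
  have hI : ∫ y, ((1 - t) * ξ (ω, y) + t * ξ' (ω, y)) ∂(η ω) =
      (1 - t) * ∫ y, ξ (ω, y) ∂(η ω) + t * ∫ y, ξ' (ω, y) ∂(η ω) := by
    rw [integral_add (i1.const_mul _) (i2.const_mul _), integral_const_mul, integral_const_mul]
  simp only [Bf, T2]
  rw [← ht, hI]
  linarith

lemma lower_value (hp : 1 ≤ p) (hlam : 0 < lam)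
    (hκ : ∫⁻ ω, ∫⁻ y, edist y0 y ^ p ∂(κ ω) ∂σ ≠ ∞)
    (hη : ∫⁻ ω, ∫⁻ y, edist y0 y ^ p ∂(η ω) ∂σ ≠ ∞) (r' : ℝ≥0∞)
    {ξ : Ω × Y → ℝ} (hc : Continuous ξ) (hs : HasCompactSupport ξ) (ζ : Ω → ℝ)
    (hζ : MemZ r' σ ζ) :
    ((∫ ω, ζ ω * Bf lam p κ η ξ ω ∂σ : ℝ) : EReal) ≤
    sSup {v : EReal | ∃ f : Ω × Y → ℝ, MemXp p y0 f ∧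
        v = -(((∫ u, f u ∂(σ.compProd η) : ℝ)) : EReal) - Hfun p r' σ y0 lam κ f} := by
  obtain ⟨C, hC⟩ := bound_of_compact hc hs
  have hG := gr_of_bounded (p := p) hlam y0 hc hC
  obtain ⟨v, hv, hv'⟩ := value_eq σ y0 p κ η lam hp hκ hη hG ζ hζ.1 hζ.2.1
    (fun u => ζ u.1 * ξ u) (fun u => rfl)
  refine le_trans ?_ (le_sSup ⟨fun u => ζ u.1 * ξ u, memXp_of_compact p y0
    ((hζ.1.comp continuous_fst).mul hc) (hs.mul_left), rfl⟩)
  have hH : Hfun p r' σ y0 lam κ (fun u => ζ u.1 * ξ u) ≤ (v : EReal) :=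
    sInf_le ⟨ζ, ξ, hζ, memXp_of_compact p y0 hc hs, fun u => rfl, hv.symm⟩
  rw [← hv', EReal.coe_sub, EReal.coe_neg]
  exact EReal.sub_le_sub le_rfl hH

/-- The running maximum of the fiberwise dual values. -/
noncomputable def FF (φ : ℕ → C_c(Y, ℝ)) : ℕ → Ω → ℝ
  | 0 => fun _ => 0
  | (K + 1) => fun ω => max (FF φ K ω) (Bf lam p κ η (fun u => φ K u.2) ω)

lemma FF_nonneg (φ : ℕ → C_c(Y, ℝ)) (K : ℕ) (ω : Ω) : 0 ≤ FF p κ η lam φ K ω := by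
  induction K with
  | zero => exact le_rfl
  | succ K ih => exact ih.trans (le_max_left _ _)

lemma FF_measurable (hp : 1 ≤ p) (hlam : 0 < lam) (y0 : Y) (φ : ℕ → C_c(Y, ℝ)) (K : ℕ) :
    Measurable (FF p κ η lam φ K) := by
  induction K with
  | zero => exact measurable_const
  | succ K ih =>
    obtain ⟨C, hC⟩ := cc_bound (φ K)
    refine ih.max (measurable_Bf y0 p κ η lam hp (C := C) ?_)
    exact gr_of_bounded hlam y0 ((φ K).continuous.comp continuous_snd) fun u => hC u.2

lemma FF_bound (hp : 1 ≤ p) (hlam : 0 < lam) (φ : ℕ → C_c(Y, ℝ)) (K : ℕ) :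
    ∃ M, ∀ ω, FF p κ η lam φ K ω ≤ M := by
  induction K with
  | zero => exact ⟨0, fun _ => le_rfl⟩
  | succ K ih =>
    obtain ⟨M, hM⟩ := ih
    obtain ⟨C, hC⟩ := cc_bound (φ K)
    refine ⟨max M (2 * C), fun ω => max_le_max (hM ω) ?_⟩
    exact (abs_le.1 (abs_Bf_le p κ η lam hp hlam (fun u => hC u.2) ω)).2

lemma exists_theta [LocallyCompactSpace Ω] (A : Set Ω) (hA : MeasurableSet A) (δ : ℝ)
    (hδ : 0 < δ) : ∃ θ : Ω → ℝ, Continuous θ ∧ HasCompactSupport θ ∧ (∀ ω, 0 ≤ θ ω) ∧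
      (∀ ω, θ ω ≤ 1) ∧ ∫ ω, |A.indicator (fun _ => (1 : ℝ)) ω - θ ω| ∂σ ≤ δ := by
  have hi : Integrable (A.indicator (fun _ => (1 : ℝ))) σ := (integrable_const 1).indicator hA
  obtain ⟨g, hgs, hg, hgc, hgi⟩ := hi.exists_hasCompactSupport_integral_sub_le hδ
  have hc : Continuous (fun ω => max 0 (min (g ω) 1)) := by fun_prop
  have hb : ∀ ω, |max 0 (min (g ω) 1)| ≤ 1 := fun ω => by
    rw [abs_le]
    exact ⟨by linarith [le_max_left 0 (min (g ω) 1)], max_le zero_le_one (min_le_right _ _)⟩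
  refine ⟨fun ω => max 0 (min (g ω) 1), hc,
    hgs.comp_left (g := fun x => max 0 (min x 1)) (by simp), fun ω => le_max_left _ _,
    fun ω => max_le zero_le_one (min_le_right _ _), le_trans ?_ hg⟩
  refine integral_mono (hi.sub (integrable_of_abs_le σ _ hc.measurable 1 hb)).abs
    (hi.sub hgi).norm fun ω => ?_
  have key : ∀ a x : ℝ, (a = 0 ∨ a = 1) → |a - max 0 (min x 1)| ≤ |a - x| := by
    intro a x ha
    rcases ha with rfl | rfl
    · rw [zero_sub, zero_sub, abs_neg, abs_neg, abs_of_nonneg (le_max_left _ _)]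
      exact max_le (abs_nonneg _) ((min_le_left _ _).trans (le_abs_self _))
    · rw [abs_of_nonneg (sub_nonneg.2 (max_le zero_le_one (min_le_right _ _)))]
      rcases le_total x 1 with h | h
      · rw [min_eq_left h]
        refine le_trans ?_ (le_abs_self _)
        linarith [le_max_right 0 x]
      · rw [min_eq_right h, max_eq_right zero_le_one, sub_self]
        exact abs_nonneg _
  refine key _ _ ?_
  by_cases h : ω ∈ A
  · right; simp [h]
  · left; simp [h]

lemma FF_approx [LocallyCompactSpace Ω] (hp : 1 ≤ p) (hlam : 0 < lam) (y0 : Y)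
    (φ : ℕ → C_c(Y, ℝ)) (K : ℕ) :
    ∀ ε : ℝ, 0 < ε → ∃ ξ : Ω × Y → ℝ, Continuous ξ ∧ HasCompactSupport ξ ∧
      ∫ ω, max (FF p κ η lam φ K ω - Bf lam p κ η ξ ω) 0 ∂σ ≤ ε := by
  induction K with
  | zero =>
    intro ε hε
    refine ⟨fun _ => 0, continuous_const, HasCompactSupport.zero, ?_⟩
    have h : ∀ ω, Bf lam p κ η (fun _ => 0) ω = 0 := fun ω => by
      have := abs_Bf_le p κ η lam hp hlam (ξ := fun _ => 0) (C := 0) (by simp) ω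
      simpa using this
    simp only [h, FF]
    simpa using hε.le
  | succ K ih =>
    intro ε hε
    obtain ⟨ξ, hc, hs, hξ⟩ := ih (ε / 2) (by linarith)
    obtain ⟨C1, hC1⟩ := bound_of_compact hc hs
    obtain ⟨C2, hC2⟩ := cc_bound (φ K)
    set C := max C1 C2
    have hC : ∀ u, |ξ u| ≤ C := fun u => (hC1 u).trans (le_max_left _ _)
    have hcφ : Continuous (fun u : Ω × Y => φ K u.2) := (φ K).continuous.comp continuous_snd
    have hC' : ∀ u : Ω × Y, |φ K u.2| ≤ C := fun u => (hC2 u.2).trans (le_max_right _ _)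
    have hC0 : 0 ≤ C := (abs_nonneg _).trans ((hC2 y0).trans (le_max_right _ _))
    have hB : ∀ ω, |Bf lam p κ η ξ ω| ≤ 2 * C := abs_Bf_le p κ η lam hp hlam hC
    have hBk : ∀ ω, |Bf lam p κ η (fun u => φ K u.2) ω| ≤ 2 * C := abs_Bf_le p κ η lam hp hlam hC'
    have mB := measurable_Bf y0 p κ η lam hp (gr_of_bounded (p := p) hlam y0 hc hC)
    have mBk := measurable_Bf y0 p κ η lam hp (gr_of_bounded (p := p) hlam y0 hcφ hC')
    have mF := FF_measurable p κ η lam hp hlam y0 φ K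
    obtain ⟨M, hM⟩ := FF_bound p κ η lam hp hlam φ K
    have hF0 := FF_nonneg p κ η lam φ K
    set A : Set Ω := {ω | FF p κ η lam φ K ω < Bf lam p κ η (fun u => φ K u.2) ω}
    have hA : MeasurableSet A := measurableSet_lt mF mBk
    obtain ⟨θ, hθc, hθs, hθ0, hθ1, hθ⟩ := exists_theta σ A hA (ε / (8 * (C + 1))) (by positivity)
    set ξ' : Ω × Y → ℝ := fun u => (1 - θ u.1) * ξ u + θ u.1 * φ K u.2 with hξ'
    have hc' : Continuous ξ' := by
      refine ((continuous_const.sub (hθc.comp continuous_fst)).mul hc).add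
        ((hθc.comp continuous_fst).mul hcφ)
    have hs' : HasCompactSupport ξ' := by
      refine HasCompactSupport.add hs.mul_left ?_
      refine HasCompactSupport.intro' (hθs.isCompact.prod (φ K).hasCompactSupport.isCompact)
        ((isClosed_tsupport _).prod (isClosed_tsupport _)) ?_
      intro u hu
      simp only [Set.mem_prod, not_and_or] at hu
      rcases hu with hu | hu
      · simp [image_eq_zero_of_notMem_tsupport hu]
      · simp [image_eq_zero_of_notMem_tsupport hu]
    obtain ⟨C3, hC3⟩ := bound_of_compact hc' hs'
    have mB' := measurable_Bf y0 p κ η lam hp (gr_of_bounded (p := p) hlam y0 hc' hC3)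
    have hB' := abs_Bf_le p κ η lam hp hlam hC3
    have hcon := Bf_concave p κ η lam hp hlam hc hcφ hC hC' θ hθc hθ0 hθ1
    refine ⟨ξ', hc', hs', ?_⟩
    have iF : Integrable (FF p κ η lam φ K) σ := integrable_of_abs_le σ _ mF M fun ω => by
      rw [abs_of_nonneg (hF0 ω)]; exact hM ω
    have iB : Integrable (Bf lam p κ η ξ) σ := integrable_of_abs_le σ _ mB _ hB
    have iB' : Integrable (Bf lam p κ η ξ') σ := integrable_of_abs_le σ _ mB' _ hB'
    have iBk : Integrable (Bf lam p κ η (fun u => φ K u.2)) σ := integrable_of_abs_le σ _ mBk _ hBk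
    have iA : Integrable (fun ω => |A.indicator (fun _ => (1 : ℝ)) ω - θ ω|) σ :=
      (((integrable_const 1).indicator hA).sub (integrable_of_abs_le σ _ hθc.measurable 1
        fun ω => by rw [abs_of_nonneg (hθ0 ω)]; exact hθ1 ω)).abs
    have i1 : Integrable (fun ω => FF p κ η lam φ (K + 1) ω - Bf lam p κ η ξ' ω) σ :=
      (iF.sup iBk).sub iB'
    have i2 : Integrable (fun ω => max (FF p κ η lam φ K ω - Bf lam p κ η ξ ω) 0) σ :=
      (iF.sub iB).pos_part
    have hle : ∫ ω, max (FF p κ η lam φ (K + 1) ω - Bf lam p κ η ξ' ω) 0 ∂σ ≤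
        ∫ ω, (4 * C * |A.indicator (fun _ => (1 : ℝ)) ω - θ ω| +
          max (FF p κ η lam φ K ω - Bf lam p κ η ξ ω) 0) ∂σ := by
      refine integral_mono i1.pos_part ((iA.const_mul _).add i2) fun ω => ?_
      have b1 := abs_le.1 (hB ω)
      have b2 := abs_le.1 (hBk ω)
      have hx := le_max_right (FF p κ η lam φ K ω - Bf lam p κ η ξ ω) 0
      have hx' := le_max_left (FF p κ η lam φ K ω - Bf lam p κ η ξ ω) 0
      have ha := abs_nonneg (A.indicator (fun _ => (1 : ℝ)) ω - θ ω)
      refine max_le ?_ (by positivity)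
      have hcω := hcon ω
      have t0 := hθ0 ω
      have t1 := hθ1 ω
      simp only [FF]
      by_cases hω : ω ∈ A
      · have hω' : FF p κ η lam φ K ω < Bf lam p κ η (fun u => φ K u.2) ω := hω
        rw [max_eq_right hω'.le, Set.indicator_of_mem hω, abs_of_nonneg (by linarith)]
        nlinarith
      · have hω' : Bf lam p κ η (fun u => φ K u.2) ω ≤ FF p κ η lam φ K ω := not_lt.1 hω
        rw [max_eq_left hω', Set.indicator_of_notMem hω, zero_sub, abs_neg, abs_of_nonneg t0]
        nlinarith
    rw [integral_add (iA.const_mul _) i2, integral_const_mul] at hle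
    refine hle.trans ?_
    have : 4 * C * ∫ ω, |A.indicator (fun _ => (1 : ℝ)) ω - θ ω| ∂σ ≤ ε / 2 := by
      refine (mul_le_mul_of_nonneg_left hθ (by positivity)).trans ?_
      rw [← mul_div_assoc, div_le_iff₀ (by positivity)]
      nlinarith
    linarith

end Glue
section Dual

variable {Ω : Type*} [MetricSpace Ω] [SecondCountableTopology Ω]
    [MeasurableSpace Ω] [BorelSpace Ω]

lemma memZ_one (σ : Measure Ω) [IsProbabilityMeasure σ] (r' : ℝ≥0∞) :
    MemZ r' σ (fun _ => (1 : ℝ)) := by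
  refine ⟨continuous_const, ⟨1, by simp⟩, fun _ => one_pos, ?_⟩
  by_cases h : r' = 0
  · rw [h, eLpNorm_exponent_zero]; exact zero_le_one
  · rw [eLpNorm_const _ h (IsProbabilityMeasure.ne_zero σ)]
    simp

lemma dual_ext (σ : Measure Ω) [IsProbabilityMeasure σ] (r' : ℝ≥0∞) (h1 : 1 ≤ r') (ht : r' ≠ ∞)
    (F : Ω → ℝ) (hF : Measurable F) (M : ℝ) (hF0 : ∀ ω, 0 ≤ F ω) (hFM : ∀ ω, F ω ≤ M) (s : ℝ)
    (h : ∀ ζ, MemZ r' σ ζ → ∫ ω, ζ ω * F ω ∂σ ≤ s) (g : Ω → ℝ) (hg : Measurable g) (C : ℝ)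
    (hgC : ∀ ω, |g ω| ≤ C) (hg1 : eLpNorm g r' σ ≤ 1) : ∫ ω, g ω * F ω ∂σ ≤ s := by
  have iF : Integrable F σ := integrable_of_abs_le σ F hF M fun ω => by
    rw [abs_of_nonneg (hF0 ω)]; exact hFM ω
  have hs0 : 0 ≤ s := by
    refine le_trans ?_ (h _ (memZ_one σ r'))
    exact integral_nonneg fun ω => by simpa using hF0 ω
  have hM0 : 0 ≤ M := by
    haveI : Nonempty Ω := nonempty_of_isProbabilityMeasure σ
    obtain ⟨ω⟩ := this
    exact (hF0 ω).trans (hFM ω)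
  have key : ∀ ε : ℝ, 0 < ε → ∫ ω, g ω * F ω ∂σ ≤ s + ε * (2 * s + M) := by
    intro ε hε
    have hgL : MemLp g r' σ := MemLp.of_bound hg.aestronglyMeasurable C (ae_of_all _ hgC)
    obtain ⟨k, hkc, B, hkb, hk, hkL⟩ : ∃ k : Ω → ℝ, Continuous k ∧ ∃ B, (∀ ω, |k ω| ≤ B) ∧
        eLpNorm (g - k) r' σ ≤ ENNReal.ofReal ε ∧ MemLp k r' σ := by
      obtain ⟨k, hk, hkL⟩ := hgL.exists_boundedContinuous_eLpNorm_sub_le ht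
        (ε := ENNReal.ofReal ε) (by simpa using hε)
      exact ⟨k, k.continuous, ‖k‖, fun ω => k.norm_coe_le_norm ω, hk, hkL⟩
    have hkn : eLpNorm k r' σ ≤ 1 + ENNReal.ofReal ε := by
      have e : k = g - (g - k) := by simp
      rw [e]
      exact (eLpNorm_sub_le hgL.1 (hgL.1.sub hkL.1) h1).trans (add_le_add hg1 hk)
    have hc : Continuous (fun ω => (1 + 2 * ε)⁻¹ * (|k ω| + ε)) := by fun_prop
    have hp1 : 0 < 1 + 2 * ε := by linarith
    have hZ : MemZ r' σ (fun ω => (1 + 2 * ε)⁻¹ * (|k ω| + ε)) := by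
      refine ⟨hc, ⟨(1 + 2 * ε)⁻¹ * (B + ε), fun ω => ?_⟩, fun ω => by positivity, ?_⟩
      · rw [abs_of_nonneg (by positivity)]
        have := hkb ω
        exact mul_le_mul_of_nonneg_left (by linarith) (by positivity)
      · have e : (fun ω => (1 + 2 * ε)⁻¹ * (|k ω| + ε)) =
            (1 + 2 * ε)⁻¹ • ((fun ω => ‖k ω‖) + fun _ => ε) := by
          ext ω; simp [Real.norm_eq_abs]
        rw [e, eLpNorm_const_smul]
        have h2 : eLpNorm ((fun ω => ‖k ω‖) + fun _ => ε) r' σ ≤ ENNReal.ofReal (1 + 2 * ε) := by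
          refine (eLpNorm_add_le hkL.1.norm aestronglyMeasurable_const h1).trans ?_
          rw [eLpNorm_norm, eLpNorm_const _ (by positivity) (IsProbabilityMeasure.ne_zero σ)]
          rw [show 1 + 2 * ε = 1 + ε + ε by ring, ENNReal.ofReal_add (by positivity) hε.le,
            ENNReal.ofReal_add zero_le_one hε.le, ENNReal.ofReal_one]
          refine add_le_add hkn ?_
          rw [measure_univ, ENNReal.one_rpow, mul_one, Real.enorm_of_nonneg hε.le]
        rw [Real.enorm_of_nonneg (by positivity)]
        refine (mul_le_mul_right h2 _).trans ?_
        rw [← ENNReal.ofReal_mul (by positivity), inv_mul_cancel₀ hp1.ne', ENNReal.ofReal_one]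
    have hζ := h _ hZ
    have ik : Integrable (fun ω => |k ω| * F ω) σ :=
      iF.bdd_mul (c := B) hkc.abs.aestronglyMeasurable (ae_of_all _ fun ω => by simpa using hkb ω)
    have hk1 : ∫ ω, |k ω| * F ω ∂σ ≤ (1 + 2 * ε) * s := by
      have e : ∫ ω, ((1 + 2 * ε)⁻¹ * (|k ω| + ε)) * F ω ∂σ =
          (1 + 2 * ε)⁻¹ * (∫ ω, |k ω| * F ω ∂σ + ε * ∫ ω, F ω ∂σ) := by
        rw [← integral_const_mul ε, ← integral_add ik (iF.const_mul ε), ← integral_const_mul]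
        refine integral_congr_ae (ae_of_all _ fun ω => ?_)
        simp only; ring
      rw [e, inv_mul_le_iff₀ hp1] at hζ
      have : 0 ≤ ε * ∫ ω, F ω ∂σ := mul_nonneg hε.le (integral_nonneg hF0)
      linarith
    have hL1 : ∫ ω, |g ω - k ω| ∂σ ≤ ε := by
      have h2 : eLpNorm (g - k) 1 σ ≤ ENNReal.ofReal ε :=
        (eLpNorm_le_eLpNorm_of_exponent_le h1 (hgL.1.sub hkL.1)).trans hk
      rw [eLpNorm_one_eq_lintegral_enorm] at h2
      have h3 : ∫ ω, ‖(g - k) ω‖ ∂σ ≤ ε := by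
        rw [integral_norm_eq_lintegral_enorm (hgL.1.sub hkL.1)]
        exact ENNReal.toReal_le_of_le_ofReal hε.le h2
      exact h3
    have igk : Integrable (fun ω => |g ω - k ω|) σ :=
      ((hgL.sub hkL).integrable h1).abs
    have ig : Integrable (fun ω => g ω * F ω) σ :=
      iF.bdd_mul (c := C) hg.aestronglyMeasurable (ae_of_all _ hgC)
    have hfin : ∫ ω, g ω * F ω ∂σ ≤ ∫ ω, (|k ω| * F ω + M * |g ω - k ω|) ∂σ := by
      refine integral_mono ig (ik.add (igk.const_mul M)) fun ω => ?_
      have a := hF0 ω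
      have b := hFM ω
      have c := le_abs_self (k ω)
      have d := le_abs_self (g ω - k ω)
      have e := abs_nonneg (g ω - k ω)
      have f1 : g ω * F ω ≤ (|k ω| + |g ω - k ω|) * F ω :=
        mul_le_mul_of_nonneg_right (by linarith) a
      have f2 : |g ω - k ω| * F ω ≤ |g ω - k ω| * M := mul_le_mul_of_nonneg_left b e
      simp only
      linarith
    rw [integral_add ik (igk.const_mul M), integral_const_mul] at hfin
    have := mul_le_mul_of_nonneg_left hL1 hM0
    linarith
  refine le_of_forall_pos_le_add fun δ hδ => ?_
  have hpos : 0 < 2 * s + M + 1 := by linarith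
  refine (key (δ / (2 * s + M + 1)) (by positivity)).trans ?_
  have : δ / (2 * s + M + 1) * (2 * s + M) ≤ δ := by
    rw [div_mul_eq_mul_div, div_le_iff₀ hpos]
    nlinarith
  linarith

lemma dual_norm (σ : Measure Ω) [IsProbabilityMeasure σ] (r r' : ℝ≥0∞) (hrr : r⁻¹ + r'⁻¹ = 1)
    (F : Ω → ℝ) (hF : Measurable F) (M : ℝ) (hF0 : ∀ ω, 0 ≤ F ω) (hFM : ∀ ω, F ω ≤ M) (s : ℝ)
    (h : ∀ ζ, MemZ r' σ ζ → ∫ ω, ζ ω * F ω ∂σ ≤ s) : eLpNorm F r σ ≤ ENNReal.ofReal s := by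
  have iF : Integrable F σ := integrable_of_abs_le σ F hF M fun ω => by
    rw [abs_of_nonneg (hF0 ω)]; exact hFM ω
  have hs0 : 0 ≤ s := by
    refine le_trans ?_ (h _ (memZ_one σ r'))
    exact integral_nonneg fun ω => by simpa using hF0 ω
  have hM0 : 0 ≤ M := by
    haveI : Nonempty Ω := nonempty_of_isProbabilityMeasure σ
    obtain ⟨ω⟩ := this
    exact (hF0 ω).trans (hFM ω)
  by_cases ht : r' = ∞
  · have hr1 : r = 1 := by
      rw [ht] at hrr; simpa using hrr
    rw [hr1, eLpNorm_one_eq_lintegral_enorm]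
    have e : ∀ ω, ‖F ω‖ₑ = ENNReal.ofReal (F ω) := fun ω => Real.enorm_of_nonneg (hF0 ω)
    simp only [e]
    rw [← ofReal_integral_eq_lintegral_ofReal iF (ae_of_all _ hF0)]
    refine ENNReal.ofReal_le_ofReal ?_
    simpa using h _ (memZ_one σ r')
  have h1 : 1 ≤ r' := by
    rw [← ENNReal.inv_le_one, ← hrr]; exact le_add_self
  have hext := dual_ext σ r' h1 ht F hF M hF0 hFM s h
  by_cases hrt : r = ∞
  · have hr1 : r' = 1 := by
      rw [hrt] at hrr; simpa using hrr
    rw [hrt, eLpNorm_exponent_top]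
    have hae : F ≤ᵐ[σ] fun _ => s := by
      refine ae_le_of_forall_setIntegral_le iF (integrable_const s) fun A hA _ => ?_
      rw [setIntegral_const, smul_eq_mul]
      by_cases hA0 : σ A = 0
      · rw [Measure.restrict_eq_zero.2 hA0, integral_zero_measure]
        positivity
      have hpos : 0 < σ.real A := by
        rw [Measure.real]
        exact ENNReal.toReal_pos hA0 (measure_ne_top _ _)
      have := hext (A.indicator fun _ => (σ.real A)⁻¹) (measurable_const.indicator hA)
        (σ.real A)⁻¹ (fun ω => by
          by_cases hω : ω ∈ A
          · rw [Set.indicator_of_mem hω, abs_of_nonneg (by positivity)]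
          · rw [Set.indicator_of_notMem hω, abs_zero]; positivity) (by
          rw [hr1, eLpNorm_indicator_const hA one_ne_zero ENNReal.one_ne_top,
            Real.enorm_of_nonneg (by positivity), ENNReal.toReal_one, div_one, ENNReal.rpow_one,
            ENNReal.ofReal_inv_of_pos hpos, Measure.real, ENNReal.ofReal_toReal (measure_ne_top _ _),
            ENNReal.inv_mul_cancel hA0 (measure_ne_top _ _)])
      have e : ∀ ω, A.indicator (fun _ => (σ.real A)⁻¹) ω * F ω =
          A.indicator (fun ω => (σ.real A)⁻¹ * F ω) ω := fun ω => by
        by_cases hω : ω ∈ A <;> simp [hω]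
      simp only [e] at this
      rw [integral_indicator hA, integral_const_mul, inv_mul_le_iff₀ hpos] at this
      exact this
    refine eLpNormEssSup_le_of_ae_bound ?_
    filter_upwards [hae] with ω hω
    rwa [Real.norm_of_nonneg (hF0 ω)]
  · have hr0 : r ≠ 0 := by
      rintro rfl; simp at hrr
    have hr'0 : r' ≠ 0 := (zero_lt_one.trans_le h1).ne'
    set a := r.toReal with ha
    set b := r'.toReal with hb
    have ha0 : 0 < a := ENNReal.toReal_pos hr0 hrt
    have hb0 : 0 < b := ENNReal.toReal_pos hr'0 ht
    have hab : a⁻¹ + b⁻¹ = 1 := by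
      have := congrArg ENNReal.toReal hrr
      rwa [ENNReal.toReal_add (ENNReal.inv_ne_top.2 hr0) (ENNReal.inv_ne_top.2 hr'0),
        ENNReal.toReal_inv, ENNReal.toReal_inv, ENNReal.toReal_one] at this
    have hba : (a - 1) * b = a := by
      field_simp at hab
      linarith
    have ha1 : 0 ≤ a - 1 := by
      by_contra hneg
      push Not at hneg
      nlinarith
    have hFL : MemLp F r σ := MemLp.of_bound hF.aestronglyMeasurable M (ae_of_all _ fun ω => by
      rw [Real.norm_of_nonneg (hF0 ω)]; exact hFM ω)
    rw [hFL.eLpNorm_eq_integral_rpow_norm hr0 hrt]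
    refine ENNReal.ofReal_le_ofReal ?_
    simp only [Real.norm_of_nonneg (hF0 _)]
    rw [← ha]
    set N := ∫ ω, F ω ^ a ∂σ with hN
    have hN0 : 0 ≤ N := integral_nonneg fun ω => Real.rpow_nonneg (hF0 ω) _
    rcases hN0.eq_or_lt with hNz | hNp
    · rw [← hNz, Real.zero_rpow (by positivity)]; exact hs0
    set c : ℝ := (N ^ b⁻¹)⁻¹ with hc
    have hcp : 0 < c := by positivity
    have hgm : Measurable (fun ω => c * F ω ^ (a - 1)) := (hF.pow_const _).const_mul _
    have hgb : ∀ ω, |c * F ω ^ (a - 1)| ≤ c * M ^ (a - 1) := fun ω => by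
      rw [abs_of_nonneg (mul_nonneg hcp.le (Real.rpow_nonneg (hF0 ω) _))]
      exact mul_le_mul_of_nonneg_left (Real.rpow_le_rpow (hF0 ω) (hFM ω) ha1) hcp.le
    have hfin := hext _ hgm _ hgb (by
      have hL : MemLp (fun ω => c * F ω ^ (a - 1)) r' σ :=
        MemLp.of_bound hgm.aestronglyMeasurable _ (ae_of_all _ hgb)
      rw [hL.eLpNorm_eq_integral_rpow_norm hr'0 ht, ← ENNReal.ofReal_one, ← hb]
      refine ENNReal.ofReal_le_ofReal (le_of_eq ?_)
      have e : ∀ ω, ‖c * F ω ^ (a - 1)‖ ^ b = c ^ b * F ω ^ a := fun ω => by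
        rw [Real.norm_of_nonneg (mul_nonneg hcp.le (Real.rpow_nonneg (hF0 ω) _)),
          Real.mul_rpow hcp.le (Real.rpow_nonneg (hF0 ω) _), ← Real.rpow_mul (hF0 ω), hba]
      simp only [e]
      rw [integral_const_mul, ← hN, hc, Real.inv_rpow (by positivity), ← Real.rpow_mul hN0,
        inv_mul_cancel₀ hb0.ne', Real.rpow_one, inv_mul_cancel₀ hNp.ne', Real.one_rpow])
    have e : ∀ ω, c * F ω ^ (a - 1) * F ω = c * F ω ^ a := fun ω => by
      rcases (hF0 ω).eq_or_lt with hz | hz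
      · rw [← hz, Real.zero_rpow ha0.ne']; ring
      · rw [mul_assoc]
        nth_rewrite 2 [← Real.rpow_one (F ω)]
        rw [← Real.rpow_add hz]; congr 2; ring
    simp only [e] at hfin
    rw [integral_const_mul, ← hN, hc] at hfin
    refine le_trans (le_of_eq ?_) hfin
    have e2 : a⁻¹ = -b⁻¹ + 1 := by linarith
    rw [e2, Real.rpow_add hNp, Real.rpow_one, Real.rpow_neg hN0]

lemma eLpNorm_iSup_le {α : Type*} [MeasurableSpace α] (σ : Measure α) (r : ℝ≥0∞) (hr : r ≠ 0)
    (f : ℕ → α → ℝ≥0∞) (hf : ∀ K, Measurable (f K)) (hm : Monotone f) (S : ℝ≥0∞)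
    (h : ∀ K, eLpNorm (f K) r σ ≤ S) : eLpNorm (fun x => ⨆ K, f K x) r σ ≤ S := by
  by_cases hrt : r = ∞
  · subst hrt
    simp only [eLpNorm_exponent_top, eLpNormEssSup_eq_essSup_enorm, enorm_eq_self] at h ⊢
    have : ∀ᵐ x ∂σ, ∀ K, f K x ≤ S := by
      rw [ae_all_iff]
      intro K
      filter_upwards [ENNReal.ae_le_essSup (f K)] with x hx
      exact hx.trans (h K)
    exact essSup_le_of_ae_le _ (this.mono fun x hx => iSup_le hx)
  · have ha0 : 0 < r.toReal := ENNReal.toReal_pos hr hrt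
    simp only [eLpNorm_eq_lintegral_rpow_enorm_toReal hr hrt, enorm_eq_self] at h ⊢
    have e : ∀ x, (⨆ K, f K x) ^ r.toReal = ⨆ K, f K x ^ r.toReal := fun x =>
      (ENNReal.orderIsoRpow r.toReal ha0).map_iSup (fun K => f K x)
    simp only [e]
    rw [lintegral_iSup (fun K => (hf K).pow_const _)
      (fun K L hKL x => ENNReal.rpow_le_rpow (hm hKL x) ha0.le)]
    rw [one_div, ENNReal.rpow_inv_le_iff ha0]
    refine iSup_le fun K => ?_
    have := h K
    rwa [one_div, ENNReal.rpow_inv_le_iff ha0] at this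

end Dual
section Final

variable {Y : Type*} [MetricSpace Y] [CompleteSpace Y] [SecondCountableTopology Y]
    [LocallyCompactSpace Y] [MeasurableSpace Y] [BorelSpace Y]
variable {Ω : Type*} [MetricSpace Ω] [SecondCountableTopology Ω] [LocallyCompactSpace Ω]
    [MeasurableSpace Ω] [BorelSpace Ω]

lemma lower_bound (σ : Measure Ω) [IsProbabilityMeasure σ] (y0 : Y) (p : ℝ)
    (κ η : Kernel Ω Y) [IsMarkovKernel κ] [IsMarkovKernel η] (lam : ℝ) (hp : 1 ≤ p)
    (hκ : ∫⁻ ω, ∫⁻ y, edist y0 y ^ p ∂(κ ω) ∂σ ≠ ∞)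
    (hη : ∫⁻ ω, ∫⁻ y, edist y0 y ^ p ∂(η ω) ∂σ ≠ ∞)
    (hlam : 0 < lam) (r r' : ℝ≥0∞) (hrr : r⁻¹ + r'⁻¹ = 1) :
    ((eLpNorm (fun ω => ENNReal.ofReal lam * MK p (κ ω) (η ω) ^ p) r σ : ℝ≥0∞) : EReal) ≤
    sSup {v : EReal | ∃ f : Ω × Y → ℝ, MemXp p y0 f ∧
        v = -(((∫ u, f u ∂(σ.compProd η) : ℝ)) : EReal) - Hfun p r' σ y0 lam κ f} := by
  have hlow := fun (ξ : Ω × Y → ℝ) hc hs (ζ : Ω → ℝ) hζ =>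
    lower_value (ξ := ξ) σ y0 p κ η lam hp hlam hκ hη r' hc hs ζ hζ
  generalize sSup {v : EReal | ∃ f : Ω × Y → ℝ, MemXp p y0 f ∧
        v = -(((∫ u, f u ∂(σ.compProd η) : ℝ)) : EReal) - Hfun p r' σ y0 lam κ f} = S at hlow ⊢
  induction S with
  | top => exact le_top
  | bot =>
    have := hlow (fun _ => 0) continuous_const HasCompactSupport.zero _ (memZ_one σ r')
    exact absurd this (EReal.bot_lt_coe _).not_ge
  | coe s =>
    simp only [EReal.coe_le_coe_iff] at hlow
    have hs0 : 0 ≤ s := by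
      have := hlow (fun _ => 0) continuous_const HasCompactSupport.zero _ (memZ_one σ r')
      have h0 : ∀ ω, Bf lam p κ η (fun _ => 0) ω = 0 := fun ω => by
        have := abs_Bf_le p κ η lam hp hlam (ξ := fun _ => 0) (C := 0) (by simp) ω
        simpa using this
      simpa [h0] using this
    obtain ⟨φ, hφ⟩ := exists_dense_cc (Y := Y)
    have hpair : ∀ K ζ, MemZ r' σ ζ → ∫ ω, ζ ω * FF p κ η lam φ K ω ∂σ ≤ s := by
      intro K ζ hζ
      obtain ⟨D, hD⟩ := hζ.2.1
      have hD0 : 0 ≤ D := by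
        haveI : Nonempty Ω := nonempty_of_isProbabilityMeasure σ
        obtain ⟨ω⟩ := this
        exact (abs_nonneg _).trans (hD ω)
      have mF := FF_measurable p κ η lam hp hlam y0 φ K
      obtain ⟨M, hM⟩ := FF_bound p κ η lam hp hlam φ K
      have iF : Integrable (FF p κ η lam φ K) σ := integrable_of_abs_le σ _ mF M fun ω => by
        rw [abs_of_nonneg (FF_nonneg p κ η lam φ K ω)]; exact hM ω
      refine le_of_forall_pos_le_add fun ε hε => ?_
      obtain ⟨ξ, hc, hs, hξ⟩ := FF_approx σ p κ η lam hp hlam y0 φ K (ε / (D + 1)) (by positivity)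
      obtain ⟨C, hC⟩ := bound_of_compact hc hs
      have iB := integrable_Bf σ y0 p κ η lam hp hκ hη (gr_of_bounded (p := p) hlam y0 hc hC)
      have i1 : Integrable (fun ω => ζ ω * FF p κ η lam φ K ω) σ :=
        iF.bdd_mul hζ.1.aestronglyMeasurable (ae_of_all _ hD)
      have i2 : Integrable (fun ω => ζ ω * Bf lam p κ η ξ ω) σ :=
        iB.bdd_mul hζ.1.aestronglyMeasurable (ae_of_all _ hD)
      have i3 : Integrable (fun ω => max (FF p κ η lam φ K ω - Bf lam p κ η ξ ω) 0) σ :=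
        (iF.sub iB).pos_part
      have hle : ∫ ω, ζ ω * FF p κ η lam φ K ω ∂σ ≤ ∫ ω, (ζ ω * Bf lam p κ η ξ ω +
          D * max (FF p κ η lam φ K ω - Bf lam p κ η ξ ω) 0) ∂σ := by
        refine integral_mono i1 (i2.add (i3.const_mul D)) fun ω => ?_
        have a := hζ.2.2.1 ω
        have b := (abs_le.1 (hD ω)).2
        have c := le_max_left (FF p κ η lam φ K ω - Bf lam p κ η ξ ω) 0
        have d := le_max_right (FF p κ η lam φ K ω - Bf lam p κ η ξ ω) 0
        have e1 := mul_le_mul_of_nonneg_left c a.le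
        have e2 := mul_le_mul_of_nonneg_right b d
        simp only
        linarith
      rw [integral_add i2 (i3.const_mul D), integral_const_mul] at hle
      have h1 := hlow ξ hc hs ζ hζ
      have h2 := mul_le_mul_of_nonneg_left hξ hD0
      have h3 : D * (ε / (D + 1)) ≤ ε := by
        rw [← mul_div_assoc, div_le_iff₀ (by positivity)]
        nlinarith
      linarith
    have hK : ∀ K, eLpNorm (fun ω => ENNReal.ofReal (FF p κ η lam φ K ω)) r σ ≤
        ENNReal.ofReal s := by
      intro K
      obtain ⟨M, hM⟩ := FF_bound p κ η lam hp hlam φ K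
      have := dual_norm σ r r' hrr (FF p κ η lam φ K) (FF_measurable p κ η lam hp hlam y0 φ K) M
        (FF_nonneg p κ η lam φ K) hM s (hpair K)
      refine le_trans (eLpNorm_mono_enorm_ae (ae_of_all _ fun ω => ?_)) this
      rw [enorm_eq_self, Real.enorm_of_nonneg (FF_nonneg p κ η lam φ K ω)]
    have hr0 : r ≠ 0 := by
      rintro rfl; simp at hrr
    have hmono : Monotone (fun K ω => ENNReal.ofReal (FF p κ η lam φ K ω)) :=
      monotone_nat_of_le_succ fun K ω => ENNReal.ofReal_le_ofReal (le_max_left _ _)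
    have hsup := eLpNorm_iSup_le σ r hr0 _
      (fun K => (FF_measurable p κ η lam hp hlam y0 φ K).ennreal_ofReal) hmono _ hK
    have hfin : eLpNorm (fun ω => ENNReal.ofReal lam * MK p (κ ω) (η ω) ^ p) r σ ≤
        ENNReal.ofReal s := by
      refine le_trans (eLpNorm_mono_enorm_ae (ae_of_all _ fun ω => ?_)) hsup
      rw [enorm_eq_self, enorm_eq_self]
      refine (MK_le_iSup lam p hp hlam (κ ω) (η ω) φ hφ).trans (iSup_le fun k => ?_)
      refine le_trans (ENNReal.ofReal_le_ofReal ?_)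
        (le_iSup (fun K => ENNReal.ofReal (FF p κ η lam φ K ω)) (k + 1))
      exact le_max_right _ _
    refine (EReal.coe_ennreal_le_coe_ennreal_iff.2 hfin).trans ?_
    rw [EReal.coe_ennreal_ofReal, max_eq_left hs0]

end Final

/-- **The Legendre–Fenchel conjugate of the dual functional `H_{λ,m}`:**
for `m ∈ 𝒫^σ_{p,q}(Ω × Y)` (with disintegration `κ`) and any `n ∈ 𝒫^σ(Ω × Y)` with finite
`p`-th fiber moment (with disintegration `η`),
`sup_{f ∈ 𝒳_p} ( -∫ f dn - H_{λ,m}(f) ) = λ · scrMK_{p,q}(m,n)^p`,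
the right-hand side being `+∞` exactly when `n ∉ 𝒫^σ_{p,q}(Ω × Y)`. -/
theorem Hfun_conjugate
    {Ω : Type*} [MetricSpace Ω] [CompleteSpace Ω] [SecondCountableTopology Ω]
    [LocallyCompactSpace Ω] [MeasurableSpace Ω] [BorelSpace Ω]
    {Y : Type*} [MetricSpace Y] [Nonempty Y] [CompleteSpace Y] [SecondCountableTopology Y]
    [LocallyCompactSpace Y] [MeasurableSpace Y] [BorelSpace Y]
    (σ : Measure Ω) [IsProbabilityMeasure σ] (y0 : Y)
    (p : ℝ) (hp : 1 ≤ p) (q : ℝ≥0∞) (hpq : ENNReal.ofReal p ≤ q)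
    (r' : ℝ≥0∞) (hr' : 1 / (q / ENNReal.ofReal p) + 1 / r' = 1)
    (lam : ℝ) (hlam : lam ∈ Set.Ioc (0 : ℝ) 1)
    (κ : Kernel Ω Y) (hκ : MemP p q σ y0 κ)
    (η : Kernel Ω Y) [IsMarkovKernel η]
    (hηmom : ∫⁻ ω, ∫⁻ y, edist y0 y ^ p ∂(η ω) ∂σ ≠ ∞) :
    sSup {v : EReal | ∃ f : Ω × Y → ℝ, MemXp p y0 f ∧
        v = -(((∫ u, f u ∂(σ.compProd η) : ℝ)) : EReal) - Hfun p r' σ y0 lam κ f} =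
      ((ENNReal.ofReal lam * scrMK p q σ κ η ^ p : ℝ≥0∞) : EReal) := by
  have hlam0 : 0 < lam := hlam.1
  haveI : IsMarkovKernel κ := hκ.1
  have hκm := moment_of_MemP σ p hp q hpq y0 κ hκ
  have hrr : (q / ENNReal.ofReal p)⁻¹ + r'⁻¹ = 1 := by
    simpa only [one_div] using hr'
  rw [scrMK_eq_eLpNorm σ p hp q hpq κ η lam]
  refine le_antisymm (sSup_le ?_) ?_
  · rintro v ⟨f, -, rfl⟩
    exact upper_bound σ y0 p κ η lam hp hκm hηmom hlam0 _ r' hrr f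
  · exact lower_bound σ y0 p κ η lam hp hκm hηmom hlam0 _ r' hrr
end

section
/- Let (Ω,d_Ω) and (Y,d_Y) be complete separable metric spaces, σ a Borel probability measure on Ω, and fix y0 ∈ Y. Fix 1 < p < ∞, κ > 0, an integer K ≥ 2, weights λ_1,…,λ_K ∈ (0,1) with Σ_k λ_k = 1, and let Ω' ⊆ Ω be Borel with 0 < σ(Ω') < 1. Let μ_0, μ_1 ∈ 𝒫_p(Y) and define m_k := σ ⊗ μ_0 for 1 ≤ k ≤ K−1 and m_K := (σ|_{Ω'}) ⊗ μ_0 + (σ|_{Ω∖Ω'}) ⊗ μ_1. Suppose ν ∈ 𝒫_p(Y) minimizes the function (1−λ_K) MK_p(μ_0,·)^κ + λ_K MK_p(μ_1,·)^κ over 𝒫_p(Y), and let μ ∈ 𝒫_p(Y) satisfy MK_p(μ_0,μ) ≤ min{ MK_p(μ_0,ν), MK_p(μ_1,ν) }. Then the measure n_μ := (σ|_{Ω'}) ⊗ μ + (σ|_{Ω∖Ω'}) ⊗ ν belongs to 𝒫^σ_{p,∞}(Ω×Y) and minimizes n ↦ Σ_{k=1}^K λ_k scrMK_{p,∞}(m_k,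 n)^κ over 𝒫^σ_{p,∞}(Ω×Y). In particular, if min{ MK_p(μ_0,ν), MK_p(μ_1,ν) } > 0, this barycenter functional has more than one minimizer. -/
open MeasureTheory ProbabilityTheory ENNReal

/-- `μ` has finite `p`-th moment about the point `x0`. -/
def FiniteMoment {X : Type*} [PseudoEMetricSpace X] [MeasurableSpace X] (p : ℝ) (x0 : X)
    (μ : Measure X) : Prop :=
  ∫⁻ x, edist x0 x ^ p ∂μ ≠ ∞

/-- The kernel equal to `κ` on the measurable set `s` and to `η` off `s`. -/
noncomputable def piecewiseKernel {Ω Y : Type*} [MeasurableSpace Ω] [MeasurableSpace Y]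
    {s : Set Ω} (hs : MeasurableSet s) (κ η : Kernel Ω Y) : Kernel Ω Y :=
  @Kernel.piecewise _ _ _ _ s (Classical.decPred _) hs κ η

theorem MK_le_of_coupling {X : Type*} [PseudoEMetricSpace X] [MeasurableSpace X] (p : ℝ)
    {μ ν : Measure X} (γ : Measure (X × X)) (h1 : γ.map Prod.fst = μ) (h2 : γ.map Prod.snd = ν) :
    MK p μ ν ≤ (∫⁻ z, edist z.1 z.2 ^ p ∂γ) ^ (1 / p) :=
  iInf₂_le_of_le γ ⟨h1, h2⟩ le_rfl

section
variable {Y : Type*} [MetricSpace Y] [SecondCountableTopology Y] [MeasurableSpace Y] [BorelSpace Y]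

theorem finiteMoment_of_MK {p : ℝ} (hp : 1 < p) {y0 : Y} {ρ : Measure Y}
    (h : MK p (Measure.dirac y0) ρ ≠ ∞) : FiniteMoment p y0 ρ := by
  unfold MK at h
  rw [← lt_top_iff_ne_top] at h
  simp only [iInf_lt_iff] at h
  obtain ⟨γ, ⟨h1, h2⟩, hlt⟩ := h
  have hp0 : 0 < p := by linarith
  have hfin : ∫⁻ z, edist z.1 z.2 ^ p ∂γ ≠ ∞ := by
    intro h0
    rw [h0, ENNReal.top_rpow_of_pos (by positivity)] at hlt
    exact lt_irrefl _ hlt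
  unfold FiniteMoment
  have hm : Measurable (fun x : Y => edist y0 x ^ p) := by fun_prop
  rw [← h2, lintegral_map hm measurable_snd]
  have hae : ∀ᵐ z ∂γ, z.1 = y0 := by
    have : ∀ᵐ y ∂(γ.map Prod.fst), y = y0 := by
      rw [h1, ae_dirac_iff (measurableSet_eq)]
    exact ae_of_ae_map measurable_fst.aemeasurable this
  have : ∫⁻ z, edist y0 z.2 ^ p ∂γ = ∫⁻ z, edist z.1 z.2 ^ p ∂γ := by
    apply lintegral_congr_ae
    filter_upwards [hae] with z hz
    rw [hz]
  rw [this]; exact hfin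

theorem MK_dirac_ne_top {p : ℝ} (hp : 1 < p) {y0 : Y} {ρ : Measure Y} [IsProbabilityMeasure ρ]
    (h : FiniteMoment p y0 ρ) : MK p (Measure.dirac y0) ρ ≠ ∞ := by
  have hp0 : 0 < p := by linarith
  refine ne_top_of_le_ne_top ?_
    (MK_le_of_coupling p ((Measure.dirac y0).prod ρ) (by simp) (by simp))
  refine (ENNReal.rpow_lt_top_of_nonneg (by positivity) ?_).ne
  rw [Measure.dirac_prod, lintegral_map (by fun_prop) (by fun_prop)]
  exact h

theorem prod_cost_ne_top {p : ℝ} (hp : 1 < p) {y0 : Y} {μ ν : Measure Y} [IsProbabilityMeasure μ]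
    [IsProbabilityMeasure ν] (h1 : FiniteMoment p y0 μ) (h2 : FiniteMoment p y0 ν) :
    ∫⁻ z, edist z.1 z.2 ^ p ∂(μ.prod ν) ≠ ∞ := by
  have hp0 : 0 < p := by linarith
  have hle : ∫⁻ z, edist z.1 z.2 ^ p ∂(μ.prod ν) ≤
      ∫⁻ z, 2 ^ (p - 1) * (edist y0 z.1 ^ p + edist y0 z.2 ^ p) ∂(μ.prod ν) := by
    refine lintegral_mono fun z => ?_
    refine le_trans (ENNReal.rpow_le_rpow (edist_triangle_left z.1 z.2 y0) hp0.le) ?_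
    exact ENNReal.rpow_add_le_mul_rpow_add_rpow _ _ hp.le
  refine ne_top_of_le_ne_top ?_ hle
  rw [lintegral_const_mul _ (by fun_prop), lintegral_add_left (by fun_prop)]
  have e1 : ∫⁻ z, edist y0 z.1 ^ p ∂(μ.prod ν) = ∫⁻ x, edist y0 x ^ p ∂μ := by
    have := lintegral_map (μ := μ.prod ν) (f := fun x : Y => edist y0 x ^ p) (by fun_prop)
      measurable_fst
    rw [← this]; simp
  have e2 : ∫⁻ z, edist y0 z.2 ^ p ∂(μ.prod ν) = ∫⁻ x, edist y0 x ^ p ∂ν := by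
    have := lintegral_map (μ := μ.prod ν) (f := fun x : Y => edist y0 x ^ p) (by fun_prop)
      measurable_snd
    rw [← this]; simp
  rw [e1, e2]
  refine ENNReal.mul_ne_top (ENNReal.rpow_lt_top_of_nonneg (by linarith) (by simp)).ne ?_
  exact ENNReal.add_ne_top.2 ⟨h1, h2⟩

theorem MK_mix_le {p : ℝ} (hp : 1 < p) {μ ν : Measure Y} [IsProbabilityMeasure μ]
    [IsProbabilityMeasure ν] (a b : ℝ≥0∞) (hab : a + b = 1) :
    MK p μ (a • μ + b • ν) ≤ (b * ∫⁻ z, edist z.1 z.2 ^ p ∂(μ.prod ν)) ^ (1 / p) := by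
  have hp0 : 0 < p := by linarith
  have hd : Measurable (fun x : Y => (x, x)) := by fun_prop
  refine le_trans (MK_le_of_coupling p (a • μ.map (fun x => (x, x)) + b • μ.prod ν) ?_ ?_) ?_
  · rw [Measure.map_add _ _ measurable_fst, Measure.map_smul, Measure.map_smul,
      Measure.map_map measurable_fst hd]
    simp only [Function.comp_def, Measure.map_id', Measure.map_fst_prod, measure_univ, one_smul]
    rw [← add_smul, hab, one_smul]
  · rw [Measure.map_add _ _ measurable_snd, Measure.map_smul, Measure.map_smul,
      Measure.map_map measurable_snd hd]
    simp only [Function.comp_def, Measure.map_id', Measure.map_snd_prod, measure_univ, one_smul]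
  · rw [lintegral_add_measure, lintegral_smul_measure, lintegral_smul_measure,
      lintegral_map (by fun_prop) hd]
    simp [hp0]
end

/-- **Non-uniqueness of disintegrated barycenters for `q = ∞`** on the trivial bundle
`Ω × Y`.  With `m_k = σ ⊗ μ0` for `k < K` and `m_K` equal to `μ0` over `Ω'` and `μ1` off
`Ω'` (`0 < σ(Ω') < 1`), if `ν` minimizes `(1-λ_K) MK_p(μ0,·)^κ + λ_K MK_p(μ1,·)^κ` over
`𝒫_p(Y)` and `μ ∈ 𝒫_p(Y)` satisfies `MK_p(μ0,μ) ≤ min{MK_p(μ0,ν), MK_p(μ1,ν)}`, then the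
measure with fibers `μ` over `Ω'` and `ν` off `Ω'` lies in `𝒫^σ_{p,∞}(Ω × Y)` and
minimizes `n ↦ ∑ k λ_k scrMK_{p,∞}(m_k, n)^κ`.  In particular, if
`min{MK_p(μ0,ν), MK_p(μ1,ν)} > 0`, there is more than one minimizer. -/
theorem q_infty_barycenter_nonunique
    {Ω : Type*} [MetricSpace Ω] [CompleteSpace Ω] [SecondCountableTopology Ω]
    [MeasurableSpace Ω] [BorelSpace Ω]
    {Y : Type*} [MetricSpace Y] [CompleteSpace Y] [SecondCountableTopology Y]
    [MeasurableSpace Y] [BorelSpace Y]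
    (σ : Measure Ω) [IsProbabilityMeasure σ] (y0 : Y)
    (p κ0 : ℝ) (hp : 1 < p) (hκ0 : 0 < κ0)
    (K : ℕ) (hK : 2 ≤ K)
    (lam : Fin K → ℝ) (hlam : ∀ k, lam k ∈ Set.Ioo (0 : ℝ) 1) (hsum : ∑ k, lam k = 1)
    (lamK : ℝ) (hlamK : lamK = lam ⟨K - 1, by omega⟩)
    (Ω' : Set Ω) (hΩ'meas : MeasurableSet Ω') (hΩ'pos : 0 < σ Ω') (hΩ'lt : σ Ω' < 1)
    (μ0 μ1 : Measure Y) (hμ0 : IsProbabilityMeasure μ0) (hμ1 : IsProbabilityMeasure μ1)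
    (hμ0mom : FiniteMoment p y0 μ0) (hμ1mom : FiniteMoment p y0 μ1)
    (m : Fin K → Kernel Ω Y)
    (hmdef : ∀ k : Fin K, m k =
      if (k : ℕ) = K - 1 then
        piecewiseKernel hΩ'meas (Kernel.const Ω μ0) (Kernel.const Ω μ1)
      else Kernel.const Ω μ0)
    (ν : Measure Y) (hν : IsProbabilityMeasure ν) (hνmom : FiniteMoment p y0 ν)
    (hνmin : ∀ ρ : Measure Y, IsProbabilityMeasure ρ → FiniteMoment p y0 ρ →
      ENNReal.ofReal (1 - lamK) * MK p μ0 ν ^ κ0 + ENNReal.ofReal lamK * MK p μ1 ν ^ κ0 ≤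
        ENNReal.ofReal (1 - lamK) * MK p μ0 ρ ^ κ0 + ENNReal.ofReal lamK * MK p μ1 ρ ^ κ0)
    (μ : Measure Y) (hμ : IsProbabilityMeasure μ) (hμmom : FiniteMoment p y0 μ)
    (hμle : MK p μ0 μ ≤ min (MK p μ0 ν) (MK p μ1 ν)) :
    (MemP p ∞ σ y0 (piecewiseKernel hΩ'meas (Kernel.const Ω μ) (Kernel.const Ω ν)) ∧
      ∀ η : Kernel Ω Y, MemP p ∞ σ y0 η →
        ∑ k, ENNReal.ofReal (lam k) *
            scrMK p ∞ σ (m k)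
              (piecewiseKernel hΩ'meas (Kernel.const Ω μ) (Kernel.const Ω ν)) ^ κ0 ≤
          ∑ k, ENNReal.ofReal (lam k) * scrMK p ∞ σ (m k) η ^ κ0) ∧
      (0 < min (MK p μ0 ν) (MK p μ1 ν) →
        ∃ η1 η2 : Kernel Ω Y, MemP p ∞ σ y0 η1 ∧ MemP p ∞ σ y0 η2 ∧
          (∀ η : Kernel Ω Y, MemP p ∞ σ y0 η →
            ∑ k, ENNReal.ofReal (lam k) * scrMK p ∞ σ (m k) η1 ^ κ0 ≤
              ∑ k, ENNReal.ofReal (lam k) * scrMK p ∞ σ (m k) η ^ κ0) ∧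
          (∀ η : Kernel Ω Y, MemP p ∞ σ y0 η →
            ∑ k, ENNReal.ofReal (lam k) * scrMK p ∞ σ (m k) η2 ^ κ0 ≤
              ∑ k, ENNReal.ofReal (lam k) * scrMK p ∞ σ (m k) η ^ κ0) ∧
          ¬ (∀ᵐ ω ∂σ, η1 ω = η2 ω)) := by
  have hp0 : 0 < p := by linarith
  have hpw : ∀ (α β : Measure Y) (ω : Ω),
      (ω ∈ Ω' → piecewiseKernel hΩ'meas (Kernel.const Ω α) (Kernel.const Ω β) ω = α) ∧
      (ω ∉ Ω' → piecewiseKernel hΩ'meas (Kernel.const Ω α) (Kernel.const Ω β) ω = β) := by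
    intro α β ω
    constructor <;> intro h <;> simp [piecewiseKernel, Kernel.piecewise, h]
  have hscr : ∀ κ η : Kernel Ω Y, scrMK p ∞ σ κ η = essSup (fun ω => MK p (κ ω) (η ω)) σ := by
    intro κ η; simp [scrMK]
  -- the weights
  set last : Fin K := ⟨K - 1, by omega⟩ with hlast
  have hsplit : ∀ η : Kernel Ω Y, ∑ k, ENNReal.ofReal (lam k) * scrMK p ∞ σ (m k) η ^ κ0 =
      ENNReal.ofReal (1 - lamK) * scrMK p ∞ σ (Kernel.const Ω μ0) η ^ κ0 +
      ENNReal.ofReal lamK * scrMK p ∞ σ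
        (piecewiseKernel hΩ'meas (Kernel.const Ω μ0) (Kernel.const Ω μ1)) η ^ κ0 := by
    intro η
    rw [← Finset.sum_erase_add _ _ (Finset.mem_univ last)]
    congr 1
    · have h1 : 1 - lamK = ∑ k ∈ Finset.univ.erase last, lam k := by
        rw [← hsum, ← Finset.sum_erase_add _ _ (Finset.mem_univ last), hlamK]; ring
      rw [h1, ENNReal.ofReal_sum_of_nonneg (fun k _ => (hlam k).1.le), Finset.sum_mul]
      refine Finset.sum_congr rfl fun k hk => ?_
      have hk' : (k : ℕ) ≠ K - 1 := fun h => (Finset.ne_of_mem_erase hk) (Fin.ext h)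
      rw [hmdef k, if_neg hk']
    · rw [hmdef last, if_pos rfl, hlamK]
  have hcompl : σ Ω'ᶜ ≠ 0 := by
    rw [prob_compl_eq_one_sub hΩ'meas]
    exact (tsub_pos_of_lt hΩ'lt).ne'
  have hlower : ∀ η : Kernel Ω Y, MemP p ∞ σ y0 η →
      ENNReal.ofReal (1 - lamK) * MK p μ0 ν ^ κ0 + ENNReal.ofReal lamK * MK p μ1 ν ^ κ0 ≤
      ∑ k, ENNReal.ofReal (lam k) * scrMK p ∞ σ (m k) η ^ κ0 := by
    intro η ⟨hη1, hη2⟩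
    rw [hsplit, hscr, hscr]
    rw [hscr] at hη2
    have hA := ENNReal.ae_le_essSup (μ := σ)
      (fun ω => MK p (Kernel.const Ω (Measure.dirac y0) ω) (η ω))
    have hB := ENNReal.ae_le_essSup (μ := σ) (fun ω => MK p (Kernel.const Ω μ0 ω) (η ω))
    have hC := ENNReal.ae_le_essSup (μ := σ) (fun ω => MK p
      (piecewiseKernel hΩ'meas (Kernel.const Ω μ0) (Kernel.const Ω μ1) ω) (η ω))
    have hfreq : ∃ᵐ ω ∂σ, ω ∈ Ω'ᶜ := frequently_ae_mem_iff.2 hcompl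
    obtain ⟨ω, hω, hAω, hBω, hCω⟩ := (hfreq.and_eventually (hA.and (hB.and hC))).exists
    rw [(hpw μ0 μ1 ω).2 hω] at hCω
    rw [Kernel.const_apply] at hAω hBω
    refine (hνmin (η ω) inferInstance
      (finiteMoment_of_MK hp (ne_top_of_le_ne_top hη2 hAω))).trans ?_
    gcongr
  have key : ∀ μ : Measure Y, IsProbabilityMeasure μ → FiniteMoment p y0 μ →
      MK p μ0 μ ≤ min (MK p μ0 ν) (MK p μ1 ν) →
      (MemP p ∞ σ y0 (piecewiseKernel hΩ'meas (Kernel.const Ω μ) (Kernel.const Ω ν)) ∧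
      ∀ η : Kernel Ω Y, MemP p ∞ σ y0 η →
        ∑ k, ENNReal.ofReal (lam k) *
            scrMK p ∞ σ (m k)
              (piecewiseKernel hΩ'meas (Kernel.const Ω μ) (Kernel.const Ω ν)) ^ κ0 ≤
          ∑ k, ENNReal.ofReal (lam k) * scrMK p ∞ σ (m k) η ^ κ0) := by
    intro μ hμ hμmom hμle
    refine ⟨⟨⟨fun ω => ?_⟩, ?_⟩, fun η hη => le_trans ?_ (hlower η hη)⟩
    · by_cases h : ω ∈ Ω'
      · rw [(hpw μ ν ω).1 h]; exact hμ
      · rw [(hpw μ ν ω).2 h]; exact hν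
    · rw [hscr]
      refine ne_top_of_le_ne_top (max_ne_top (MK_dirac_ne_top hp hμmom) (MK_dirac_ne_top hp hνmom))
        (essSup_le_of_ae_le _ (Filter.Eventually.of_forall fun ω => ?_))
      by_cases h : ω ∈ Ω'
      · simp only [(hpw μ ν ω).1 h, Kernel.const_apply]; exact le_max_left _ _
      · simp only [(hpw μ ν ω).2 h, Kernel.const_apply]; exact le_max_right _ _
    · rw [hsplit, hscr, hscr]
      gcongr
      · refine essSup_le_of_ae_le _ (Filter.Eventually.of_forall fun ω => ?_)
        by_cases h : ω ∈ Ω'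
        · simp only [(hpw μ ν ω).1 h, Kernel.const_apply]; exact hμle.trans (min_le_left _ _)
        · simp only [(hpw μ ν ω).2 h, Kernel.const_apply]; exact le_rfl
      · refine essSup_le_of_ae_le _ (Filter.Eventually.of_forall fun ω => ?_)
        by_cases h : ω ∈ Ω'
        · simp only [(hpw μ ν ω).1 h, (hpw μ0 μ1 ω).1 h]; exact hμle.trans (min_le_right _ _)
        · simp only [(hpw μ ν ω).2 h, (hpw μ0 μ1 ω).2 h]; exact le_rfl
  refine ⟨key μ hμ hμmom hμle, fun hpos => ?_⟩
  have hself : MK p μ0 μ0 = 0 := by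
    have := MK_mix_le hp (μ := μ0) (ν := μ0) 1 0 (by simp)
    simpa [hp0] using this
  obtain ⟨ε, hε, hεlt⟩ := ENNReal.exists_nnreal_pos_mul_lt (prod_cost_ne_top hp hμ0mom hνmom)
    (b := min (MK p μ0 ν) (MK p μ1 ν) ^ p) (by simp [hpos.ne', hp0, ENNReal.rpow_eq_zero_iff]; grind)
  set b : ℝ≥0∞ := min (ε : ℝ≥0∞) 1 with hb
  have hb1 : b ≤ 1 := min_le_right _ _
  have hb0 : b ≠ 0 := by
    have : (0 : ℝ≥0∞) < ε := by exact_mod_cast hε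
    exact (lt_min this one_pos).ne'
  have hbt : b ≠ ∞ := ne_top_of_le_ne_top one_ne_top hb1
  have hab : (1 - b) + b = 1 := tsub_add_cancel_of_le hb1
  set μ' : Measure Y := (1 - b) • μ0 + b • ν with hμ'
  have hμ'p : IsProbabilityMeasure μ' := ⟨by simp [hμ', hab]⟩
  have hμ'm : FiniteMoment p y0 μ' := by
    unfold FiniteMoment
    rw [hμ', lintegral_add_measure, lintegral_smul_measure, lintegral_smul_measure]
    exact ENNReal.add_ne_top.2 ⟨ENNReal.mul_ne_top (by simp) hμ0mom, ENNReal.mul_ne_top hbt hνmom⟩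
  have hμ'le : MK p μ0 μ' ≤ min (MK p μ0 ν) (MK p μ1 ν) := by
    refine (MK_mix_le hp _ _ hab).trans ?_
    rw [one_div, ENNReal.rpow_inv_le_iff hp0]
    refine le_trans ?_ hεlt.le
    gcongr
    exact min_le_left _ _
  have hne : μ0 ≠ μ' := by
    intro h
    have hν0 : μ0 = ν := by
      ext s hs
      have h2 : μ0 s = (1 - b) * μ0 s + b * ν s := by
        conv_lhs => rw [h]
        simp [hμ']
      have h3 : (1 - b) * μ0 s + b * μ0 s = (1 - b) * μ0 s + b * ν s := by
        rw [← h2, ← add_mul, hab, one_mul]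
      have h4 := (ENNReal.add_right_inj (ENNReal.mul_ne_top (by simp) (measure_ne_top _ _))).1 h3
      exact (ENNReal.mul_right_inj hb0 hbt).1 h4
    rw [← hν0, hself] at hpos
    simp at hpos
  obtain ⟨a1, a2⟩ := key μ0 hμ0 hμ0mom (by rw [hself]; exact zero_le)
  obtain ⟨b1, b2⟩ := key μ' hμ'p hμ'm hμ'le
  refine ⟨_, _, a1, b1, a2, b2, fun hae => ?_⟩
  obtain ⟨ω, hω, h⟩ := ((frequently_ae_mem_iff.2 hΩ'pos.ne').and_eventually hae).exists
  rw [(hpw _ _ ω).1 hω, (hpw _ _ ω).1 hω] at h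
  exact hne h
end
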